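/- arXiv:0905.1150 — 2 statements merged into one kernel-verified Lean document; each statement's English description precedes it below -/
import Mathlib

section
/- Let n ≥ 9 be an even integer, D = (d_{ij}) a standardized n×n array, π chosen uniformly at random from Π_n, and W = Σ_{i=1}^n d_{iπ(i)}. Then ||F_W − Φ||_1 ≤ (β_D/n)·(224 + 1344/n + 384/n²), and in particular ||F_W − Φ||_1 ≤ 379 β_D / n. -/
open Finset MeasureTheory ProbabilityTheory
open scoped ENNReal

noncomputable def stdNormalCDF (t : ℝ) : ℝ :=
  (Real.sqrt (2 * Real.pi))⁻¹ * ∫ x in Set.Iic t, Real.exp (-(x ^ 2) / 2)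

/-- The set of fixed-point-free involutions of `{1,…,n}`. -/
def fpfInvolutions (n : ℕ) : Finset (Equiv.Perm (Fin n)) :=
  Finset.univ.filter fun π => π * π = 1 ∧ ∀ i, π i ≠ i

section Involutions

variable {n : ℕ} {π : Equiv.Perm (Fin n)} {i m : Fin n}

lemma fpfInvolutions_apply_apply (hπ : π ∈ fpfInvolutions n) (x : Fin n) : π (π x) = x := by
  have h := (Finset.mem_filter.1 hπ).2.1
  rw [← Equiv.Perm.mul_apply, h, Equiv.Perm.one_apply]

lemma fpfInvolutions_apply_ne (hπ : π ∈ fpfInvolutions n) (x : Fin n) : π x ≠ x :=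
  (Finset.mem_filter.1 hπ).2.2 x

lemma fpfInvolutions_nonempty (hn : Even n) : (fpfInvolutions n).Nonempty := by
  refine ⟨Fin.revPerm, Finset.mem_filter.2 ⟨Finset.mem_univ _, ?_, fun i h => ?_⟩⟩
  · ext x
    simp
  · have h' := congrArg Fin.val h
    simp only [Fin.revPerm_apply, Fin.val_rev] at h'
    obtain ⟨k, hk⟩ := hn
    omega

/-- The conjugate of `π` by the transposition of `π i` and `m`; it matches `i` with `m`. -/
def rematch (π : Equiv.Perm (Fin n)) (i m : Fin n) : Equiv.Perm (Fin n) :=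
  Equiv.swap (π i) m * π * Equiv.swap (π i) m

lemma rematch_mem (hπ : π ∈ fpfInvolutions n) (i m : Fin n) :
    rematch π i m ∈ fpfInvolutions n := by
  refine Finset.mem_filter.2 ⟨Finset.mem_univ _, ?_, fun x h => ?_⟩
  · ext x
    simp [rematch, fpfInvolutions_apply_apply hπ]
  · refine fpfInvolutions_apply_ne hπ (Equiv.swap (π i) m x) ?_
    simp only [rematch, Equiv.Perm.mul_apply] at h
    simpa using congrArg (Equiv.swap (π i) m) h

lemma rematch_apply_left (hπ : π ∈ fpfInvolutions n) (hm : m ≠ i) : rematch π i m i = m := by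
  simp [rematch, Equiv.swap_apply_of_ne_of_ne (fpfInvolutions_apply_ne hπ i).symm hm.symm]

lemma rematch_rematch (hπ : π ∈ fpfInvolutions n) (hm : m ≠ i) :
    rematch (rematch π i m) i (π i) = π := by
  rw [rematch, rematch_apply_left hπ hm, rematch, Equiv.swap_comm m]
  ext x
  simp

/-- Rematching `i` with a uniformly chosen partner preserves the uniform distribution. -/
lemma sum_rematch (ψ : Equiv.Perm (Fin n) → ℝ) (i : Fin n) :
    ∑ π ∈ fpfInvolutions n, ∑ m ∈ univ.erase i, ψ (rematch π i m) =
      ((n : ℝ) - 1) * ∑ π ∈ fpfInvolutions n, ψ π := by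
  have hn : 1 ≤ n := Nat.one_le_iff_ne_zero.2 (by rintro rfl; exact i.elim0)
  have hcard : ((univ.erase i).card : ℝ) = (n : ℝ) - 1 := by
    rw [Finset.card_erase_of_mem (Finset.mem_univ i), Finset.card_univ, Fintype.card_fin]
    push_cast [hn]
    ring
  have hR : ((n : ℝ) - 1) * ∑ π ∈ fpfInvolutions n, ψ π =
      ∑ π ∈ fpfInvolutions n, ∑ _m ∈ univ.erase i, ψ π := by
    simp only [Finset.sum_const, nsmul_eq_mul, hcard, Finset.mul_sum]
  rw [hR, ← Finset.sum_product', ← Finset.sum_product']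
  refine Finset.sum_nbij' (fun p => (rematch p.1 i p.2, p.1 i))
    (fun p => (rematch p.1 i p.2, p.1 i)) ?_ ?_ ?_ ?_ ?_
  · rintro ⟨π, m⟩ h
    simp only [Finset.mem_product, Finset.mem_erase, Finset.mem_univ, and_true] at h ⊢
    exact ⟨rematch_mem h.1 _ _, fpfInvolutions_apply_ne h.1 i⟩
  · rintro ⟨π, m⟩ h
    simp only [Finset.mem_product, Finset.mem_erase, Finset.mem_univ, and_true] at h ⊢
    exact ⟨rematch_mem h.1 _ _, fpfInvolutions_apply_ne h.1 i⟩
  · rintro ⟨π, m⟩ h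
    simp only [Finset.mem_product, Finset.mem_erase, Finset.mem_univ, and_true] at h
    simp only [rematch_rematch h.1 h.2, rematch_apply_left h.1 h.2]
  · rintro ⟨π, m⟩ h
    simp only [Finset.mem_product, Finset.mem_erase, Finset.mem_univ, and_true] at h
    simp only [rematch_rematch h.1 h.2, rematch_apply_left h.1 h.2]
  · rintro ⟨π, m⟩ _
    rfl

/-- The effect of rematching on a sum over matched pairs. -/
lemma sum_apply_rematch (u : Fin n → Fin n → ℝ) (hπ : π ∈ fpfInvolutions n) (hm : m ≠ i) :
    ∑ x, u x (rematch π i m x) = ∑ x, u x (π x) + (u i m - u i (π i)) + (u m i - u m (π m)) +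
      (u (π i) (π m) - u (π i) i) + (u (π m) (π i) - u (π m) m) := by
  have hinv := fpfInvolutions_apply_apply hπ
  have hne := fpfInvolutions_apply_ne hπ
  by_cases hk : π i = m
  · subst hk
    simp [rematch, hinv]
  have hip : i ≠ π m := fun h => hk (by rw [h, hinv])
  have hkp : π i ≠ π m := fun h => hm (π.injective h).symm
  have hσk : rematch π i m (π i) = π m := by
    simp [rematch, Equiv.swap_apply_of_ne_of_ne hkp.symm (hne m)]
  have hσm : rematch π i m m = i := by
    simp [rematch, hinv, Equiv.swap_apply_of_ne_of_ne (hne i).symm hm.symm]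
  have hσp : rematch π i m (π m) = π i := by
    simp [rematch, Equiv.swap_apply_of_ne_of_ne hkp.symm (hne m), hinv]
  have hσ : ∀ x, x ∉ ({i, m, π i, π m} : Finset (Fin n)) → rematch π i m x = π x := by
    intro x hx
    simp only [Finset.mem_insert, Finset.mem_singleton, not_or] at hx
    obtain ⟨h1, h2, h3, h4⟩ := hx
    have h5 : π x ≠ π i := fun h => h1 (π.injective h)
    have h6 : π x ≠ m := fun h => h4 (by rw [← h, hinv])
    simp [rematch, Equiv.swap_apply_of_ne_of_ne h3 h2, Equiv.swap_apply_of_ne_of_ne h5 h6]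
  have key : ∑ x, (u x (rematch π i m x) - u x (π x)) =
      ∑ x ∈ ({i, m, π i, π m} : Finset (Fin n)), (u x (rematch π i m x) - u x (π x)) := by
    symm
    refine Finset.sum_subset (Finset.subset_univ _) fun x _ hx => ?_
    rw [hσ x hx, sub_self]
  rw [Finset.sum_sub_distrib, Finset.sum_insert (by simp [hm.symm, (hne i).symm, hip]),
    Finset.sum_insert (by simp [Ne.symm hk, (hne m).symm]),
    Finset.sum_insert (by simp [hkp]), Finset.sum_singleton, hσk, hσm, hσp,
    rematch_apply_left hπ hm, hinv, hinv] at key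
  linarith

lemma sum_sum_apply (χ : Fin n → Fin n → ℝ) (hχ : ∀ i, χ i i = 0) :
    ((n : ℝ) - 1) * ∑ π ∈ fpfInvolutions n, ∑ i, χ i (π i) =
      (fpfInvolutions n).card * ∑ i, ∑ j, χ i j := by
  rw [Finset.sum_comm, Finset.mul_sum, Finset.mul_sum]
  refine Finset.sum_congr rfl fun i _ => ?_
  rw [← sum_rematch (fun π => χ i (π i)) i, ← nsmul_eq_mul, ← Finset.sum_const]
  refine Finset.sum_congr rfl fun π hπ => ?_
  rw [← Finset.sum_erase univ (hχ i)]
  refine Finset.sum_congr rfl fun m hm => ?_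
  rw [rematch_apply_left hπ (Finset.ne_of_mem_erase hm)]

end Involutions

section NormalTail

open Filter Topology

/-- The standard normal density. -/
noncomputable def stdNormalPDF (x : ℝ) : ℝ :=
  (Real.sqrt (2 * Real.pi))⁻¹ * Real.exp (-(x ^ 2) / 2)

/-- The upper tail of the standard normal distribution. -/
noncomputable def stdNormalTail (x : ℝ) : ℝ := ∫ t in Set.Ioi x, stdNormalPDF t

lemma stdNormalPDF_eq : stdNormalPDF = gaussianPDFReal 0 1 := by
  ext x
  simp [stdNormalPDF, gaussianPDFReal_def]

lemma stdNormalPDF_pos (x : ℝ) : 0 < stdNormalPDF x := by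
  unfold stdNormalPDF
  positivity

lemma stdNormalPDF_neg (x : ℝ) : stdNormalPDF (-x) = stdNormalPDF x := by
  simp [stdNormalPDF]

lemma stdNormalPDF_le_one (x : ℝ) : stdNormalPDF x ≤ 1 := by
  unfold stdNormalPDF
  have h1 : (Real.sqrt (2 * Real.pi))⁻¹ ≤ 1 := by
    refine inv_le_one_of_one_le₀ (Real.one_le_sqrt.2 ?_)
    linarith [Real.pi_gt_three]
  have h2 : Real.exp (-(x ^ 2) / 2) ≤ 1 := Real.exp_le_one_iff.2 (by nlinarith [sq_nonneg x])
  exact mul_le_one₀ h1 (Real.exp_nonneg _) h2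

lemma continuous_stdNormalPDF : Continuous stdNormalPDF := by
  unfold stdNormalPDF
  fun_prop

lemma hasDerivAt_stdNormalPDF (x : ℝ) : HasDerivAt stdNormalPDF (-(x * stdNormalPDF x)) x := by
  have h := ((((hasDerivAt_id x).pow 2).neg.div_const 2).exp).const_mul
    (Real.sqrt (2 * Real.pi))⁻¹
  refine h.congr_deriv ?_
  simp [stdNormalPDF]
  ring

lemma integrable_stdNormalPDF : Integrable stdNormalPDF := by
  rw [stdNormalPDF_eq]
  exact integrable_gaussianPDFReal 0 1

lemma integral_stdNormalPDF : ∫ x, stdNormalPDF x = 1 := by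
  rw [stdNormalPDF_eq]
  exact integral_gaussianPDFReal_eq_one 0 one_ne_zero

lemma tendsto_mul_stdNormalPDF : Tendsto (fun x => x * stdNormalPDF x) atTop (𝓝 0) := by
  have h := (Real.tendsto_pow_mul_exp_neg_atTop_nhds_zero 1).mul_const
    ((Real.sqrt (2 * Real.pi))⁻¹ * Real.exp (1 / 2))
  rw [zero_mul] at h
  refine tendsto_of_tendsto_of_tendsto_of_le_of_le' tendsto_const_nhds h ?_ ?_
  · filter_upwards [eventually_ge_atTop 0] with x hx
    exact mul_nonneg hx (stdNormalPDF_pos x).le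
  · filter_upwards [eventually_ge_atTop 0] with x hx
    have he : Real.exp (-(x ^ 2) / 2) ≤ Real.exp (-x) * Real.exp (1 / 2) := by
      rw [← Real.exp_add]
      exact Real.exp_le_exp.2 (by nlinarith [sq_nonneg (x - 1)])
    calc x * stdNormalPDF x
        ≤ x * ((Real.sqrt (2 * Real.pi))⁻¹ * (Real.exp (-x) * Real.exp (1 / 2))) := by
          unfold stdNormalPDF
          gcongr
      _ = _ := by ring

lemma tendsto_stdNormalPDF : Tendsto stdNormalPDF atTop (𝓝 0) := by
  refine tendsto_of_tendsto_of_tendsto_of_le_of_le' tendsto_const_nhds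
    tendsto_mul_stdNormalPDF (Eventually.of_forall fun x => (stdNormalPDF_pos x).le) ?_
  filter_upwards [eventually_ge_atTop 1] with x hx
  exact le_mul_of_one_le_left (stdNormalPDF_pos x).le hx

lemma hasDerivAt_integral_Ioi {k : ℝ → ℝ} (hk : Continuous k)
    (hint : ∀ a, IntegrableOn k (Set.Ioi a)) (x : ℝ) :
    HasDerivAt (fun x => ∫ t in Set.Ioi x, k t) (-k x) x := by
  have h := (intervalIntegral.integral_hasDerivAt_right (hk.intervalIntegrable x x)
    (hk.stronglyMeasurableAtFilter _ _) hk.continuousAt).const_sub (∫ t in Set.Ioi x, k t)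
  refine h.congr_of_eventuallyEq (Eventually.of_forall fun y => ?_)
  have := intervalIntegral.integral_Ioi_sub_Ioi' (hint x) (hint y)
  simp only
  linarith

lemma hasDerivAt_stdNormalTail (x : ℝ) : HasDerivAt stdNormalTail (-stdNormalPDF x) x :=
  hasDerivAt_integral_Ioi continuous_stdNormalPDF
    (fun _ => integrable_stdNormalPDF.integrableOn) x

lemma continuous_stdNormalTail : Continuous stdNormalTail :=
  continuous_iff_continuousAt.2 fun x => (hasDerivAt_stdNormalTail x).continuousAt

lemma stdNormalTail_nonneg (x : ℝ) : 0 ≤ stdNormalTail x :=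
  setIntegral_nonneg measurableSet_Ioi fun t _ => (stdNormalPDF_pos t).le

lemma stdNormalCDF_eq_tail (x : ℝ) : stdNormalCDF x = stdNormalTail (-x) := by
  rw [stdNormalTail, ← integral_comp_neg_Iic, stdNormalCDF, ← integral_const_mul]
  simp only [stdNormalPDF_neg]
  rfl

lemma stdNormalTail_neg (x : ℝ) : stdNormalTail (-x) = 1 - stdNormalTail x := by
  have h := intervalIntegral.integral_Iic_add_Ioi (b := x)
    (integrable_stdNormalPDF.integrableOn) (integrable_stdNormalPDF.integrableOn)
  rw [integral_stdNormalPDF] at h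
  rw [stdNormalTail, ← integral_comp_neg_Iic, stdNormalTail]
  simp only [stdNormalPDF_neg]
  linarith

lemma stdNormalTail_le_one (x : ℝ) : stdNormalTail x ≤ 1 := by
  have := stdNormalTail_nonneg (-x)
  rw [stdNormalTail_neg] at this
  linarith

lemma mul_stdNormalTail_le (x : ℝ) : x * stdNormalTail x ≤ stdNormalPDF x := by
  rcases le_total x 0 with hx | hx
  · exact (mul_nonpos_of_nonpos_of_nonneg hx (stdNormalTail_nonneg x)).trans
      (stdNormalPDF_pos x).le
  have hneg : ∀ t ∈ Set.Ioi x, -(t * stdNormalPDF t) ≤ 0 := fun t ht =>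
    neg_nonpos.2 (mul_nonneg (hx.trans (le_of_lt ht)) (stdNormalPDF_pos t).le)
  have hderiv : ∀ t ∈ Set.Ici x, HasDerivAt stdNormalPDF (-(t * stdNormalPDF t)) t :=
    fun t _ => hasDerivAt_stdNormalPDF t
  have hint := integrableOn_Ioi_deriv_of_nonpos' hderiv hneg tendsto_stdNormalPDF
  have heq := integral_Ioi_of_hasDerivAt_of_nonpos' hderiv hneg tendsto_stdNormalPDF
  have hle : ∫ t in Set.Ioi x, -(t * stdNormalPDF t) ≤ ∫ t in Set.Ioi x, -(x * stdNormalPDF t) := by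
    refine setIntegral_mono_on hint
      ((integrable_stdNormalPDF.integrableOn.const_mul x).neg) measurableSet_Ioi fun t ht => ?_
    exact neg_le_neg (mul_le_mul_of_nonneg_right (le_of_lt ht) (stdNormalPDF_pos t).le)
  rw [heq, integral_neg, integral_const_mul] at hle
  unfold stdNormalTail
  linarith

lemma hasDerivAt_integratedTail (x : ℝ) :
    HasDerivAt (fun x => stdNormalPDF x - x * stdNormalTail x) (-stdNormalTail x) x := by
  have h := (hasDerivAt_stdNormalPDF x).sub ((hasDerivAt_id x).mul (hasDerivAt_stdNormalTail x))
  refine h.congr_deriv ?_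
  simp

lemma tendsto_integratedTail :
    Tendsto (fun x => stdNormalPDF x - x * stdNormalTail x) atTop (𝓝 0) := by
  refine tendsto_of_tendsto_of_tendsto_of_le_of_le' tendsto_const_nhds tendsto_stdNormalPDF
    (Eventually.of_forall fun x => sub_nonneg.2 (mul_stdNormalTail_le x)) ?_
  filter_upwards [eventually_ge_atTop 0] with x hx
  exact sub_le_self _ (mul_nonneg hx (stdNormalTail_nonneg x))

lemma integrableOn_stdNormalTail (a : ℝ) : IntegrableOn stdNormalTail (Set.Ioi a) := by
  have h := integrableOn_Ioi_deriv_of_nonpos' (a := a)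
    (fun x _ => hasDerivAt_integratedTail x)
    (fun x _ => neg_nonpos.2 (stdNormalTail_nonneg x)) tendsto_integratedTail
  simpa using h.neg

lemma integral_stdNormalTail (a : ℝ) :
    ∫ t in Set.Ioi a, stdNormalTail t = stdNormalPDF a - a * stdNormalTail a := by
  have h := integral_Ioi_of_hasDerivAt_of_nonpos' (a := a)
    (fun x _ => hasDerivAt_integratedTail x)
    (fun x _ => neg_nonpos.2 (stdNormalTail_nonneg x)) tendsto_integratedTail
  rw [integral_neg] at h
  linarith

/-- The Mills ratio lower bound. -/
lemma mul_stdNormalPDF_le (x : ℝ) : x * stdNormalPDF x ≤ (1 + x ^ 2) * stdNormalTail x := by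
  have hderiv : ∀ x, HasDerivAt (fun x => (1 + x ^ 2) * stdNormalTail x - x * stdNormalPDF x)
      (-(2 * (stdNormalPDF x - x * stdNormalTail x))) x := by
    intro x
    have h := ((((hasDerivAt_id x).pow 2).const_add 1).mul (hasDerivAt_stdNormalTail x)).sub
      ((hasDerivAt_id x).mul (hasDerivAt_stdNormalPDF x))
    refine h.congr_deriv ?_
    simp
    ring
  have hanti : Antitone (fun x => (1 + x ^ 2) * stdNormalTail x - x * stdNormalPDF x) := by
    refine antitone_of_deriv_nonpos (fun x => (hderiv x).differentiableAt) fun x => ?_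
    rw [(hderiv x).deriv]
    linarith [mul_stdNormalTail_le x]
  have hlim := tendsto_mul_stdNormalPDF.neg
  rw [neg_zero] at hlim
  refine sub_nonneg.1 (le_of_tendsto hlim ?_)
  filter_upwards [eventually_ge_atTop x] with a ha
  have h1 := hanti ha
  have h2 : 0 ≤ (1 + a ^ 2) * stdNormalTail a :=
    mul_nonneg (by positivity) (stdNormalTail_nonneg a)
  simp only at h1
  linarith

end NormalTail

section SteinEquation

variable {s : ℝ → ℝ}

/-- The integral of `s` against the normal tail over a half-line. -/
noncomputable def tailIntegral (s : ℝ → ℝ) (x : ℝ) : ℝ := ∫ t in Set.Ioi x, s t * stdNormalTail t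

lemma integrableOn_mul_stdNormalTail (hs : Continuous s) (hs1 : ∀ x, |s x| ≤ 1) (a : ℝ) :
    IntegrableOn (fun t => s t * stdNormalTail t) (Set.Ioi a) :=
  (integrableOn_stdNormalTail a).bdd_mul (c := 1) hs.aestronglyMeasurable
    (Filter.Eventually.of_forall hs1)

lemma hasDerivAt_tailIntegral (hs : Continuous s) (hs1 : ∀ x, |s x| ≤ 1) (x : ℝ) :
    HasDerivAt (tailIntegral s) (-(s x * stdNormalTail x)) x :=
  hasDerivAt_integral_Ioi (k := fun t => s t * stdNormalTail t)
    (hs.mul continuous_stdNormalTail)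
    (integrableOn_mul_stdNormalTail hs hs1) x

lemma abs_tailIntegral_le (hs1 : ∀ x, |s x| ≤ 1) (x : ℝ) :
    |tailIntegral s x| ≤ stdNormalPDF x - x * stdNormalTail x := by
  rw [← integral_stdNormalTail]
  refine norm_integral_le_of_norm_le (f := fun t => s t * stdNormalTail t)
    (integrableOn_stdNormalTail x) (Filter.Eventually.of_forall fun t => ?_)
  rw [norm_mul, Real.norm_eq_abs, Real.norm_eq_abs, abs_of_nonneg (stdNormalTail_nonneg t)]
  exact mul_le_of_le_one_left (stdNormalTail_nonneg t) (hs1 t)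

/-- The centred test function with derivative `s`. -/
noncomputable def steinTest (s : ℝ → ℝ) (x : ℝ) : ℝ :=
  tailIntegral (fun t => s (-t)) (-x) - tailIntegral s x

/-- The solution of the Stein equation for the test function with derivative `s`. -/
noncomputable def steinSol (s : ℝ → ℝ) (x : ℝ) : ℝ :=
  -(stdNormalTail x * tailIntegral (fun t => s (-t)) (-x) +
    (1 - stdNormalTail x) * tailIntegral s x) / stdNormalPDF x

/-- The derivative of `steinSol s`. -/
noncomputable def steinSolDeriv (s : ℝ → ℝ) (x : ℝ) : ℝ := x * steinSol s x + steinTest s x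

lemma hasDerivAt_tailIntegral_neg (hs : Continuous s) (hs1 : ∀ x, |s x| ≤ 1) (x : ℝ) :
    HasDerivAt (fun x => tailIntegral (fun t => s (-t)) (-x))
      (s x * (1 - stdNormalTail x)) x := by
  have h := (hasDerivAt_tailIntegral (s := fun t => s (-t)) (by fun_prop)
    (fun t => hs1 (-t)) (-x)).comp x (hasDerivAt_neg x)
  refine h.congr_deriv ?_
  rw [stdNormalTail_neg]
  simp

lemma hasDerivAt_steinTest (hs : Continuous s) (hs1 : ∀ x, |s x| ≤ 1) (x : ℝ) :
    HasDerivAt (steinTest s) (s x) x := by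
  refine ((hasDerivAt_tailIntegral_neg hs hs1 x).sub
    (hasDerivAt_tailIntegral hs hs1 x)).congr_deriv ?_
  ring

lemma hasDerivAt_steinSol (hs : Continuous s) (hs1 : ∀ x, |s x| ≤ 1) (x : ℝ) :
    HasDerivAt (steinSol s) (steinSolDeriv s x) x := by
  have hp := (stdNormalPDF_pos x).ne'
  have hT := hasDerivAt_stdNormalTail x
  have h := (((hT.mul (hasDerivAt_tailIntegral_neg hs hs1 x)).add
    ((hT.const_sub 1).mul (hasDerivAt_tailIntegral hs hs1 x))).neg).div
    (hasDerivAt_stdNormalPDF x) hp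
  refine h.congr_deriv ?_
  simp only [steinSolDeriv, steinSol, steinTest, Pi.add_apply, Pi.mul_apply, Pi.neg_apply]
  field_simp
  ring

lemma hasDerivAt_steinSolDeriv (hs : Continuous s) (hs1 : ∀ x, |s x| ≤ 1) (x : ℝ) :
    HasDerivAt (steinSolDeriv s) (steinSol s x + x * steinSolDeriv s x + s x) x := by
  refine (((hasDerivAt_id x).mul (hasDerivAt_steinSol hs hs1 x)).add
    (hasDerivAt_steinTest hs hs1 x)).congr_deriv ?_
  simp

lemma abs_lower_tailIntegral_le (hs1 : ∀ x, |s x| ≤ 1) (x : ℝ) :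
    |tailIntegral (fun t => s (-t)) (-x)| ≤ stdNormalPDF x + x * (1 - stdNormalTail x) := by
  have h := abs_tailIntegral_le (s := fun t => s (-t)) (fun t => hs1 (-t)) (-x)
  rw [stdNormalTail_neg, stdNormalPDF_neg] at h
  linarith

/-- The triangle inequality for a combination with nonnegative weights. -/
lemma abs_mul_add_mul_le {A B a b p q : ℝ} (hA : |A| ≤ a) (hB : |B| ≤ b) (hp : 0 ≤ p)
    (hq : 0 ≤ q) : |A * p + B * q| ≤ a * p + b * q := by
  refine (abs_add_le _ _).trans (add_le_add ?_ ?_)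
  · rw [abs_mul, abs_of_nonneg hp]
    exact mul_le_mul_of_nonneg_right hA hp
  · rw [abs_mul, abs_of_nonneg hq]
    exact mul_le_mul_of_nonneg_right hB hq

lemma abs_steinSolDeriv_deriv_le (hs1 : ∀ x, |s x| ≤ 1) (x : ℝ) :
    |steinSol s x + x * steinSolDeriv s x + s x| ≤ 2 := by
  have hp := stdNormalPDF_pos x
  have hA := abs_lower_tailIntegral_le hs1 x
  have hB := abs_tailIntegral_le hs1 x
  have hM1 := mul_stdNormalPDF_le x
  have hM2 := mul_stdNormalPDF_le (-x)
  rw [stdNormalPDF_neg, stdNormalTail_neg] at hM2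
  set A := tailIntegral (fun t => s (-t)) (-x) with hAdef
  set B := tailIntegral s x with hBdef
  set T := stdNormalTail x with hTdef
  set p := stdNormalPDF x with hpdef
  have h1 : 0 ≤ ((1 + x ^ 2) * T - x * p) / p := div_nonneg (by linarith) hp.le
  have h2 : 0 ≤ ((1 + x ^ 2) * (1 - T) + x * p) / p := div_nonneg (by linarith) hp.le
  have h := abs_mul_add_mul_le hA hB h1 h2
  have e1 : (p + x * (1 - T)) * (((1 + x ^ 2) * T - x * p) / p) +
      (p - x * T) * (((1 + x ^ 2) * (1 - T) + x * p) / p) = 1 := by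
    field_simp
    ring
  have e2 : steinSol s x + x * steinSolDeriv s x + s x =
      s x - (A * (((1 + x ^ 2) * T - x * p) / p) +
        B * (((1 + x ^ 2) * (1 - T) + x * p) / p)) := by
    simp only [steinSolDeriv, steinSol, steinTest, ← hAdef, ← hBdef, ← hTdef, ← hpdef]
    field_simp
    ring
  rw [e2]
  rw [e1] at h
  refine (abs_sub _ _).trans ?_
  linarith [hs1 x]

lemma abs_steinSolDeriv_le (hs1 : ∀ x, |s x| ≤ 1) (x : ℝ) : |steinSolDeriv s x| ≤ 3 := by
  have hp := stdNormalPDF_pos x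
  have hp1 := stdNormalPDF_le_one x
  have hA := abs_lower_tailIntegral_le hs1 x
  have hB := abs_tailIntegral_le hs1 x
  have hM1 := mul_stdNormalPDF_le x
  have hM2 := mul_stdNormalPDF_le (-x)
  have hb := mul_stdNormalTail_le x
  have hb2 := mul_stdNormalTail_le (-x)
  have hT0 := stdNormalTail_nonneg x
  have hT1 := stdNormalTail_le_one x
  rw [stdNormalPDF_neg, stdNormalTail_neg] at hM2 hb2
  set A := tailIntegral (fun t => s (-t)) (-x) with hAdef
  set B := tailIntegral s x with hBdef
  set T := stdNormalTail x with hTdef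
  set p := stdNormalPDF x with hpdef
  have h1 : 0 ≤ (p - x * T) / p := div_nonneg (by linarith) hp.le
  have h2 : 0 ≤ (p + x * (1 - T)) / p := div_nonneg (by linarith) hp.le
  have h := abs_mul_add_mul_le hA ((abs_neg B).trans_le hB) h1 h2
  have e : steinSolDeriv s x = A * ((p - x * T) / p) + -B * ((p + x * (1 - T)) / p) := by
    simp only [steinSolDeriv, steinSol, steinTest, ← hAdef, ← hBdef, ← hTdef, ← hpdef]
    field_simp
    ring
  rw [e]
  refine h.trans ?_
  have e2 : (p + x * (1 - T)) * ((p - x * T) / p) + (p - x * T) * ((p + x * (1 - T)) / p) =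
      2 * ((p - x * T) * (p + x * (1 - T))) / p := by
    field_simp
    ring
  rw [e2, div_le_iff₀ hp]
  have hx2 : 0 < 1 + x ^ 2 := by positivity
  refine le_of_mul_le_mul_left ?_ hx2
  rcases le_total 0 x with hx | hx
  · have k1 : (1 + x ^ 2) * (p - x * T) ≤ p := by nlinarith
    have k2 : p + x * (1 - T) ≤ 1 + x := by nlinarith
    have k3 : (1 + x ^ 2) * (p - x * T) * (p + x * (1 - T)) ≤ p * (1 + x) :=
      mul_le_mul k1 k2 (by linarith) hp.le
    nlinarith [mul_nonneg hp.le (sq_nonneg (x - 1)), mul_nonneg hp.le (sq_nonneg x)]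
  · have k1 : (1 + x ^ 2) * (p + x * (1 - T)) ≤ p := by nlinarith
    have k2 : p - x * T ≤ 1 - x := by nlinarith
    have k3 : (1 + x ^ 2) * (p + x * (1 - T)) * (p - x * T) ≤ p * (1 - x) :=
      mul_le_mul k1 k2 (by linarith) hp.le
    nlinarith [mul_nonneg hp.le (sq_nonneg (x + 1)), mul_nonneg hp.le (sq_nonneg x)]

lemma abs_steinSolDeriv_sub_le (hs : Continuous s) (hs1 : ∀ x, |s x| ≤ 1) (x y : ℝ) :
    |steinSolDeriv s y - steinSolDeriv s x| ≤ 2 * |y - x| :=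
  Convex.norm_image_sub_le_of_norm_hasDerivWithin_le (s := Set.univ)
    (fun z _ => (hasDerivAt_steinSolDeriv hs hs1 z).hasDerivWithinAt)
    (fun z _ => abs_steinSolDeriv_deriv_le hs1 z) convex_univ (Set.mem_univ x) (Set.mem_univ y)

end SteinEquation

section Duality

open Filter Topology

lemma stdNormalCDF_eq_one_sub_tail (x : ℝ) : stdNormalCDF x = 1 - stdNormalTail x := by
  rw [stdNormalCDF_eq_tail, stdNormalTail_neg]

lemma integrableOn_stdNormalCDF (a : ℝ) : IntegrableOn stdNormalCDF (Set.Iio a) := by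
  have h := (integrableOn_stdNormalTail (-a)).comp_neg_Iio
  exact h.congr_fun (fun x _ => (stdNormalCDF_eq_tail x).symm) measurableSet_Iio

/-- The distribution function of the point mass at `w`, minus the normal one. -/
noncomputable def cdfGap (w z : ℝ) : ℝ := (if w ≤ z then 1 else 0) - stdNormalCDF z

lemma cdfGap_eqOn_Iio (w : ℝ) : Set.EqOn (cdfGap w) (fun z => -stdNormalCDF z) (Set.Iio w) :=
  fun z hz => by simp [cdfGap, not_le.2 (Set.mem_Iio.1 hz)]

lemma cdfGap_eqOn_Ici (w : ℝ) : Set.EqOn (cdfGap w) stdNormalTail (Set.Ici w) :=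
  fun z hz => by simp [cdfGap, Set.mem_Ici.1 hz, stdNormalCDF_eq_one_sub_tail]

lemma integrable_cdfGap (w : ℝ) : Integrable (cdfGap w) := by
  rw [← integrableOn_univ, ← Set.Iio_union_Ici (a := w)]
  refine IntegrableOn.union ?_ ?_
  · exact (integrableOn_stdNormalCDF w).neg.congr_fun (cdfGap_eqOn_Iio w).symm measurableSet_Iio
  · exact ((integrableOn_Ici_iff_integrableOn_Ioi).2 (integrableOn_stdNormalTail w)).congr_fun
      (cdfGap_eqOn_Ici w).symm measurableSet_Ici

lemma integrable_mul_of_abs_le_one {s G : ℝ → ℝ} (hs : Continuous s) (hs1 : ∀ x, |s x| ≤ 1)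
    (hG : Integrable G) : Integrable (fun z => s z * G z) :=
  hG.bdd_mul (c := 1) hs.aestronglyMeasurable (Eventually.of_forall hs1)

lemma integral_mul_cdfGap {s : ℝ → ℝ} (hs : Continuous s) (hs1 : ∀ x, |s x| ≤ 1) (w : ℝ) :
    ∫ z, s z * cdfGap w z = -steinTest s w := by
  have hint := integrable_mul_of_abs_le_one hs hs1 (integrable_cdfGap w)
  have h1 : ∫ z in Set.Iic w, s z * cdfGap w z =
      -tailIntegral (fun t => s (-t)) (-w) := by
    rw [tailIntegral, ← integral_comp_neg_Iic, integral_Iic_eq_integral_Iio,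
      integral_Iic_eq_integral_Iio, ← integral_neg]
    refine setIntegral_congr_fun measurableSet_Iio fun z hz => ?_
    simp only [cdfGap_eqOn_Iio w hz, stdNormalCDF_eq_tail, neg_neg]
    ring
  have h2 : ∫ z in Set.Ioi w, s z * cdfGap w z = tailIntegral s w := by
    refine setIntegral_congr_fun measurableSet_Ioi fun z hz => ?_
    simp only [cdfGap_eqOn_Ici w (Set.mem_Ici.2 (le_of_lt hz))]
  rw [← intervalIntegral.integral_Iic_add_Ioi (b := w) hint.integrableOn hint.integrableOn, h1, h2,
    steinTest]
  ring

/-- Duality between `L¹` and bounded continuous functions. -/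
lemma integral_abs_le_of_forall_continuous {G : ℝ → ℝ} (hG : Integrable G) {C : ℝ}
    (h : ∀ s : ℝ → ℝ, Continuous s → (∀ x, |s x| ≤ 1) → ∫ z, s z * G z ≤ C) :
    ∫ z, |G z| ≤ C := by
  refine le_of_forall_pos_le_add fun ε hε => ?_
  obtain ⟨g, -, hgε, hgc, hgi⟩ := hG.exists_hasCompactSupport_integral_sub_le (half_pos hε)
  simp only [Real.norm_eq_abs] at hgε
  have hGg : Integrable (fun z => |G z - g z|) := (hG.sub hgi).abs
  let s : ℕ → ℝ → ℝ := fun k z => k * g z / (1 + k * |g z|)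
  have hpos : ∀ (k : ℕ) z, 0 < 1 + (k : ℝ) * |g z| := fun k z => by positivity
  have hsc : ∀ k, Continuous (s k) := fun k =>
    (hgc.const_mul _).div (by fun_prop) fun z => (hpos k z).ne'
  have hs1 : ∀ k z, |s k z| ≤ 1 := fun k z => by
    simp only [s, abs_div, abs_mul, Nat.abs_cast, abs_of_pos (hpos k z)]
    exact (div_le_one (hpos k z)).2 (by linarith)
  have hlim : Tendsto (fun k => ∫ z, s k z * g z) atTop (𝓝 (∫ z, |g z|)) := by
    refine tendsto_integral_of_dominated_convergence (fun z => |g z|)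
      (fun k => ((hsc k).mul hgc).aestronglyMeasurable) hgi.abs (fun k => ?_) ?_
    · refine Eventually.of_forall fun z => ?_
      rw [Real.norm_eq_abs, abs_mul]
      exact mul_le_of_le_one_left (abs_nonneg _) (hs1 k z)
    · refine Eventually.of_forall fun z => ?_
      rcases eq_or_ne (g z) 0 with hz | hz
      · simp [hz]
      have hz' : 0 < |g z| := abs_pos.2 hz
      have ht : Tendsto (fun k : ℕ => |g z| - |g z| * (1 + (k : ℝ) * |g z|)⁻¹) atTop
          (𝓝 (|g z| - |g z| * 0)) := by
        refine tendsto_const_nhds.sub (tendsto_const_nhds.mul (tendsto_inv_atTop_zero.comp ?_))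
        exact tendsto_atTop_add_const_left _ _
          (tendsto_natCast_atTop_atTop.atTop_mul_const hz')
      rw [mul_zero, sub_zero] at ht
      refine ht.congr fun k => ?_
      have := (hpos k z).ne'
      simp only [s]
      field_simp
      rw [← sq_abs (g z)]
      ring
  have hbound : ∀ k, ∫ z, s k z * g z ≤ C + ε / 2 := fun k => by
    have i1 := integrable_mul_of_abs_le_one (hsc k) (hs1 k) hG
    calc ∫ z, s k z * g z ≤ ∫ z, (s k z * G z + |G z - g z|) := by
          refine integral_mono (integrable_mul_of_abs_le_one (hsc k) (hs1 k) hgi)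
            (i1.add hGg) fun z => ?_
          have h1 : |s k z * (g z - G z)| ≤ |G z - g z| := by
            rw [abs_mul, abs_sub_comm (G z)]
            exact mul_le_of_le_one_left (abs_nonneg _) (hs1 k z)
          have h2 := (le_abs_self _).trans h1
          simp only
          linarith
      _ = (∫ z, s k z * G z) + ∫ z, |G z - g z| := integral_add i1 hGg
      _ ≤ C + ε / 2 := add_le_add (h _ (hsc k) (hs1 k)) hgε
  have hg := le_of_tendsto' hlim hbound
  calc ∫ z, |G z| ≤ ∫ z, (|g z| + |G z - g z|) := by
        refine integral_mono hG.abs (hgi.abs.add hGg) fun z => ?_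
        have := abs_add_le (g z) (G z - g z)
        simpa using this
    _ = (∫ z, |g z|) + ∫ z, |G z - g z| := integral_add hgi.abs hGg
    _ ≤ C + ε := by linarith

end Duality

section MatchingSum

variable {n : ℕ} {d : Fin n → Fin n → ℝ} {π : Equiv.Perm (Fin n)} {i m : Fin n}

/-- The statistic `∑ i, d i (π i)`. -/
def matchingSum (d : Fin n → Fin n → ℝ) (π : Equiv.Perm (Fin n)) : ℝ := ∑ i, d i (π i)

/-- Half the change of `matchingSum` when `i` is rematched with `m`. -/
def rematchDiff (d : Fin n → Fin n → ℝ) (π : Equiv.Perm (Fin n)) (i m : Fin n) : ℝ :=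
  d i m + d (π i) (π m) - d i (π i) - d m (π m)

/-- The change of `∑ j, d i j * d m (π j)` when `i` is rematched with `m`. -/
def rematchCorrection (d : Fin n → Fin n → ℝ) (π : Equiv.Perm (Fin n)) (i m : Fin n) : ℝ :=
  d i m ^ 2 - d i m * d m (π m) + d i (π i) * d m (π m) - d i (π i) * d i m +
    d i (π m) * d m (π i)

lemma matchingSum_rematch (hsymm : ∀ i j, d i j = d j i) (hπ : π ∈ fpfInvolutions n)
    (hm : m ≠ i) :
    matchingSum d (rematch π i m) = matchingSum d π + 2 * rematchDiff d π i m := by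
  rw [matchingSum, sum_apply_rematch d hπ hm, matchingSum, rematchDiff, hsymm m i,
    hsymm (π i) i, hsymm (π m) (π i), hsymm (π m) m]
  ring

lemma sum_mul_rematch (hsymm : ∀ i j, d i j = d j i) (hdiag : ∀ i, d i i = 0)
    (hπ : π ∈ fpfInvolutions n) (hm : m ≠ i) :
    ∑ j, d i j * d m (rematch π i m j) = ∑ j, d i j * d m (π j) + rematchCorrection d π i m := by
  rw [sum_apply_rematch (fun j x => d i j * d m x) hπ hm, rematchCorrection, hdiag, hdiag,
    hsymm m i]
  ring

lemma sum_matchingSum_mul (hsymm : ∀ i j, d i j = d j i) (hdiag : ∀ i, d i i = 0) (f : ℝ → ℝ) :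
    ((n : ℝ) - 1) * ∑ π ∈ fpfInvolutions n, matchingSum d π * f (matchingSum d π) =
      ∑ π ∈ fpfInvolutions n, ∑ i, ∑ m,
        d i m * f (matchingSum d π + 2 * rematchDiff d π i m) := by
  have h1 : ∀ π : Equiv.Perm (Fin n), matchingSum d π * f (matchingSum d π) =
      ∑ i, d i (π i) * f (matchingSum d π) := fun π => Finset.sum_mul _ _ _
  simp_rw [h1]
  rw [Finset.sum_comm, Finset.mul_sum, Finset.sum_comm (s := fpfInvolutions n)]
  refine Finset.sum_congr rfl fun i _ => ?_
  rw [← sum_rematch (fun π => d i (π i) * f (matchingSum d π)) i]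
  refine Finset.sum_congr rfl fun π hπ => ?_
  rw [← Finset.sum_erase univ (a := i) (by rw [hdiag, zero_mul])]
  refine Finset.sum_congr rfl fun m hm => ?_
  have hm' := Finset.ne_of_mem_erase hm
  rw [rematch_apply_left hπ hm', matchingSum_rematch hsymm hπ hm']

lemma sum_quadratic_mul (hsymm : ∀ i j, d i j = d j i) (hdiag : ∀ i, d i i = 0) (g : ℝ → ℝ) :
    ((n : ℝ) - 1) * ∑ π ∈ fpfInvolutions n,
        (∑ i, ∑ j, d i j * d (π i) (π j)) * g (matchingSum d π) =
      ∑ π ∈ fpfInvolutions n, ∑ i, ∑ m ∈ univ.erase i,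
        (∑ j, d i j * d m (π j) + rematchCorrection d π i m) *
          g (matchingSum d π + 2 * rematchDiff d π i m) := by
  simp_rw [Finset.sum_mul univ]
  rw [Finset.sum_comm, Finset.mul_sum, Finset.sum_comm (s := fpfInvolutions n)]
  refine Finset.sum_congr rfl fun i _ => ?_
  simp_rw [← Finset.sum_mul univ]
  rw [← sum_rematch (fun π => (∑ j, d i j * d (π i) (π j)) * g (matchingSum d π)) i]
  refine Finset.sum_congr rfl fun π hπ => Finset.sum_congr rfl fun m hm => ?_
  have hm' := Finset.ne_of_mem_erase hm
  rw [rematch_apply_left hπ hm', matchingSum_rematch hsymm hπ hm',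
    sum_mul_rematch hsymm hdiag hπ hm']

lemma sum_mul_rematchDiff (hrow : ∀ i, ∑ j, d i j = 0) (hsymm : ∀ i j, d i j = d j i) :
    ∑ i, ∑ m, d i m * rematchDiff d π i m =
      ∑ i, ∑ j, d i j ^ 2 + ∑ i, ∑ j, d i j * d (π i) (π j) := by
  have h1 : ∑ i, ∑ m, d i m * d i (π i) = 0 := by
    simp [← Finset.sum_mul, hrow]
  have h2 : ∑ i, ∑ m, d i m * d m (π m) = 0 := by
    rw [Finset.sum_comm]
    refine Finset.sum_eq_zero fun m _ => ?_
    rw [← Finset.sum_mul, Finset.sum_congr rfl fun i _ => hsymm i m, hrow, zero_mul]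
  have h3 : ∀ i m, d i m * rematchDiff d π i m =
      d i m ^ 2 + d i m * d (π i) (π m) - d i m * d i (π i) - d i m * d m (π m) :=
    fun i m => by rw [rematchDiff]; ring
  simp only [h3, Finset.sum_sub_distrib, Finset.sum_add_distrib, h1, h2, sub_zero]

lemma sum_sum_comp_perm (c : Fin n → Fin n → ℝ) (π : Equiv.Perm (Fin n)) :
    ∑ i, ∑ m, c (π i) (π m) = ∑ i, ∑ m, c i m := by
  rw [Equiv.sum_comp π (fun i => ∑ m, c i (π m))]
  exact Finset.sum_congr rfl fun i _ => Equiv.sum_comp π (c i)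

lemma sum_sum_comp_perm_right (c : Fin n → Fin n → ℝ) (π : Equiv.Perm (Fin n)) :
    ∑ i, ∑ m, c i (π m) = ∑ i, ∑ m, c i m :=
  Finset.sum_congr rfl fun i _ => Equiv.sum_comp π (c i)

lemma abs_sum_sum_le (u v : Fin n → Fin n → ℝ) (h : ∀ i m, |u i m| ≤ v i m) :
    |∑ i, ∑ m, u i m| ≤ ∑ i, ∑ m, v i m :=
  (Finset.abs_sum_le_sum_abs _ _).trans <| Finset.sum_le_sum fun i _ =>
    (Finset.abs_sum_le_sum_abs _ _).trans <| Finset.sum_le_sum fun m _ => h i m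

lemma mul_sq_le_cubes {x y : ℝ} (hx : 0 ≤ x) (hy : 0 ≤ y) :
    x * y ^ 2 ≤ (x ^ 3 + 2 * y ^ 3) / 3 := by
  nlinarith [mul_nonneg (add_nonneg hx (mul_nonneg zero_le_two hy)) (sq_nonneg (x - y))]

lemma mul_mul_le_cubes {x y z : ℝ} (hx : 0 ≤ x) (hy : 0 ≤ y) (hz : 0 ≤ z) :
    x * y * z ≤ (x ^ 3 + y ^ 3 + z ^ 3) / 3 := by
  nlinarith [mul_nonneg (add_nonneg (add_nonneg hx hy) hz)
    (add_nonneg (add_nonneg (sq_nonneg (x - y)) (sq_nonneg (y - z))) (sq_nonneg (x - z)))]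

lemma abs_rematchDiff_le (d : Fin n → Fin n → ℝ) (π : Equiv.Perm (Fin n)) (i m : Fin n) :
    |rematchDiff d π i m| ≤ |d i m| + |d (π i) (π m)| + |d i (π i)| + |d m (π m)| :=
  (abs_sub _ _).trans <| add_le_add_left ((abs_sub _ _).trans <|
    add_le_add_left (abs_add_le _ _) _) _

lemma mul_rematchDiff_sq_le (d : Fin n → Fin n → ℝ) (π : Equiv.Perm (Fin n)) (i m : Fin n) :
    |d i m| * (2 * rematchDiff d π i m) ^ 2 ≤ 32 * |d i m| ^ 3 +
      32 / 3 * (|d (π i) (π m)| ^ 3 + |d i (π i)| ^ 3 + |d m (π m)| ^ 3) := by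
  have h : rematchDiff d π i m ^ 2 ≤
      4 * (|d i m| ^ 2 + |d (π i) (π m)| ^ 2 + |d i (π i)| ^ 2 + |d m (π m)| ^ 2) := by
    simp only [sq_abs, rematchDiff]
    nlinarith [sq_nonneg (d i m - d (π i) (π m)), sq_nonneg (d i m + d i (π i)),
      sq_nonneg (d i m + d m (π m)), sq_nonneg (d (π i) (π m) + d i (π i)),
      sq_nonneg (d (π i) (π m) + d m (π m)), sq_nonneg (d i (π i) - d m (π m))]
  have h' := mul_le_mul_of_nonneg_left h (abs_nonneg (d i m))
  have h1 := mul_sq_le_cubes (abs_nonneg (d i m)) (abs_nonneg (d (π i) (π m)))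
  have h2 := mul_sq_le_cubes (abs_nonneg (d i m)) (abs_nonneg (d i (π i)))
  have h3 := mul_sq_le_cubes (abs_nonneg (d i m)) (abs_nonneg (d m (π m)))
  linarith [pow_succ' |d i m| 2]

lemma abs_rematchCorrection_le (d : Fin n → Fin n → ℝ) (π : Equiv.Perm (Fin n)) (i m : Fin n) :
    |rematchCorrection d π i m| ≤ 2 * d i m ^ 2 + d i (π i) ^ 2 + d m (π m) ^ 2 +
      (d i (π m) ^ 2 + d m (π i) ^ 2) / 2 := by
  unfold rematchCorrection
  rw [abs_le]
  constructor <;>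
  nlinarith [sq_nonneg (d i m - d m (π m)), sq_nonneg (d i m + d m (π m)),
    sq_nonneg (d i (π i) - d m (π m)), sq_nonneg (d i (π i) + d m (π m)),
    sq_nonneg (d i (π i) - d i m), sq_nonneg (d i (π i) + d i m),
    sq_nonneg (d i (π m) - d m (π i)), sq_nonneg (d i (π m) + d m (π i))]

/-- Second-order Taylor bound from a Lipschitz bound on the derivative. -/
lemma abs_taylor_le {f g : ℝ → ℝ} (hf : ∀ x, HasDerivAt f (g x) x)
    (hg : ∀ x y, |g y - g x| ≤ 2 * |y - x|) (x y : ℝ) :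
    |f (x + y) - f x - y * g x| ≤ y ^ 2 := by
  have key : ∀ e : ℝ, |e| = 1 → ∀ r, 0 ≤ r →
      |f (x + e * r) - f x - e * r * g x| ≤ r ^ 2 := by
    intro e he r hr
    have hF : ∀ t : ℝ, HasDerivAt (fun t => f (x + e * t) - f x - e * t * g x)
        (e * (g (x + e * t) - g x)) t := by
      intro t
      have h1 : HasDerivAt (fun t : ℝ => x + e * t) e t := by
        simpa using ((hasDerivAt_id t).const_mul e).const_add x
      have h2 : HasDerivAt (fun t : ℝ => e * t * g x) (e * g x) t := by
        simpa using ((hasDerivAt_id t).const_mul e).mul_const (g x)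
      refine ((((hf (x + e * t)).comp t h1).sub_const (f x)).sub h2).congr_deriv ?_
      ring
    refine image_norm_le_of_norm_deriv_right_le_deriv_boundary (a := 0) (b := r)
      (f := fun t => f (x + e * t) - f x - e * t * g x) (B := fun t => t ^ 2)
      (B' := fun t => 2 * t)
      (fun t _ => (hF t).continuousAt.continuousWithinAt)
      (fun t _ => (hF t).hasDerivWithinAt) (by simp)
      (fun t => by simpa using hasDerivAt_pow 2 t) (fun t ht => ?_) ⟨hr, le_rfl⟩
    have := hg x (x + e * t)
    rw [add_sub_cancel_left, abs_mul, he, one_mul, abs_of_nonneg ht.1] at this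
    rwa [norm_mul, Real.norm_eq_abs, he, one_mul]
  rcases le_total 0 y with hy | hy
  · simpa using key 1 (by simp) y hy
  · simpa using key (-1) (by simp) (-y) (by linarith)

lemma abs_sum_sum_erase_le (u v : Fin n → Fin n → ℝ) (h : ∀ i m, |u i m| ≤ v i m) :
    |∑ i, ∑ m ∈ univ.erase i, u i m| ≤ ∑ i, ∑ m, v i m :=
  (Finset.abs_sum_le_sum_abs _ _).trans <| Finset.sum_le_sum fun i _ =>
    (Finset.abs_sum_le_sum_abs _ _).trans <| (Finset.sum_le_sum fun m _ => h i m).trans <|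
      Finset.sum_le_sum_of_subset_of_nonneg (Finset.subset_univ _) fun m _ _ =>
        (abs_nonneg _).trans (h i m)

lemma sum_sq_eq (hn : 9 ≤ n)
    (hvar : 2 * ((n : ℝ) - 2) / (((n : ℝ) - 1) * ((n : ℝ) - 3)) *
      (∑ i, ∑ j, d i j ^ 2) = 1) :
    ∑ i, ∑ j, d i j ^ 2 = ((n : ℝ) - 1) * (n - 3) / (2 * (n - 2)) := by
  have hn9 : (9 : ℝ) ≤ n := by exact_mod_cast hn
  have h1 : (n : ℝ) - 1 ≠ 0 := by linarith
  have h2 : (n : ℝ) - 2 ≠ 0 := by linarith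
  have h3 : (n : ℝ) - 3 ≠ 0 := by linarith
  field_simp at hvar ⊢
  linarith

/-- A standardized array has third absolute moment bounded below. -/
lemma half_le_sum_cubes (hn : 9 ≤ n)
    (hvar : 2 * ((n : ℝ) - 2) / (((n : ℝ) - 1) * ((n : ℝ) - 3)) *
      (∑ i, ∑ j, d i j ^ 2) = 1) :
    1 / 2 ≤ ∑ i, ∑ j, |d i j| ^ 3 := by
  have hn9 : (9 : ℝ) ≤ n := by exact_mod_cast hn
  obtain ⟨a, ha0, ha⟩ : ∃ a : ℝ, 0 < a ∧ a ^ 2 = 1 / (2 * n) :=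
    ⟨Real.sqrt (1 / (2 * n)), Real.sqrt_pos.2 (by positivity), Real.sq_sqrt (by positivity)⟩
  have hS := sum_sq_eq hn hvar
  have hpt : ∀ i j, 3 * a * d i j ^ 2 ≤ 2 * |d i j| ^ 3 + a ^ 3 := fun i j => by
    have := mul_sq_le_cubes ha0.le (abs_nonneg (d i j))
    rw [sq_abs] at this
    linarith
  have hsum := Finset.sum_le_sum fun i (_ : i ∈ univ) =>
    Finset.sum_le_sum fun j (_ : j ∈ univ) => hpt i j
  simp only [← Finset.mul_sum, Finset.sum_add_distrib, Finset.sum_const, Finset.card_univ,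
    Fintype.card_fin, nsmul_eq_mul] at hsum
  have hS' : 11 / 30 * (n : ℝ) ≤ ∑ i, ∑ j, d i j ^ 2 := by
    rw [hS, le_div_iff₀ (by linarith)]
    nlinarith
  have hna : 2 ≤ n * a := by
    have h : (2 : ℝ) ^ 2 ≤ (n * a) ^ 2 := by
      rw [mul_pow, ha]
      field_simp
      linarith
    exact le_of_sq_le_sq h (by positivity)
  have hcube : (n : ℝ) * (n * a ^ 3) = n * a / 2 := by
    rw [pow_succ, ha]
    field_simp
  have := mul_le_mul_of_nonneg_left hS' (mul_nonneg zero_le_three ha0.le)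
  nlinarith

lemma abs_taylor_remainder_le {f g : ℝ → ℝ} (hf : ∀ x, HasDerivAt f (g x) x)
    (hg : ∀ x y, |g y - g x| ≤ 2 * |y - x|) (π : Equiv.Perm (Fin n)) (w : ℝ) :
    |∑ i, ∑ m, d i m * (f (w + 2 * rematchDiff d π i m) - f w - 2 * rematchDiff d π i m * g w)| ≤
      32 / 3 * (4 * ∑ i, ∑ j, |d i j| ^ 3 + 2 * n * ∑ i, |d i (π i)| ^ 3) := by
  refine (abs_sum_sum_le _ (fun i m => 32 * |d i m| ^ 3 + 32 / 3 *
    (|d (π i) (π m)| ^ 3 + |d i (π i)| ^ 3 + |d m (π m)| ^ 3)) fun i m => ?_).trans_eq ?_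
  · rw [abs_mul]
    exact (mul_le_mul_of_nonneg_left (abs_taylor_le hf hg _ _) (abs_nonneg _)).trans
      (mul_rematchDiff_sq_le d π i m)
  · simp only [Finset.sum_add_distrib, ← Finset.mul_sum, Finset.sum_const, Finset.card_univ,
      Fintype.card_fin, nsmul_eq_mul, sum_sum_comp_perm (fun i m => |d i m| ^ 3) π]
    ring

lemma abs_sum_increment_le {g : ℝ → ℝ} (hg : ∀ x y, |g y - g x| ≤ 2 * |y - x|)
    (π : Equiv.Perm (Fin n)) (w : ℝ) :
    |∑ i, ∑ m ∈ univ.erase i,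
        (∑ j, d i j * d m (π j)) * (g (w + 2 * rematchDiff d π i m) - g w)| ≤
      4 / 3 * (10 * n * ∑ i, ∑ j, |d i j| ^ 3 + 2 * n ^ 2 * ∑ i, |d i (π i)| ^ 3) := by
  refine (abs_sum_sum_erase_le _ (fun i m => ∑ j, 4 / 3 * (4 * |d i j| ^ 3 + 4 * |d m (π j)| ^ 3 +
    (|d i m| ^ 3 + |d (π i) (π m)| ^ 3 + |d i (π i)| ^ 3 + |d m (π m)| ^ 3)))
    fun i m => ?_).trans_eq ?_
  · rw [Finset.sum_mul]
    refine (Finset.abs_sum_le_sum_abs _ _).trans (Finset.sum_le_sum fun j _ => ?_)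
    have h1 := hg w (w + 2 * rematchDiff d π i m)
    rw [add_sub_cancel_left, abs_mul, abs_of_pos (zero_lt_two : (0 : ℝ) < 2)] at h1
    have h2 : |g (w + 2 * rematchDiff d π i m) - g w| ≤
        4 * (|d i m| + |d (π i) (π m)| + |d i (π i)| + |d m (π m)|) := by
      linarith [abs_rematchDiff_le d π i m]
    rw [abs_mul, abs_mul]
    have h3 := mul_le_mul_of_nonneg_left h2
      (mul_nonneg (abs_nonneg (d i j)) (abs_nonneg (d m (π j))))
    have hc := fun z : ℝ =>
      mul_mul_le_cubes (abs_nonneg (d i j)) (abs_nonneg (d m (π j))) (abs_nonneg z)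
    linarith [hc (d i m), hc (d (π i) (π m)), hc (d i (π i)), hc (d m (π m))]
  · simp only [Finset.sum_add_distrib, ← Finset.mul_sum, Finset.sum_const, Finset.card_univ,
      Fintype.card_fin, nsmul_eq_mul, sum_sum_comp_perm (fun i m => |d i m| ^ 3) π,
      sum_sum_comp_perm_right (fun i m => |d i m| ^ 3) π]
    ring

lemma abs_sum_erase_le (hrow : ∀ i, ∑ j, d i j = 0) (hsymm : ∀ i j, d i j = d j i)
    (π : Equiv.Perm (Fin n)) :
    |∑ i, ∑ m ∈ univ.erase i, ∑ j, d i j * d m (π j)| ≤ ∑ i, ∑ j, d i j ^ 2 := by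
  have h : ∀ i, ∑ m ∈ univ.erase i, ∑ j, d i j * d m (π j) = ∑ j, -(d i j * d i (π j)) := by
    intro i
    have hall : ∑ m, ∑ j, d i j * d m (π j) = 0 := by
      rw [Finset.sum_comm]
      refine Finset.sum_eq_zero fun j _ => ?_
      rw [← Finset.mul_sum, Finset.sum_congr rfl fun m _ => hsymm m (π j), hrow, mul_zero]
    rw [← Finset.sum_erase_add univ _ (Finset.mem_univ i)] at hall
    rw [Finset.sum_neg_distrib]
    linarith
  simp only [h]
  refine (abs_sum_sum_le _ (fun i j => (d i j ^ 2 + d i (π j) ^ 2) / 2) fun i j => ?_).trans_eq ?_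
  · rw [abs_neg, abs_le]
    constructor <;> nlinarith [sq_nonneg (d i j - d i (π j)), sq_nonneg (d i j + d i (π j))]
  · simp only [← Finset.sum_div, Finset.sum_add_distrib,
      sum_sum_comp_perm_right (fun i m => d i m ^ 2) π]
    ring

lemma abs_sum_correction_le {g : ℝ → ℝ} (hg : ∀ x, |g x| ≤ 3) (π : Equiv.Perm (Fin n)) (w : ℝ) :
    |∑ i, ∑ m ∈ univ.erase i, rematchCorrection d π i m * g (w + 2 * rematchDiff d π i m)| ≤
      3 * (3 * ∑ i, ∑ j, d i j ^ 2 + 2 * n * ∑ i, d i (π i) ^ 2) := by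
  have hb : ∀ i m, |rematchCorrection d π i m * g (w + 2 * rematchDiff d π i m)| ≤
      3 * (2 * d i m ^ 2 + d i (π i) ^ 2 + d m (π m) ^ 2 +
        (d i (π m) ^ 2 + d m (π i) ^ 2) / 2) := by
    intro i m
    rw [abs_mul, mul_comm]
    exact mul_le_mul (hg _) (abs_rematchCorrection_le d π i m) (abs_nonneg _) (by norm_num)
  have hswap : ∑ i, ∑ m, d m (π i) ^ 2 = ∑ i, ∑ m, d i m ^ 2 := by
    rw [Finset.sum_comm]
    exact sum_sum_comp_perm_right (fun i m => d i m ^ 2) π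
  refine (abs_sum_sum_erase_le _ _ hb).trans_eq ?_
  simp only [← Finset.mul_sum, ← Finset.sum_div, Finset.sum_add_distrib, Finset.sum_const,
    Finset.card_univ, Fintype.card_fin, nsmul_eq_mul, hswap,
    sum_sum_comp_perm_right (fun i m => d i m ^ 2) π]
  ring

/-- The quadratic form against a bounded Lipschitz function of the matching sum. -/
lemma abs_sum_quadratic_mul_le (hsymm : ∀ i j, d i j = d j i) (hdiag : ∀ i, d i i = 0)
    (hrow : ∀ i, ∑ j, d i j = 0) {g : ℝ → ℝ} (hg3 : ∀ x, |g x| ≤ 3)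
    (hg : ∀ x y, |g y - g x| ≤ 2 * |y - x|) :
    |((n : ℝ) - 1) * ∑ π ∈ fpfInvolutions n,
        (∑ i, ∑ j, d i j * d (π i) (π j)) * g (matchingSum d π)| ≤
      ∑ π ∈ fpfInvolutions n,
        (4 / 3 * (10 * n * ∑ i, ∑ j, |d i j| ^ 3 + 2 * n ^ 2 * ∑ i, |d i (π i)| ^ 3) +
          3 * ∑ i, ∑ j, d i j ^ 2 +
          3 * (3 * ∑ i, ∑ j, d i j ^ 2 + 2 * n * ∑ i, d i (π i) ^ 2)) := by
  rw [sum_quadratic_mul hsymm hdiag]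
  refine (Finset.abs_sum_le_sum_abs _ _).trans (Finset.sum_le_sum fun π hπ => ?_)
  set w := matchingSum d π
  have hsplit : ∀ i m, (∑ j, d i j * d m (π j) + rematchCorrection d π i m) *
      g (w + 2 * rematchDiff d π i m) =
        (∑ j, d i j * d m (π j)) * (g (w + 2 * rematchDiff d π i m) - g w) +
          (∑ j, d i j * d m (π j)) * g w +
          rematchCorrection d π i m * g (w + 2 * rematchDiff d π i m) := fun i m => by ring
  simp only [hsplit, Finset.sum_add_distrib]
  refine (abs_add_le _ _).trans (add_le_add ((abs_add_le _ _).trans (add_le_add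
    (abs_sum_increment_le hg π w) ?_)) (abs_sum_correction_le hg3 π w))
  simp only [← Finset.sum_mul univ, ← Finset.sum_mul (univ.erase _)]
  rw [abs_mul, mul_comm]
  exact mul_le_mul (hg3 w) (abs_sum_erase_le hrow hsymm π) (abs_nonneg _) (by norm_num)

/-- Stein's identity for the matching sum, up to a cubic error. -/
lemma abs_stein_discrepancy_le (hsymm : ∀ i j, d i j = d j i) (hdiag : ∀ i, d i i = 0)
    (hrow : ∀ i, ∑ j, d i j = 0) {f g : ℝ → ℝ} (hf : ∀ x, HasDerivAt f (g x) x)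
    (hg : ∀ x y, |g y - g x| ≤ 2 * |y - x|) :
    |((n : ℝ) - 1) * ∑ π ∈ fpfInvolutions n, matchingSum d π * f (matchingSum d π) -
        2 * (∑ i, ∑ j, d i j ^ 2) * ∑ π ∈ fpfInvolutions n, g (matchingSum d π) -
        2 * ∑ π ∈ fpfInvolutions n,
          (∑ i, ∑ j, d i j * d (π i) (π j)) * g (matchingSum d π)| ≤
      ∑ π ∈ fpfInvolutions n,
        32 / 3 * (4 * ∑ i, ∑ j, |d i j| ^ 3 + 2 * n * ∑ i, |d i (π i)| ^ 3) := by
  rw [sum_matchingSum_mul hsymm hdiag, Finset.mul_sum (fpfInvolutions n),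
    Finset.mul_sum (fpfInvolutions n), ← Finset.sum_sub_distrib, ← Finset.sum_sub_distrib]
  refine (Finset.abs_sum_le_sum_abs _ _).trans (Finset.sum_le_sum fun π _ => ?_)
  refine le_of_eq_of_le ?_ (abs_taylor_remainder_le hf hg π (matchingSum d π))
  congr 1
  set w := matchingSum d π
  have hsplit : ∀ i m, d i m *
      (f (w + 2 * rematchDiff d π i m) - f w - 2 * rematchDiff d π i m * g w) =
        d i m * f (w + 2 * rematchDiff d π i m) - d i m * f w -
          2 * g w * (d i m * rematchDiff d π i m) := fun i m => by ring
  simp only [hsplit, Finset.sum_sub_distrib, ← Finset.mul_sum, ← Finset.sum_mul,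
    sum_mul_rematchDiff hrow hsymm, hrow]
  simp
  ring

/-- A bound on the Stein operator for the matching sum of a standardized array. -/
lemma abs_stein_matchingSum_le (hn : 9 ≤ n) (hsymm : ∀ i j, d i j = d j i)
    (hdiag : ∀ i, d i i = 0) (hrow : ∀ i, ∑ j, d i j = 0)
    (hvar : 2 * ((n : ℝ) - 2) / (((n : ℝ) - 1) * ((n : ℝ) - 3)) *
      (∑ i, ∑ j, d i j ^ 2) = 1)
    {f g : ℝ → ℝ} (hf : ∀ x, HasDerivAt f (g x) x) (hg3 : ∀ x, |g x| ≤ 3)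
    (hg : ∀ x y, |g y - g x| ≤ 2 * |y - x|) :
    |∑ π ∈ fpfInvolutions n, (g (matchingSum d π) - matchingSum d π * f (matchingSum d π))| ≤
      (fpfInvolutions n).card * (224 * (∑ i, ∑ j, |d i j| ^ 3) / n) := by
  have hn9 : (9 : ℝ) ≤ n := by exact_mod_cast hn
  have hβ := half_le_sum_cubes hn hvar
  have hQ := abs_sum_quadratic_mul_le hsymm hdiag hrow hg3 hg
  have hT := abs_stein_discrepancy_le hsymm hdiag hrow hf hg
  have hτ := sum_sum_apply (fun i j => |d i j| ^ 3) (fun i => by simp [hdiag])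
  have ht := sum_sum_apply (fun i j => d i j ^ 2) (fun i => by simp [hdiag])
  have hG : |∑ π ∈ fpfInvolutions n, g (matchingSum d π)| ≤ (fpfInvolutions n).card * 3 := by
    refine (Finset.abs_sum_le_sum_abs _ _).trans ((Finset.sum_le_sum fun π _ => hg3 _).trans_eq ?_)
    simp
  simp only [Finset.sum_add_distrib, ← Finset.mul_sum, Finset.sum_const, nsmul_eq_mul] at hQ hT
  rw [Finset.sum_sub_distrib]
  have hS := sum_sq_eq hn hvar
  set P : ℝ := ((fpfInvolutions n).card : ℝ) with hP
  have hP0 : 0 ≤ P := Nat.cast_nonneg _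
  set β := ∑ i, ∑ j, |d i j| ^ 3
  set S := ∑ i, ∑ j, d i j ^ 2
  set τ := ∑ π ∈ fpfInvolutions n, ∑ i, |d i (π i)| ^ 3
  set t := ∑ π ∈ fpfInvolutions n, ∑ i, d i (π i) ^ 2
  set G := ∑ π ∈ fpfInvolutions n, g (matchingSum d π)
  set Q := ∑ π ∈ fpfInvolutions n,
    (∑ i, ∑ j, d i j * d (π i) (π j)) * g (matchingSum d π)
  set T := ∑ π ∈ fpfInvolutions n, matchingSum d π * f (matchingSum d π)
  have hn1 : (0 : ℝ) < n - 1 := by linarith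
  have hPβ : P * (1 / 2) ≤ P * β := mul_le_mul_of_nonneg_left hβ hP0
  have hPβ0 : 0 ≤ P * β := by linarith
  have hnle : (n : ℝ) ≤ 9 / 8 * (n - 1) := by linarith
  have hS2 : S ≤ (n - 1) / 2 := by
    rw [hS, div_le_iff₀ (by linarith)]
    nlinarith
  have hS0 : 0 ≤ S := Finset.sum_nonneg fun i _ => Finset.sum_nonneg fun j _ => sq_nonneg _
  have hnτ : n * τ ≤ 9 / 8 * (P * β) := by
    have : 0 ≤ τ := Finset.sum_nonneg fun π _ => Finset.sum_nonneg fun j _ => by positivity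
    rw [← hτ]
    nlinarith
  have hnt : n * t ≤ 9 / 8 * (P * S) := by
    have : 0 ≤ t := Finset.sum_nonneg fun π _ => Finset.sum_nonneg fun j _ => by positivity
    rw [← ht]
    nlinarith
  have hPS : P * S ≤ (n - 1) * (P * β) := by
    have := mul_le_mul_of_nonneg_left hS2 hP0
    nlinarith
  have hQ' : |Q| ≤ 38 * (P * β) := by
    rw [abs_mul, abs_of_pos hn1] at hQ
    refine le_of_mul_le_mul_left (hQ.trans ?_) hn1
    have h1 : (n : ℝ) * (P * β) ≤ 9 / 8 * (n - 1) * (P * β) :=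
      mul_le_mul_of_nonneg_right hnle hPβ0
    have h2 : (n : ℝ) * (n * τ) ≤ n * (9 / 8 * (P * β)) :=
      mul_le_mul_of_nonneg_left hnτ (by linarith)
    nlinarith
  have hmain : (n - 1) * |G - T| ≤ 199 * (P * β) := by
    have e : (n - 1) * (G - T) = (n - 1 - 2 * S) * G - 2 * Q -
        ((n - 1) * T - 2 * S * G - 2 * Q) := by ring
    have hcoef : |n - 1 - 2 * S| ≤ 8 / 7 := by
      have hc : (n : ℝ) - 1 - 2 * S = (n - 1) / (n - 2) := by
        rw [hS]
        have : (n : ℝ) - 2 ≠ 0 := by linarith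
        field_simp
        ring
      rw [hc, abs_of_nonneg (div_nonneg hn1.le (by linarith)), div_le_iff₀ (by linarith)]
      linarith
    have hGc : |(n - 1 - 2 * S) * G| ≤ 8 / 7 * (P * 3) := by
      rw [abs_mul]
      exact mul_le_mul hcoef hG (abs_nonneg _) (by norm_num)
    have habs : (n - 1) * |G - T| = |(n - 1) * (G - T)| := by rw [abs_mul, abs_of_pos hn1]
    rw [habs, e]
    refine (abs_sub _ _).trans ?_
    refine (add_le_add_left (abs_sub _ _) _).trans ?_
    rw [abs_mul 2 Q, abs_of_pos (zero_lt_two : (0 : ℝ) < 2)]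
    linarith
  have hn0 : (0 : ℝ) < n := by linarith
  rw [← mul_div_assoc, le_div_iff₀ hn0]
  have := mul_le_mul_of_nonneg_left hnle (abs_nonneg (G - T))
  linarith

end MatchingSum

open Classical in
/-- The empirical distribution function of `w`, minus the normal one, as an average of gaps. -/
lemma cdf_sub_eq_sum_cdfGap {α : Type*} (s : Finset α) (hs : s.Nonempty) (w : α → ℝ) (t : ℝ) :
    ((s.filter fun a => w a ≤ t).card : ℝ) / s.card - stdNormalCDF t =
      (s.card : ℝ)⁻¹ * ∑ a ∈ s, cdfGap (w a) t := by
  have hc : (s.card : ℝ) ≠ 0 := by exact_mod_cast hs.card_pos.ne'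
  simp only [cdfGap, Finset.sum_sub_distrib, Finset.sum_const, nsmul_eq_mul, Finset.sum_boole]
  field_simp

/-- An `L¹` bound for the empirical distribution of `w` from a bound on Stein's operator. -/
lemma integral_abs_sum_cdfGap_le {α : Type*} (s : Finset α) (hs : s.Nonempty) (w : α → ℝ) {C : ℝ}
    (h : ∀ f g : ℝ → ℝ, (∀ x, HasDerivAt f (g x) x) → (∀ x, |g x| ≤ 3) →
      (∀ x y, |g y - g x| ≤ 2 * |y - x|) →
      |∑ a ∈ s, (g (w a) - w a * f (w a))| ≤ s.card * C) :
    ∫ z, |(s.card : ℝ)⁻¹ * ∑ a ∈ s, cdfGap (w a) z| ≤ C := by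
  have hc : (0 : ℝ) < s.card := by exact_mod_cast hs.card_pos
  refine integral_abs_le_of_forall_continuous
    ((integrable_finsetSum _ fun a _ => integrable_cdfGap (w a)).const_mul _)
    fun u hu hu1 => ?_
  have hint : ∫ z, u z * ((s.card : ℝ)⁻¹ * ∑ a ∈ s, cdfGap (w a) z) =
      (s.card : ℝ)⁻¹ * -∑ a ∈ s, (steinSolDeriv u (w a) - w a * steinSol u (w a)) := by
    have e : ∀ z, u z * ((s.card : ℝ)⁻¹ * ∑ a ∈ s, cdfGap (w a) z) =
        (s.card : ℝ)⁻¹ * ∑ a ∈ s, u z * cdfGap (w a) z := fun z => by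
      rw [← Finset.mul_sum]
      ring
    simp only [e]
    rw [integral_const_mul, integral_finsetSum _ fun a _ =>
      integrable_mul_of_abs_le_one hu hu1 (integrable_cdfGap (w a))]
    simp only [integral_mul_cdfGap hu hu1, Finset.sum_neg_distrib, steinSolDeriv,
      add_sub_cancel_left]
  rw [hint, inv_mul_le_iff₀ hc]
  exact (neg_le_abs _).trans (h _ _ (hasDerivAt_steinSol hu hu1)
    (abs_steinSolDeriv_le hu1) (abs_steinSolDeriv_sub_le hu hu1))

/-- L¹ bound for the CLT with fixed-point-free involutions and a standardized array. -/
theorem l1_bound_involutions (n : ℕ) (hn : Even n) (hn9 : 9 ≤ n)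
    (d : Fin n → Fin n → ℝ)
    (hsymm : ∀ i j, d i j = d j i) (hdiag : ∀ i, d i i = 0)
    (hrow : ∀ i, ∑ j, d i j = 0)
    (hvar : 2 * ((n : ℝ) - 2) / (((n : ℝ) - 1) * ((n : ℝ) - 3)) *
      (∑ i, ∑ j, d i j ^ 2) = 1)
    (βD : ℝ) (hβD : βD = ∑ i, ∑ j, if i ≠ j then |d i j| ^ 3 else 0)
    (F : ℝ → ℝ)
    (hF : ∀ t, F t = (((fpfInvolutions n).filter
        (fun π => ∑ i, d i (π i) ≤ t)).card : ℝ) / (fpfInvolutions n).card) :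
    eLpNorm (fun t => F t - stdNormalCDF t) 1 volume ≤
        ENNReal.ofReal (βD / n * (224 + 1344 / n + 384 / (n : ℝ) ^ 2)) ∧
      eLpNorm (fun t => F t - stdNormalCDF t) 1 volume ≤
        ENNReal.ofReal (379 * βD / n) := by
  have hne := fpfInvolutions_nonempty hn
  have hβ : βD = ∑ i, ∑ j, |d i j| ^ 3 := by
    rw [hβD]
    refine Finset.sum_congr rfl fun i _ => Finset.sum_congr rfl fun j _ => ?_
    by_cases h : i = j
    · simp [h, hdiag]
    · simp [h]
  have hβ0 : 0 ≤ βD := hβ ▸ Finset.sum_nonneg fun i _ => Finset.sum_nonneg fun j _ => by positivity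
  have hn0 : (0 : ℝ) < n := by exact_mod_cast (by omega : 0 < n)
  have hG : (fun t => F t - stdNormalCDF t) = fun t => ((fpfInvolutions n).card : ℝ)⁻¹ *
      ∑ π ∈ fpfInvolutions n, cdfGap (matchingSum d π) t := by
    funext t
    rw [hF, ← cdf_sub_eq_sum_cdfGap _ hne (matchingSum d) t]
    congr!
  have hL : eLpNorm (fun t => F t - stdNormalCDF t) 1 volume ≤
      ENNReal.ofReal (224 * βD / n) := by
    have hGi : Integrable fun t => ((fpfInvolutions n).card : ℝ)⁻¹ *
        ∑ π ∈ fpfInvolutions n, cdfGap (matchingSum d π) t :=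
      (integrable_finsetSum _ fun π _ => integrable_cdfGap (matchingSum d π)).const_mul _
    rw [hG, eLpNorm_one_eq_lintegral_enorm, ← ofReal_integral_norm_eq_lintegral_enorm hGi, hβ]
    exact ENNReal.ofReal_le_ofReal (integral_abs_sum_cdfGap_le _ hne _ fun f g hf hg3 hg =>
      abs_stein_matchingSum_le hn9 hsymm hdiag hrow hvar hf hg3 hg)
  refine ⟨hL.trans (ENNReal.ofReal_le_ofReal ?_), hL.trans (ENNReal.ofReal_le_ofReal ?_)⟩
  · rw [mul_comm 224, mul_div_right_comm]
    refine mul_le_mul_of_nonneg_left ?_ (by positivity)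
    rw [add_assoc]
    exact le_add_of_nonneg_right (by positivity)
  · gcongr
    norm_num
end

section
/- Let n > 9 be an even integer, D = (d_{ij}) a standardized n×n array, π chosen uniformly at random from Π_n, and W = Σ_{i=1}^n d_{iπ(i)}. Then ||F_W − Φ||_∞ ≤ K · β_D / n with the universal constant K = 61702446. -/
open Finset MeasureTheory ProbabilityTheory
open scoped ENNReal

namespace Matching

section Averages

variable {ι : Type*}

/-- The average of `F` over the finite set `P`. -/
noncomputable def av (P : Finset ι) (F : ι → ℝ) : ℝ := (∑ π ∈ P, F π) / P.card

lemma av_add (P : Finset ι) (F G : ι → ℝ) : av P (fun π => F π + G π) = av P F + av P G := by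
  simp only [av, Finset.sum_add_distrib, add_div]

lemma av_sub (P : Finset ι) (F G : ι → ℝ) : av P (fun π => F π - G π) = av P F - av P G := by
  simp only [av, Finset.sum_sub_distrib, sub_div]

lemma av_const_mul (P : Finset ι) (c : ℝ) (F : ι → ℝ) : av P (fun π => c * F π) = c * av P F := by
  simp only [av, ← Finset.mul_sum, mul_div_assoc]

lemma av_sum {κ : Type*} (P : Finset ι) (s : Finset κ) (F : κ → ι → ℝ) :
    av P (fun π => ∑ x ∈ s, F x π) = ∑ x ∈ s, av P (F x) := by
  simp only [av]
  rw [Finset.sum_comm, Finset.sum_div]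

lemma av_const {P : Finset ι} (hP : P.Nonempty) (c : ℝ) : av P (fun _ => c) = c := by
  have : (P.card : ℝ) ≠ 0 := by exact_mod_cast hP.card_pos.ne'
  simp [av, this]

lemma av_congr {P : Finset ι} {F G : ι → ℝ} (h : ∀ π ∈ P, F π = G π) : av P F = av P G := by
  simp only [av, Finset.sum_congr rfl h]

lemma av_mono {P : Finset ι} {F G : ι → ℝ} (h : ∀ π ∈ P, F π ≤ G π) : av P F ≤ av P G :=
  div_le_div_of_nonneg_right (Finset.sum_le_sum h) (Nat.cast_nonneg _)

lemma av_nonneg {P : Finset ι} {F : ι → ℝ} (h : ∀ π ∈ P, 0 ≤ F π) : 0 ≤ av P F :=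
  div_nonneg (Finset.sum_nonneg h) (Nat.cast_nonneg _)

lemma abs_av_le (P : Finset ι) (F : ι → ℝ) : |av P F| ≤ av P (fun π => |F π|) := by
  simp only [av, abs_div, Nat.abs_cast]
  exact div_le_div_of_nonneg_right (Finset.abs_sum_le_sum_abs _ _) (Nat.cast_nonneg _)

/-- Jensen's inequality for the square. -/
lemma av_abs_sq_le {P : Finset ι} (hP : P.Nonempty) (F : ι → ℝ) :
    (av P (fun π => |F π|)) ^ 2 ≤ av P (fun π => F π ^ 2) := by
  have h : 0 ≤ av P (fun π => (|F π| - av P (fun π => |F π|)) ^ 2) :=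
    av_nonneg fun _ _ => sq_nonneg _
  have e : av P (fun π => (|F π| - av P (fun π => |F π|)) ^ 2)
      = av P (fun π => F π ^ 2) - (av P (fun π => |F π|)) ^ 2 := by
    set a := av P (fun π => |F π|) with ha
    have : ∀ π ∈ P, (|F π| - a) ^ 2 = (F π ^ 2 - (2 * a) * |F π|) + a ^ 2 := by
      intro π _
      rw [← sq_abs (F π)]; ring
    rw [av_congr this, av_add, av_const hP, av_sub, av_const_mul, ← ha]
    ring
  linarith

end Averages

variable {α : Type*} [DecidableEq α]

/-- Conjugation by the transposition of `i` and `j`. -/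
def cj (i j : α) (π : Equiv.Perm α) : Equiv.Perm α := Equiv.swap i j * π * Equiv.swap i j

lemma cj_apply (i j : α) (π : Equiv.Perm α) (x : α) :
    cj i j π x = Equiv.swap i j (π (Equiv.swap i j x)) := rfl

lemma cj_cj (i j : α) (π : Equiv.Perm α) : cj i j (cj i j π) = π := by
  ext x; simp [cj_apply]

/-- A nonempty set `P` of fixed-point-free involutions preserving `S` which is closed under
conjugation by transpositions of points of `S`. -/
structure Inv (P : Finset (Equiv.Perm α)) (S : Finset α) : Prop where
  ne : P.Nonempty
  inv : ∀ π ∈ P, ∀ x, π (π x) = x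
  fpf : ∀ π ∈ P, ∀ x, π x ≠ x
  maps : ∀ π ∈ P, ∀ x ∈ S, π x ∈ S
  conj : ∀ π ∈ P, ∀ i ∈ S, ∀ j ∈ S, cj i j π ∈ P

/-- `S` without `i` and `k`. -/
def del (S : Finset α) (i k : α) : Finset α := (S.erase i).erase k

/-- The elements of `P` that match `i` with `k`. -/
def fx (P : Finset (Equiv.Perm α)) (i k : α) : Finset (Equiv.Perm α) := P.filter (fun π => π i = k)

lemma mem_del {S : Finset α} {i k x : α} : x ∈ del S i k ↔ x ≠ k ∧ x ≠ i ∧ x ∈ S := by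
  simp [del]

lemma mem_fx {P : Finset (Equiv.Perm α)} {i k : α} {π : Equiv.Perm α} :
    π ∈ fx P i k ↔ π ∈ P ∧ π i = k := by
  simp [fx]

lemma del_subset (S : Finset α) (i k : α) : del S i k ⊆ S :=
  fun _ h => (mem_del.1 h).2.2

lemma card_del {S : Finset α} {i k : α} (hi : i ∈ S) (hk : k ∈ S) (h : i ≠ k) :
    ((del S i k).card : ℝ) = S.card - 2 := by
  have h1 : k ∈ S.erase i := Finset.mem_erase.2 ⟨h.symm, hk⟩
  rw [del, Finset.cast_card_erase_of_mem h1, Finset.cast_card_erase_of_mem hi]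
  ring

lemma sum_del {S : Finset α} {i k : α} (hi : i ∈ S) (hk : k ∈ S) (h : i ≠ k) (F : α → ℝ) :
    ∑ x ∈ del S i k, F x = ∑ x ∈ S, F x - F i - F k := by
  have h1 : k ∈ S.erase i := Finset.mem_erase.2 ⟨h.symm, hk⟩
  rw [del, ← Finset.add_sum_erase S F hi, ← Finset.add_sum_erase _ F h1]
  ring

variable {P : Finset (Equiv.Perm α)} {S : Finset α}

lemma cj_mem_fx (h : Inv P S) {i k x : α} (hk : k ∈ S) (hx : x ∈ S) (hik : i ≠ k)
    (hix : i ≠ x) {π : Equiv.Perm α} (hπ : π ∈ fx P i x) : cj k x π ∈ fx P i k := by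
  rw [mem_fx] at hπ ⊢
  refine ⟨h.conj _ hπ.1 _ hk _ hx, ?_⟩
  rw [cj_apply, Equiv.swap_apply_of_ne_of_ne hik hix, hπ.2, Equiv.swap_apply_right]

lemma Inv.fix (h : Inv P S) {i k : α} (hi : i ∈ S) (hk : k ∈ S) (hik : i ≠ k) :
    Inv (fx P i k) (del S i k) where
  ne := by
    obtain ⟨π, hπ⟩ := h.ne
    exact ⟨cj k (π i) π, cj_mem_fx h hk (h.maps π hπ i hi) hik (h.fpf π hπ i).symm
      (mem_fx.2 ⟨hπ, rfl⟩)⟩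
  inv π hπ := h.inv π (mem_fx.1 hπ).1
  fpf π hπ := h.fpf π (mem_fx.1 hπ).1
  maps π hπ x hx := by
    have h1 := (mem_fx.1 hπ).2
    have h2 := (mem_fx.1 hπ).1
    rw [mem_del] at hx ⊢
    refine ⟨fun e => hx.2.1 ?_, fun e => hx.1 ?_, h.maps π h2 x hx.2.2⟩
    · exact π.injective (e.trans h1.symm)
    · rw [← h.inv π h2 x, e, h1]
  conj π hπ a ha b hb := by
    rw [mem_del] at ha hb
    rw [mem_fx] at hπ ⊢
    refine ⟨h.conj π hπ.1 a ha.2.2 b hb.2.2, ?_⟩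
    rw [cj_apply, Equiv.swap_apply_of_ne_of_ne ha.2.1.symm hb.2.1.symm, hπ.2,
      Equiv.swap_apply_of_ne_of_ne ha.1.symm hb.1.symm]

lemma sum_fiber (h : Inv P S) {i : α} (hi : i ∈ S) (F : Equiv.Perm α → ℝ) :
    ∑ π ∈ P, F π = ∑ x ∈ S.erase i, ∑ π ∈ fx P i x, F π :=
  (Finset.sum_fiberwise_of_maps_to
    (fun π hπ => Finset.mem_erase.2 ⟨h.fpf π hπ i, h.maps π hπ i hi⟩) F).symm

lemma sum_transfer (h : Inv P S) {i k : α} (hi : i ∈ S) (hk : k ∈ S) (hik : i ≠ k)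
    (F : Equiv.Perm α → ℝ) :
    ∑ π ∈ P, F (cj k (π i) π) = (S.card - 1) * ∑ π ∈ fx P i k, F π := by
  rw [sum_fiber h hi]
  have key : ∀ x ∈ S.erase i, ∑ π ∈ fx P i x, F (cj k (π i) π) = ∑ π ∈ fx P i k, F π := by
    intro x hx
    rw [Finset.mem_erase] at hx
    refine Finset.sum_bij' (fun π _ => cj k x π) (fun π _ => cj k x π) ?_ ?_ ?_ ?_ ?_
    · intro π hπ
      exact cj_mem_fx h hk hx.2 hik hx.1.symm hπ
    · intro π hπ
      have := cj_mem_fx h hx.2 hk hx.1.symm hik hπ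
      rwa [cj, Equiv.swap_comm] at this
    · intro π _; exact cj_cj _ _ _
    · intro π _; exact cj_cj _ _ _
    · intro π hπ; rw [(mem_fx.1 hπ).2]
  rw [Finset.sum_congr rfl key, Finset.sum_const, nsmul_eq_mul, Finset.cast_card_erase_of_mem hi]

lemma card_fx (h : Inv P S) {i k : α} (hi : i ∈ S) (hk : k ∈ S) (hik : i ≠ k) :
    (P.card : ℝ) = (S.card - 1) * (fx P i k).card := by
  have := sum_transfer h hi hk hik (fun _ => 1)
  simpa using this

lemma card_pos_of_ne (h : Inv P S) {i : α} (hi : i ∈ S) : (0 : ℝ) < S.card - 1 := by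
  obtain ⟨π, hπ⟩ := h.ne
  have : 1 < S.card := Finset.one_lt_card.2 ⟨i, hi, π i, h.maps π hπ i hi, (h.fpf π hπ i).symm⟩
  have h2 : (1 : ℝ) < S.card := by exact_mod_cast this
  linarith

lemma av_transfer (h : Inv P S) {i k : α} (hi : i ∈ S) (hk : k ∈ S) (hik : i ≠ k)
    (F : Equiv.Perm α → ℝ) :
    av P (fun π => F (cj k (π i) π)) = av (fx P i k) F := by
  have h1 := card_pos_of_ne h hi
  rw [av, av, sum_transfer h hi hk hik, card_fx h hi hk hik, mul_div_mul_left _ _ h1.ne']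

lemma av_expand (h : Inv P S) {i : α} (hi : i ∈ S) (H : α → Equiv.Perm α → ℝ) :
    av P (fun π => H (π i) π) = (S.card - 1 : ℝ)⁻¹ * ∑ k ∈ S.erase i, av (fx P i k) (H k) := by
  have h1 := card_pos_of_ne h hi
  rw [av, sum_fiber h hi, Finset.sum_div, Finset.mul_sum]
  refine Finset.sum_congr rfl fun k hk => ?_
  rw [Finset.mem_erase] at hk
  rw [card_fx h hi hk.2 hk.1.symm, av]
  have : ∑ π ∈ fx P i k, H (π i) π = ∑ π ∈ fx P i k, H k π :=
    Finset.sum_congr rfl fun π hπ => by rw [(mem_fx.1 hπ).2]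
  rw [this, div_mul_eq_div_div_swap, div_eq_inv_mul _ (S.card - 1 : ℝ)]

lemma av_expand_sum (h : Inv P S) (H : α → α → Equiv.Perm α → ℝ) :
    av P (fun π => ∑ i ∈ S, H i (π i) π)
      = (S.card - 1 : ℝ)⁻¹ * ∑ i ∈ S, ∑ k ∈ S.erase i, av (fx P i k) (H i k) := by
  rw [av_sum, Finset.mul_sum]
  exact Finset.sum_congr rfl fun i hi => av_expand h hi (H i)

/-- Summing over two distinct matched pairs. -/
lemma av_expand_two (h : Inv P S) (H : α → α → α → α → Equiv.Perm α → ℝ) :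
    av P (fun π => ∑ i ∈ S, ∑ j ∈ del S i (π i), H i (π i) j (π j) π)
      = ((S.card - 1 : ℝ)⁻¹ * (S.card - 3 : ℝ)⁻¹) * ∑ i ∈ S, ∑ k ∈ S.erase i, ∑ j ∈ del S i k,
        ∑ l ∈ (del S i k).erase j, av (fx (fx P i k) j l) (H i k j l) := by
  rw [av_expand_sum h (fun i k π => ∑ j ∈ del S i k, H i k j (π j) π), mul_assoc]
  congr 1
  rw [Finset.mul_sum]
  refine Finset.sum_congr rfl fun i hi => ?_
  rw [Finset.mul_sum]
  refine Finset.sum_congr rfl fun k hk => ?_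
  rw [Finset.mem_erase] at hk
  have h2 := h.fix hi hk.2 hk.1.symm
  rw [av_expand_sum h2 (fun j l π => H i k j l π), card_del hi hk.2 hk.1.symm]
  congr 2
  ring

/-- The sum of `d` over the points of `S` matched by `π`. -/
def W (d : α → α → ℝ) (S : Finset α) (π : Equiv.Perm α) : ℝ := ∑ i ∈ S, d i (π i)

/-- The increment of `W` under conjugation by the transposition of `i` and `j`. -/
def dl (d : α → α → ℝ) (i j : α) (π : Equiv.Perm α) : ℝ :=
  if j = i ∨ j = π i then 0 else 2 * (d i (π j) + d j (π i) - d i (π i) - d j (π j))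

/-- The row sums of `d` on `S`. -/
def row (d : α → α → ℝ) (S : Finset α) (i : α) : ℝ := ∑ j ∈ S, d i j

/-- The total sum of `d` on `S`. -/
def tot (d : α → α → ℝ) (S : Finset α) : ℝ := ∑ i ∈ S, row d S i

/-- The sum of the squares of `d` on `S`. -/
def sqs (d : α → α → ℝ) (S : Finset α) : ℝ := ∑ i ∈ S, ∑ j ∈ S, d i j ^ 2

variable {d : α → α → ℝ}

lemma sum_comp_perm (h : Inv P S) {π : Equiv.Perm α} (hπ : π ∈ P) (F : α → ℝ) :
    ∑ x ∈ S, F (π x) = ∑ x ∈ S, F x :=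
  Finset.sum_bij' (fun x _ => π x) (fun x _ => π x) (h.maps π hπ) (h.maps π hπ)
    (fun x _ => h.inv π hπ x) (fun x _ => h.inv π hπ x) (fun _ _ => rfl)

lemma cj_self (i : α) (π : Equiv.Perm α) : cj i i π = π := by
  ext x; simp [cj_apply]

lemma cj_partner {i : α} {π : Equiv.Perm α} (hinv : ∀ x, π (π x) = x) : cj i (π i) π = π := by
  ext x
  rw [cj_apply]
  by_cases h1 : x = i
  · subst h1; rw [Equiv.swap_apply_left, hinv, Equiv.swap_apply_left]
  by_cases h2 : x = π i
  · subst h2; rw [Equiv.swap_apply_right, Equiv.swap_apply_right, hinv]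
  rw [Equiv.swap_apply_of_ne_of_ne h1 h2, Equiv.swap_apply_of_ne_of_ne]
  · intro e; apply h2; rw [← e, hinv]
  · intro e; exact h1 (π.injective e)

lemma W_cj (hs : ∀ i j, d i j = d j i) (h : Inv P S) {π : Equiv.Perm α} (hπ : π ∈ P)
    {i j : α} (hi : i ∈ S) (hj : j ∈ S) : W d S (cj i j π) = W d S π + dl d i j π := by
  by_cases h0 : j = i ∨ j = π i
  · rw [dl, if_pos h0, add_zero]
    rcases h0 with rfl | rfl
    · rw [cj_self]
    · rw [cj_partner (h.inv π hπ)]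
  rw [dl, if_neg h0]
  push Not at h0
  obtain ⟨hji, hjp⟩ := h0
  have hpj : π j ≠ i := fun e => hjp (by rw [← e, h.inv π hπ])
  have hpi : π i ≠ j := hjp.symm
  have hpp : π i ≠ π j := fun e => hji (π.injective e).symm
  have h1 := h.fpf π hπ i
  have h2 := h.fpf π hπ j
  set s := Equiv.swap i j with hsw
  have hsS : ∀ x ∈ S, s x ∈ S := by
    intro x hx
    rw [hsw, Equiv.swap_apply_def]
    split_ifs <;> assumption
  have e1 : W d S (cj i j π) = ∑ x ∈ S, d (s x) (s (π x)) := by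
    rw [W]
    refine Finset.sum_bij' (fun x _ => s x) (fun x _ => s x) hsS hsS ?_ ?_ ?_
    · intro x _; exact Equiv.swap_apply_self _ _ _
    · intro x _; exact Equiv.swap_apply_self _ _ _
    · intro x _
      rw [cj_apply, ← hsw, hsw, Equiv.swap_apply_self]
  have e2 : ∑ x ∈ S, (d (s x) (s (π x)) - d x (π x))
      = ∑ x ∈ ({i, j, π i, π j} : Finset α), (d (s x) (s (π x)) - d x (π x)) := by
    symm
    refine Finset.sum_subset ?_ ?_
    · intro x hx
      simp only [Finset.mem_insert, Finset.mem_singleton] at hx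
      rcases hx with rfl | rfl | rfl | rfl
      exacts [hi, hj, h.maps π hπ _ hi, h.maps π hπ _ hj]
    · intro x _ hx
      simp only [Finset.mem_insert, Finset.mem_singleton, not_or] at hx
      obtain ⟨a1, a2, a3, a4⟩ := hx
      have b1 : π x ≠ i := fun e => a3 (by rw [← e, h.inv π hπ])
      have b2 : π x ≠ j := fun e => a4 (by rw [← e, h.inv π hπ])
      rw [hsw, Equiv.swap_apply_of_ne_of_ne a1 a2, Equiv.swap_apply_of_ne_of_ne b1 b2, sub_self]
  have e3 : ∑ x ∈ ({i, j, π i, π j} : Finset α), (d (s x) (s (π x)) - d x (π x))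
      = 2 * (d i (π j) + d j (π i) - d i (π i) - d j (π j)) := by
    rw [Finset.sum_insert (by simp [hji.symm, h1.symm, hpj.symm]),
      Finset.sum_insert (by simp [hjp, h2.symm]),
      Finset.sum_insert (by simp [hpp]), Finset.sum_singleton, h.inv π hπ, h.inv π hπ,
      hsw, Equiv.swap_apply_left, Equiv.swap_apply_right,
      Equiv.swap_apply_of_ne_of_ne h1 hpi, Equiv.swap_apply_of_ne_of_ne hpj h2,
      hs (π i) j, hs (π i) i, hs (π j) i, hs (π j) j]
    ring
  rw [e1, ← e3, ← e2, Finset.sum_sub_distrib, W]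
  ring

lemma dl_cj (hs : ∀ i j, d i j = d j i) (h : Inv P S) {π : Equiv.Perm α} (hπ : π ∈ P)
    {i j : α} (hi : i ∈ S) (hj : j ∈ S) : dl d i j (cj i j π) = - dl d i j π := by
  have h1 := W_cj hs h hπ hi hj
  have h2 := W_cj hs h (h.conj π hπ i hi j hj) hi hj
  rw [cj_cj] at h2
  linarith

lemma sum_dl (hs : ∀ i j, d i j = d j i) (hd : ∀ i, d i i = 0) (h : Inv P S)
    {π : Equiv.Perm α} (hπ : π ∈ P) :
    ∑ i ∈ S, ∑ j ∈ S, dl d i j π = 4 * (tot d S - (S.card - 1) * W d S π) := by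
  have key : ∀ i ∈ S, ∑ j ∈ S, dl d i j π
      = 2 * (row d S i + row d S (π i) - (S.card - 2) * d i (π i) - W d S π) := by
    intro i hi
    have hpi := h.maps π hπ i hi
    have hne := h.fpf π hπ i
    have e1 : ∑ j ∈ S, dl d i j π
        = ∑ j ∈ del S i (π i), 2 * (d i (π j) + d j (π i) - d i (π i) - d j (π j)) := by
      symm
      rw [← Finset.sum_subset (del_subset S i (π i))]
      · refine Finset.sum_congr rfl fun j hj => ?_
        rw [mem_del] at hj
        rw [dl, if_neg (not_or.2 ⟨hj.2.1, hj.1⟩)]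
      · intro j hj hj2
        rw [dl, if_pos]
        by_contra hc
        push Not at hc
        exact hj2 (mem_del.2 ⟨hc.2, hc.1, hj⟩)
    rw [e1, sum_del hi hpi hne.symm, ← Finset.mul_sum, h.inv π hπ, hd, hd, hs (π i) i]
    simp only [Finset.sum_sub_distrib, Finset.sum_add_distrib, Finset.sum_const, nsmul_eq_mul]
    rw [sum_comp_perm h hπ (fun x => d i x)]
    have : ∑ x ∈ S, d x (π i) = row d S (π i) := Finset.sum_congr rfl fun x _ => hs _ _
    rw [this]
    simp only [row, W]
    ring
  rw [Finset.sum_congr rfl key, ← Finset.mul_sum]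
  simp only [Finset.sum_sub_distrib, Finset.sum_add_distrib, Finset.sum_const, nsmul_eq_mul,
    ← Finset.mul_sum]
  rw [sum_comp_perm h hπ (fun x => row d S x)]
  simp only [tot, W]
  ring

/-- The exchangeable pair identity. -/
lemma av_exchange (hs : ∀ i j, d i j = d j i) (hd : ∀ i, d i i = 0) (h : Inv P S) (f : ℝ → ℝ) :
    av P (fun π => ∑ i ∈ S, ∑ j ∈ S, dl d i j π * (f (W d S π + dl d i j π) - f (W d S π)))
      = 8 * av P (fun π => ((S.card - 1) * W d S π - tot d S) * f (W d S π)) := by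
  have key : ∀ i ∈ S, ∀ j ∈ S, av P (fun π => dl d i j π * f (W d S π + dl d i j π))
      = av P (fun π => - (dl d i j π * f (W d S π))) := by
    intro i hi j hj
    simp only [av]
    congr 1
    refine Finset.sum_bij' (fun π _ => cj i j π) (fun π _ => cj i j π) ?_ ?_ ?_ ?_ ?_
    · intro π hπ; exact h.conj π hπ i hi j hj
    · intro π hπ; exact h.conj π hπ i hi j hj
    · intro π _; exact cj_cj _ _ _
    · intro π _; exact cj_cj _ _ _
    · intro π hπ
      rw [dl_cj hs h hπ hi hj, W_cj hs h hπ hi hj]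
      ring
  have e1 : av P (fun π => ∑ i ∈ S, ∑ j ∈ S,
        dl d i j π * (f (W d S π + dl d i j π) - f (W d S π)))
      = ∑ i ∈ S, ∑ j ∈ S, av P (fun π => (-2) * (dl d i j π * f (W d S π))) := by
    rw [av_sum]
    refine Finset.sum_congr rfl fun i hi => ?_
    rw [av_sum]
    refine Finset.sum_congr rfl fun j hj => ?_
    have e2 : ∀ π ∈ P, dl d i j π * (f (W d S π + dl d i j π) - f (W d S π))
      = dl d i j π * f (W d S π + dl d i j π) + - (dl d i j π * f (W d S π)) := by
      intro π _; ring
    rw [av_congr e2, av_add, key i hi j hj, ← av_add]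
    exact av_congr fun π _ => by ring
  rw [e1, ← av_const_mul]
  simp only [← av_sum]
  refine av_congr fun π hπ => ?_
  simp only [← Finset.mul_sum, ← Finset.sum_mul]
  rw [sum_dl hs hd h hπ]
  ring

lemma av_W (hs : ∀ i j, d i j = d j i) (hd : ∀ i, d i i = 0) (h : Inv P S) :
    (S.card - 1) * av P (W d S) = tot d S := by
  have := av_exchange hs hd h (fun _ => 1)
  simp only [sub_self, mul_zero, Finset.sum_const_zero, mul_one] at this
  rw [av_const h.ne, av_sub, av_const_mul, av_const h.ne] at this
  linarith

lemma W_del (hs : ∀ i j, d i j = d j i) (h : Inv P S) {π : Equiv.Perm α} (hπ : π ∈ P) {i : α}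
    (hi : i ∈ S) : W d S π = 2 * d i (π i) + W d (del S i (π i)) π := by
  rw [W, W, sum_del hi (h.maps π hπ i hi) (h.fpf π hπ i).symm, h.inv π hπ, hs (π i) i]
  ring

lemma tot_del (hs : ∀ i j, d i j = d j i) (hd : ∀ i, d i i = 0) {i k : α} (hi : i ∈ S)
    (hk : k ∈ S) (hik : i ≠ k) :
    tot d (del S i k) = tot d S - 2 * row d S i - 2 * row d S k + 2 * d i k := by
  have e : ∀ x, row d (del S i k) x = row d S x - d i x - d k x := by
    intro x
    rw [row, sum_del hi hk hik, row, hs x i, hs x k]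
  rw [tot, sum_del hi hk hik]
  simp only [e, Finset.sum_sub_distrib, tot, hd]
  rw [hs k i]
  simp only [row]
  ring

lemma sum_erase_diag (hd : ∀ i, d i i = 0) {i : α} (hi : i ∈ S) (G : α → ℝ) :
    ∑ k ∈ S.erase i, d i k * G k = ∑ k ∈ S, d i k * G k := by
  rw [← Finset.add_sum_erase S _ hi, hd]; ring

omit [DecidableEq α] in
lemma sum_mul_row (hs : ∀ i j, d i j = d j i) :
    ∑ i ∈ S, ∑ k ∈ S, d i k * row d S k = ∑ i ∈ S, row d S i ^ 2 := by
  rw [Finset.sum_comm]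
  refine Finset.sum_congr rfl fun k _ => ?_
  rw [← Finset.sum_mul, sq]
  congr 1
  exact Finset.sum_congr rfl fun x _ => hs _ _

/-- The second moment of `W`. -/
lemma av_W_sq (hs : ∀ i j, d i j = d j i) (hd : ∀ i, d i i = 0) (h : Inv P S)
    (hm : (3 : ℝ) < S.card) :
    av P (fun π => W d S π ^ 2) = (S.card - 1 : ℝ)⁻¹ * (2 * sqs d S + (S.card - 3 : ℝ)⁻¹ *
      (tot d S ^ 2 - 4 * ∑ i ∈ S, row d S i ^ 2 + 2 * sqs d S)) := by
  have e1 : av P (fun π => W d S π ^ 2) = av P (fun π => ∑ i ∈ S, d i (π i) * W d S π) := by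
    refine av_congr fun π _ => ?_
    rw [← Finset.sum_mul, sq]; rfl
  have hm3 : (S.card - 3 : ℝ) ≠ 0 := by linarith
  rw [e1, av_expand_sum h (fun i k π => d i k * W d S π)]
  congr 1
  have e2 : ∀ i ∈ S, ∑ k ∈ S.erase i, av (fx P i k) (fun π => d i k * W d S π)
      = ∑ k ∈ S, d i k * (2 * d i k + (S.card - 3 : ℝ)⁻¹ *
        (tot d S - 2 * row d S i - 2 * row d S k + 2 * d i k)) := by
    intro i hi
    rw [← sum_erase_diag hd hi]
    refine Finset.sum_congr rfl fun k hk => ?_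
    rw [Finset.mem_erase] at hk
    have h2 := h.fix hi hk.2 hk.1.symm
    rw [av_const_mul]
    congr 1
    have e3 : av (fx P i k) (W d S) = av (fx P i k) (fun π => 2 * d i k + W d (del S i k) π) := by
      refine av_congr fun π hπ => ?_
      rw [mem_fx] at hπ
      rw [W_del hs h hπ.1 hi, hπ.2]
    have e4 := av_W hs hd h2
    rw [card_del hi hk.2 hk.1.symm, tot_del hs hd hi hk.2 hk.1.symm] at e4
    rw [show av (fx P i k) (fun π => W d S π) = av (fx P i k) (W d S) from rfl,
      e3, av_add, av_const h2.ne, ← e4]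
    have : (S.card - 2 - 1 : ℝ) = S.card - 3 := by ring
    rw [this, inv_mul_cancel_left₀ hm3]
  rw [Finset.sum_congr rfl e2]
  have e5 : ∀ i ∈ S, ∀ k ∈ S, d i k * (2 * d i k + (S.card - 3 : ℝ)⁻¹ *
        (tot d S - 2 * row d S i - 2 * row d S k + 2 * d i k))
      = 2 * d i k ^ 2 + (S.card - 3 : ℝ)⁻¹ * (tot d S * d i k - 2 * (row d S i * d i k)
        - 2 * (d i k * row d S k) + 2 * d i k ^ 2) := by
    intro i _ k _; ring
  rw [Finset.sum_congr rfl fun i hi => Finset.sum_congr rfl (e5 i hi)]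
  simp only [Finset.sum_add_distrib, Finset.sum_sub_distrib, ← Finset.mul_sum]
  rw [sum_mul_row hs]
  have e6 : ∑ i ∈ S, row d S i * ∑ k ∈ S, d i k = ∑ i ∈ S, row d S i ^ 2 :=
    Finset.sum_congr rfl fun i _ => by rw [sq]; rfl
  have e7 : ∑ i ∈ S, ∑ k ∈ S, d i k = tot d S := rfl
  rw [e6, e7, ← show sqs d S = ∑ i ∈ S, ∑ j ∈ S, d i j ^ 2 from rfl]
  ring

/-- The truncated square `|x| min(|x|, ε)`. -/
noncomputable def tsq (ε x : ℝ) : ℝ := |x| * min |x| ε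

lemma tsq_zero (ε : ℝ) : tsq ε 0 = 0 := by simp [tsq]

lemma tsq_nonneg {ε : ℝ} (hε : 0 < ε) (x : ℝ) : 0 ≤ tsq ε x :=
  mul_nonneg (abs_nonneg _) (le_min (abs_nonneg _) hε.le)

lemma tsq_le_sq (ε x : ℝ) : tsq ε x ≤ x ^ 2 := by
  rw [← sq_abs, sq]
  exact mul_le_mul_of_nonneg_left (min_le_left _ _) (abs_nonneg _)

lemma tsq_sq_le {ε : ℝ} (hε : 0 < ε) (x : ℝ) : tsq ε x ^ 2 ≤ ε ^ 2 * x ^ 2 := by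
  rw [tsq, mul_pow, sq_abs, mul_comm]
  exact mul_le_mul_of_nonneg_right
    (pow_le_pow_left₀ (le_min (abs_nonneg _) hε.le) (min_le_right _ _) 2) (sq_nonneg _)

lemma le_tsq {ε : ℝ} (hε : 0 < ε) (x : ℝ) : x ^ 2 - ε⁻¹ * |x| ^ 3 ≤ tsq ε x := by
  have h0 := abs_nonneg x
  rw [tsq, ← sq_abs]
  rcases le_total |x| ε with h | h
  · rw [min_eq_left h]
    have : 0 ≤ ε⁻¹ * |x| ^ 3 := by positivity
    nlinarith
  · rw [min_eq_right h]
    have h1 : 1 ≤ ε⁻¹ * |x| := by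
      rw [← div_eq_inv_mul, one_le_div hε]; exact h
    have h2 : |x| ^ 2 * 1 ≤ |x| ^ 2 * (ε⁻¹ * |x|) := mul_le_mul_of_nonneg_left h1 (sq_nonneg _)
    have h3 : 0 ≤ |x| * ε := by positivity
    nlinarith

lemma sum_fun_dl {ψ : ℝ → ℝ} (hψ : ψ 0 = 0) (i : α) (π : Equiv.Perm α) (F : α → ℝ) :
    ∑ j ∈ S, ψ (dl d i j π) * F j = ∑ j ∈ del S i (π i),
      ψ (2 * (d i (π j) + d j (π i) - d i (π i) - d j (π j))) * F j := by
  symm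
  rw [← Finset.sum_subset (del_subset S i (π i))]
  · refine Finset.sum_congr rfl fun j hj => ?_
    rw [mem_del] at hj
    rw [dl, if_neg (not_or.2 ⟨hj.2.1, hj.1⟩)]
  · intro j hj hj2
    rw [dl, if_pos, hψ, zero_mul]
    by_contra hc
    push Not at hc
    exact hj2 (mem_del.2 ⟨hc.2, hc.1, hj⟩)

/-- The value of the increment `dl` when `i` is matched with `k` and `j` with `l`. -/
def qd (d : α → α → ℝ) (i k j l : α) : ℝ := 2 * (d i l + d j k - d i k - d j l)

/-- The sum of `H` over quadruples of distinct points of `S`. -/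
def qsum (S : Finset α) (H : α → α → α → α → ℝ) : ℝ :=
  ∑ i ∈ S, ∑ k ∈ S.erase i, ∑ j ∈ del S i k, ∑ l ∈ (del S i k).erase j, H i k j l

lemma qsum_mono_fun {H H' : α → α → α → α → ℝ}
    (hH : ∀ i ∈ S, ∀ k ∈ S.erase i, ∀ j ∈ del S i k, ∀ l ∈ (del S i k).erase j,
      H i k j l ≤ H' i k j l) : qsum S H ≤ qsum S H' :=
  Finset.sum_le_sum fun i hi => Finset.sum_le_sum fun k hk => Finset.sum_le_sum fun j hj =>
    Finset.sum_le_sum fun l hl => hH i hi k hk j hj l hl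

lemma qsum_mono_set {S' : Finset α} (hS : S ⊆ S') {H : α → α → α → α → ℝ}
    (hH : ∀ i k j l, 0 ≤ H i k j l) : qsum S H ≤ qsum S' H := by
  have hdel : ∀ i k, del S i k ⊆ del S' i k := fun i k =>
    Finset.erase_subset_erase _ (Finset.erase_subset_erase _ hS)
  unfold qsum
  refine (Finset.sum_le_sum fun i _ => ?_).trans
    (Finset.sum_le_sum_of_subset_of_nonneg hS fun i _ _ => Finset.sum_nonneg fun k _ =>
      Finset.sum_nonneg fun j _ => Finset.sum_nonneg fun l _ => hH i k j l)
  refine (Finset.sum_le_sum fun k _ => ?_).trans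
    (Finset.sum_le_sum_of_subset_of_nonneg (Finset.erase_subset_erase i hS) fun k _ _ =>
      Finset.sum_nonneg fun j _ => Finset.sum_nonneg fun l _ => hH i k j l)
  refine (Finset.sum_le_sum fun j _ => ?_).trans
    (Finset.sum_le_sum_of_subset_of_nonneg (hdel i k) fun j _ _ =>
      Finset.sum_nonneg fun l _ => hH i k j l)
  exact Finset.sum_le_sum_of_subset_of_nonneg (Finset.erase_subset_erase j (hdel i k))
    fun l _ _ => hH i k j l

lemma qsum_const_mul (c : ℝ) (H : α → α → α → α → ℝ) :
    qsum S (fun i k j l => c * H i k j l) = c * qsum S H := by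
  simp only [qsum, Finset.mul_sum]

lemma qsum_add (H H' : α → α → α → α → ℝ) :
    qsum S (fun i k j l => H i k j l + H' i k j l) = qsum S H + qsum S H' := by
  simp only [qsum, Finset.sum_add_distrib]

lemma av_sum_fun_dl (h : Inv P S) {ψ : ℝ → ℝ} (hψ : ψ 0 = 0)
    (F : α → α → α → α → Equiv.Perm α → ℝ) :
    av P (fun π => ∑ i ∈ S, ∑ j ∈ S, ψ (dl d i j π) * F i (π i) j (π j) π)
      = ((S.card - 1 : ℝ)⁻¹ * (S.card - 3 : ℝ)⁻¹) * qsum S (fun i k j l =>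
        ψ (qd d i k j l) * av (fx (fx P i k) j l) (F i k j l)) := by
  have e : ∀ π ∈ P, ∑ i ∈ S, ∑ j ∈ S, ψ (dl d i j π) * F i (π i) j (π j) π
      = ∑ i ∈ S, ∑ j ∈ del S i (π i), ψ (qd d i (π i) j (π j)) * F i (π i) j (π j) π :=
    fun π _ => Finset.sum_congr rfl fun i _ =>
      sum_fun_dl hψ i π (fun j => F i (π i) j (π j) π)
  rw [av_congr e, av_expand_two h (fun i k j l π => ψ (qd d i k j l) * F i k j l π)]
  simp only [qsum, av_const_mul]

lemma dl_comm (h : Inv P S) {π : Equiv.Perm α} (hπ : π ∈ P) (i j : α) :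
    dl d i j π = dl d j i π := by
  have : (j = i ∨ j = π i) ↔ (i = j ∨ i = π j) := by
    constructor
    · rintro (rfl | rfl)
      · exact Or.inl rfl
      · exact Or.inr (h.inv π hπ _).symm
    · rintro (rfl | rfl)
      · exact Or.inl rfl
      · exact Or.inr (h.inv π hπ _).symm
  simp only [dl, this]
  split_ifs
  · rfl
  · ring

lemma sum_sum_del_le {q : α → α → ℝ} (hq : ∀ a b, 0 ≤ q a b) (hqs : ∀ a b, q a b = q b a)
    {x y : α} (hx : x ∈ S) (hy : y ∈ S) (hxy : x ≠ y) :
    ∑ a ∈ S, ∑ b ∈ S, q a b ≤ ∑ a ∈ del S x y, ∑ b ∈ del S x y, q a b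
      + (2 * ∑ b ∈ S, q x b + 2 * ∑ b ∈ S, q y b) := by
  have e1 := sum_del hx hy hxy (fun a => ∑ b ∈ S, q a b)
  have e2 : ∀ a, ∑ b ∈ del S x y, q a b = ∑ b ∈ S, q a b - q x a - q y a := fun a => by
    rw [sum_del hx hy hxy, hqs x a, hqs y a]
  simp only [e2, Finset.sum_sub_distrib]
  linarith [hq x x, hq y x, hq x y, hq y y]

/-- The sum of truncated squares of all increments. -/
noncomputable def tsum (d : α → α → ℝ) (ε : ℝ) (S : Finset α) (π : Equiv.Perm α) : ℝ :=
  ∑ i ∈ S, ∑ j ∈ S, tsq ε (dl d i j π)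

lemma av_tsum (h : Inv P S) (ε : ℝ) : av P (tsum d ε S)
    = ((S.card - 1 : ℝ)⁻¹ * (S.card - 3 : ℝ)⁻¹) * qsum S (fun i k j l =>
      tsq ε (qd d i k j l)) := by
  have e := av_sum_fun_dl (d := d) h (tsq_zero ε) (fun _ _ _ _ _ => 1)
  simp only [mul_one] at e
  change av P (fun π => ∑ i ∈ S, ∑ j ∈ S, tsq ε (dl d i j π)) = _
  rw [e]
  congr 1
  refine Finset.sum_congr rfl fun i hi => Finset.sum_congr rfl fun k hk =>
    Finset.sum_congr rfl fun j hj => Finset.sum_congr rfl fun l hl => ?_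
  have hk' := Finset.mem_erase.1 hk
  have hl' := Finset.mem_erase.1 hl
  dsimp only
  rw [av_const ((h.fix hi hk'.2 hk'.1.symm).fix hj hl'.2 hl'.1.symm).ne, mul_one]

lemma tsum_overlap_le (h : Inv P S) {π : Equiv.Perm α} (hπ : π ∈ P) (ε : ℝ) :
    ∑ i ∈ S, ∑ j ∈ S, tsq ε (dl d i j π) * ∑ b ∈ S, 2 * (tsq ε (dl d i b π)
      + tsq ε (dl d (π i) b π) + tsq ε (dl d j b π) + tsq ε (dl d (π j) b π))
    ≤ 8 * S.card * ∑ i ∈ S, ∑ j ∈ S, tsq ε (dl d i j π) ^ 2 := by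
  set g : α → α → ℝ := fun i j => tsq ε (dl d i j π)
  change ∑ i ∈ S, ∑ j ∈ S, g i j * ∑ b ∈ S, 2 * (g i b + g (π i) b + g j b + g (π j) b)
    ≤ 8 * S.card * ∑ i ∈ S, ∑ j ∈ S, g i j ^ 2
  have h1 : ∑ i ∈ S, ∑ j ∈ S, g i j * ∑ b ∈ S, 2 * (g i b + g (π i) b + g j b + g (π j) b)
      ≤ ∑ i ∈ S, ∑ j ∈ S, ∑ b ∈ S, (4 * g i j ^ 2 + g i b ^ 2 + g (π i) b ^ 2 + g j b ^ 2
        + g (π j) b ^ 2) := by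
    refine Finset.sum_le_sum fun i _ => Finset.sum_le_sum fun j _ => ?_
    rw [Finset.mul_sum]
    refine Finset.sum_le_sum fun b _ => ?_
    nlinarith [sq_nonneg (g i j - g i b), sq_nonneg (g i j - g (π i) b),
      sq_nonneg (g i j - g j b), sq_nonneg (g i j - g (π j) b)]
  refine h1.trans (le_of_eq ?_)
  simp only [Finset.sum_add_distrib, Finset.sum_const, nsmul_eq_mul, ← Finset.mul_sum]
  rw [sum_comp_perm h hπ (fun x => ∑ b ∈ S, g x b ^ 2)]
  ring

lemma av_tsum_sq_le (h : Inv P S) (hm : (7 : ℝ) < S.card) {ε : ℝ} (hε : 0 < ε) :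
    av P (fun π => tsum d ε S π ^ 2)
      ≤ ((S.card - 1) * (S.card - 3)) / ((S.card - 5) * (S.card - 7)) * av P (tsum d ε S) ^ 2
        + 8 * S.card * av P (fun π => ∑ i ∈ S, ∑ j ∈ S, tsq ε (dl d i j π) ^ 2) := by
  have p1 : (0 : ℝ) < S.card - 1 := by linarith
  have p3 : (0 : ℝ) < S.card - 3 := by linarith
  have p5 : (0 : ℝ) < S.card - 5 := by linarith
  have p7 : (0 : ℝ) < S.card - 7 := by linarith
  set c : ℝ := (S.card - 1 : ℝ)⁻¹ * (S.card - 3 : ℝ)⁻¹ with hc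
  have hc0 : 0 < c := by positivity
  set Q := qsum S (fun i k j l => tsq ε (qd d i k j l)) with hQ
  set O : α → α → α → α → Equiv.Perm α → ℝ := fun i k j l π => ∑ b ∈ S,
    2 * (tsq ε (dl d i b π) + tsq ε (dl d k b π) + tsq ε (dl d j b π) + tsq ε (dl d l b π)) with hO
  have e1 : av P (fun π => tsum d ε S π ^ 2) = c * qsum S (fun i k j l =>
      tsq ε (qd d i k j l) * av (fx (fx P i k) j l) (tsum d ε S)) := by
    rw [hc, ← av_sum_fun_dl h (tsq_zero ε) (fun _ _ _ _ π => tsum d ε S π)]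
    refine av_congr fun π _ => ?_
    simp only [← Finset.sum_mul]
    rw [sq]; rfl
  have e2 : qsum S (fun i k j l => tsq ε (qd d i k j l) * av (fx (fx P i k) j l) (tsum d ε S))
      ≤ qsum S (fun i k j l => (((S.card - 5 : ℝ)⁻¹ * (S.card - 7 : ℝ)⁻¹) * Q)
        * tsq ε (qd d i k j l) + tsq ε (qd d i k j l) * av (fx (fx P i k) j l) (O i k j l)) := by
    refine qsum_mono_fun fun i hi k hk j hj l hl => ?_
    have hk' := Finset.mem_erase.1 hk
    have hl' := Finset.mem_erase.1 hl
    have hi1 := h.fix hi hk'.2 hk'.1.symm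
    have hi2 := hi1.fix hj hl'.2 hl'.1.symm
    have b1 : av (fx (fx P i k) j l) (tsum d ε S) ≤ av (fx (fx P i k) j l)
        (fun π => tsum d ε (del (del S i k) j l) π + O i k j l π) := by
      refine av_mono fun π hπ => ?_
      have hq : ∀ a b, 0 ≤ tsq ε (dl d a b π) := fun a b => tsq_nonneg hε _
      have hqs : ∀ a b, tsq ε (dl d a b π) = tsq ε (dl d b a π) := fun a b => by
        rw [dl_comm hi2 hπ]
      have c1 := sum_sum_del_le hq hqs hi hk'.2 hk'.1.symm
      have c2 := sum_sum_del_le hq hqs hj hl'.2 hl'.1.symm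
      have c3 : ∀ a, ∑ b ∈ del S i k, tsq ε (dl d a b π) ≤ ∑ b ∈ S, tsq ε (dl d a b π) :=
        fun a => Finset.sum_le_sum_of_subset_of_nonneg (del_subset _ _ _) fun _ _ _ => hq _ _
      have c4 := c3 j
      have c5 := c3 l
      simp only [tsum, hO, ← Finset.mul_sum, Finset.sum_add_distrib]
      linarith
    have b2 : av (fx (fx P i k) j l) (tsum d ε (del (del S i k) j l))
        ≤ ((S.card - 5 : ℝ)⁻¹ * (S.card - 7 : ℝ)⁻¹) * Q := by
      rw [av_tsum hi2, card_del hj hl'.2 hl'.1.symm, card_del hi hk'.2 hk'.1.symm,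
        show (S.card - 2 - 2 - 1 : ℝ) = S.card - 5 by ring,
        show (S.card - 2 - 2 - 3 : ℝ) = S.card - 7 by ring]
      refine mul_le_mul_of_nonneg_left ?_ (by positivity)
      exact qsum_mono_set ((del_subset _ _ _).trans (del_subset _ _ _))
        fun _ _ _ _ => tsq_nonneg hε _
    rw [av_add] at b1
    have b3 := mul_le_mul_of_nonneg_left b1 (tsq_nonneg hε (qd d i k j l))
    have b4 := mul_le_mul_of_nonneg_left b2 (tsq_nonneg hε (qd d i k j l))
    have b5 : tsq ε (qd d i k j l) * av (fx (fx P i k) j l) (fun π => O i k j l π)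
      = tsq ε (qd d i k j l) * av (fx (fx P i k) j l) (O i k j l) := rfl
    have b6 : tsq ε (qd d i k j l)
        * av (fx (fx P i k) j l) (fun π => tsum d ε (del (del S i k) j l) π)
      = tsq ε (qd d i k j l) * av (fx (fx P i k) j l) (tsum d ε (del (del S i k) j l)) := rfl
    linarith
  have e3 : c * qsum S (fun i k j l => tsq ε (qd d i k j l) * av (fx (fx P i k) j l) (O i k j l))
      ≤ 8 * S.card * av P (fun π => ∑ i ∈ S, ∑ j ∈ S, tsq ε (dl d i j π) ^ 2) := by
    rw [hc, ← av_sum_fun_dl h (tsq_zero ε) O, ← av_const_mul]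
    exact av_mono fun π hπ => tsum_overlap_le h hπ ε
  have e4 := mul_le_mul_of_nonneg_left e2 hc0.le
  rw [qsum_add, qsum_const_mul, ← hQ, mul_add] at e4
  rw [e1]
  refine e4.trans (add_le_add (le_of_eq ?_) e3)
  rw [av_tsum h, ← hQ, hc]
  field_simp

lemma pow_three_add_four (a b c e : ℝ) (ha : 0 ≤ a) (hb : 0 ≤ b) (hc : 0 ≤ c) (he : 0 ≤ e) :
    (a + b + c + e) ^ 3 ≤ 16 * (a ^ 3 + b ^ 3 + c ^ 3 + e ^ 3) := by
  have two : ∀ x y : ℝ, 0 ≤ x → 0 ≤ y → (x + y) ^ 3 ≤ 4 * (x ^ 3 + y ^ 3) := by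
    intro x y hx hy
    nlinarith [mul_nonneg (add_nonneg hx hy) (sq_nonneg (x - y))]
  have h1 := two (a + b) (c + e) (by positivity) (by positivity)
  have h2 := two a b ha hb
  have h3 := two c e hc he
  have : a + b + c + e = (a + b) + (c + e) := by ring
  rw [this]
  linarith

/-- The sum of the absolute third powers of `d` on `S`. -/
def cubes (d : α → α → ℝ) (S : Finset α) : ℝ := ∑ i ∈ S, ∑ j ∈ S, |d i j| ^ 3

lemma abs_dl_le (d : α → α → ℝ) (i j : α) (π : Equiv.Perm α) :
    |dl d i j π| ≤ 2 * (|d i (π j)| + |d j (π i)| + |d i (π i)| + |d j (π j)|) := by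
  rw [dl]
  split_ifs
  · rw [abs_zero]; positivity
  · rw [abs_mul, abs_two]
    have h1 := abs_sub (d i (π j) + d j (π i) - d i (π i)) (d j (π j))
    have h2 := abs_sub (d i (π j) + d j (π i)) (d i (π i))
    have h3 := abs_add_le (d i (π j)) (d j (π i))
    linarith

omit [DecidableEq α] in
lemma cubes_nonneg : 0 ≤ cubes d S :=
  Finset.sum_nonneg fun _ _ => Finset.sum_nonneg fun _ _ => pow_nonneg (abs_nonneg _) 3

lemma av_sum_cube_partner (hd : ∀ i, d i i = 0) (h : Inv P S) :
    av P (fun π => ∑ i ∈ S, |d i (π i)| ^ 3) = (S.card - 1 : ℝ)⁻¹ * cubes d S := by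
  rw [av_expand_sum h (fun i k _ => |d i k| ^ 3)]
  congr 1
  refine Finset.sum_congr rfl fun i hi => ?_
  rw [← Finset.add_sum_erase S _ hi, hd]
  simp only [abs_zero, ne_eq, OfNat.ofNat_ne_zero, not_false_eq_true, zero_pow, zero_add]
  refine Finset.sum_congr rfl fun k hk => ?_
  have hk' := Finset.mem_erase.1 hk
  rw [av_const (h.fix hi hk'.2 hk'.1.symm).ne]

lemma av_sum_dl_cube_le (hd : ∀ i, d i i = 0) (h : Inv P S) (hm : (1000 : ℝ) ≤ S.card) :
    av P (fun π => ∑ i ∈ S, ∑ j ∈ S, |dl d i j π| ^ 3) ≤ 520 * cubes d S := by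
  have h1 : ∀ π ∈ P, ∑ i ∈ S, ∑ j ∈ S, |dl d i j π| ^ 3
      ≤ 256 * cubes d S + (256 * S.card) * ∑ i ∈ S, |d i (π i)| ^ 3 := by
    intro π hπ
    have e : ∑ i ∈ S, ∑ j ∈ S, |dl d i j π| ^ 3 ≤ ∑ i ∈ S, ∑ j ∈ S,
        128 * (|d i (π j)| ^ 3 + |d j (π i)| ^ 3 + |d i (π i)| ^ 3 + |d j (π j)| ^ 3) := by
      refine Finset.sum_le_sum fun i _ => Finset.sum_le_sum fun j _ => ?_
      refine (pow_le_pow_left₀ (abs_nonneg _) (abs_dl_le d i j π) 3).trans ?_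
      rw [mul_pow]
      have := pow_three_add_four _ _ _ _ (abs_nonneg (d i (π j))) (abs_nonneg (d j (π i)))
        (abs_nonneg (d i (π i))) (abs_nonneg (d j (π j)))
      linarith
    refine e.trans (le_of_eq ?_)
    have e1 : ∀ i, ∑ j ∈ S, |d i (π j)| ^ 3 = ∑ j ∈ S, |d i j| ^ 3 := fun i =>
      sum_comp_perm h hπ (fun x => |d i x| ^ 3)
    have e2 : ∑ i ∈ S, ∑ j ∈ S, |d j (π i)| ^ 3 = cubes d S := by
      rw [sum_comp_perm h hπ (fun x => ∑ j ∈ S, |d j x| ^ 3), Finset.sum_comm, cubes]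
    have e3 : ∑ i ∈ S, ∑ j ∈ S, |d i j| ^ 3 = cubes d S := rfl
    simp only [← Finset.mul_sum, Finset.sum_add_distrib, e1, e2, e3, Finset.sum_const,
      nsmul_eq_mul]
    ring
  refine (av_mono h1).trans ?_
  rw [av_add, av_const h.ne, av_const_mul, av_sum_cube_partner hd h]
  have hb := cubes_nonneg (d := d) (S := S)
  have h2 : (256 * S.card : ℝ) * (S.card - 1 : ℝ)⁻¹ ≤ 264 := by
    rw [← div_eq_mul_inv, div_le_iff₀ (by linarith)]
    linarith
  nlinarith [mul_le_mul_of_nonneg_right h2 hb]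

/-- The linear function `w ↦ w - z` truncated at `±a`. -/
noncomputable def clamp (z a w : ℝ) : ℝ := max (-a) (min (w - z) a)

lemma abs_clamp_le {a : ℝ} (ha : 0 ≤ a) (z w : ℝ) : |clamp z a w| ≤ a := by
  rw [abs_le, clamp]
  exact ⟨le_max_left _ _, max_le (by linarith) (min_le_right _ _)⟩

lemma clamp_mono (z a : ℝ) : Monotone (clamp z a) := fun x y hxy =>
  max_le_max le_rfl (min_le_min (by linarith) le_rfl)

lemma mul_clamp_sub_nonneg (z a w x : ℝ) : 0 ≤ x * (clamp z a (w + x) - clamp z a w) := by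
  rcases le_total 0 x with h | h
  · exact mul_nonneg h (sub_nonneg.2 (clamp_mono z a (by linarith)))
  · exact mul_nonneg_of_nonpos_of_nonpos h (sub_nonpos.2 (clamp_mono z a (by linarith)))

lemma tsq_le_mul_clamp_sub {r ε z w : ℝ} (hε : 0 < ε) (hw : |w - z| ≤ r) (x : ℝ) :
    tsq ε x ≤ x * (clamp z (r + ε) (w + x) - clamp z (r + ε) w) := by
  rw [abs_le] at hw
  have e : clamp z (r + ε) w = w - z := by
    rw [clamp, min_eq_left (by linarith), max_eq_right (by linarith)]
  rw [e, tsq]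
  rcases le_total 0 x with h | h
  · rw [abs_of_nonneg h]
    refine mul_le_mul_of_nonneg_left ?_ h
    rw [clamp]
    refine le_sub_iff_add_le.2 (le_trans ?_ (le_max_right _ _))
    refine le_min ?_ ?_
    · linarith [min_le_left x ε]
    · linarith [min_le_right x ε]
  · rw [abs_of_nonpos h]
    have : clamp z (r + ε) (w + x) - (w - z) ≤ - min (-x) ε := by
      rw [clamp, sub_le_iff_le_add]
      refine max_le ?_ ((min_le_left _ _).trans ?_)
      · linarith [min_le_right (-x) ε]
      · linarith [min_le_left (-x) ε]
    nlinarith [mul_le_mul_of_nonneg_left this (neg_nonneg.2 h)]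

/-- The indicator of `|w - z| ≤ r`. -/
noncomputable def win (z r w : ℝ) : ℝ := if |w - z| ≤ r then 1 else 0

lemma win_nonneg (z r w : ℝ) : 0 ≤ win z r w := by
  rw [win]; split_ifs <;> norm_num

/-- The variance of `W` controls the mean square of the increments. -/
lemma av_sum_dl_sq (hs : ∀ i j, d i j = d j i) (hd : ∀ i, d i i = 0) (h : Inv P S) :
    av P (fun π => ∑ i ∈ S, ∑ j ∈ S, dl d i j π ^ 2)
      = 8 * (S.card - 1) * (av P (fun π => W d S π ^ 2) - av P (W d S) ^ 2) := by
  have e := av_exchange hs hd h id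
  have e1 : ∀ π ∈ P, ((S.card - 1) * W d S π - tot d S) * id (W d S π)
      = (S.card - 1) * W d S π ^ 2 - tot d S * W d S π := fun π _ => by
    simp only [id]; ring
  rw [av_congr e1, av_sub, av_const_mul, av_const_mul, ← av_W hs hd h] at e
  simp only [id, add_sub_cancel_left, ← sq] at e
  rw [e, show av P (fun π => W d S π) = av P (W d S) from rfl]
  ring

/-- The concentration inequality. -/
lemma concentration (hs : ∀ i j, d i j = d j i) (hd : ∀ i, d i i = 0) (h : Inv P S)
    (hm : (1000 : ℝ) ≤ S.card)
    (hV1 : 0.9 ≤ av P (fun π => W d S π ^ 2) - av P (W d S) ^ 2)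
    (hV2 : av P (fun π => W d S π ^ 2) - av P (W d S) ^ 2 ≤ 1.1)
    {ε : ℝ} (hε : 0 < ε) (hcub : cubes d S ≤ ε * S.card / 1000) (hε2 : 1000 ≤ S.card * ε ^ 2)
    (z : ℝ) {r : ℝ} (hr : 0 ≤ r) :
    av P (fun π => win z r (W d S π)) ≤ 2 * r + 3 * ε := by
  set m : ℝ := (S.card : ℝ) with hmdef
  set V := av P (fun π => W d S π ^ 2) - av P (W d S) ^ 2 with hV
  set T := av P (tsum d ε S) with hT
  set w := av P (W d S) with hw
  have sqV := av_sum_dl_sq hs hd h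
  rw [← hmdef, ← hw, ← hV] at sqV
  -- lower bound for the mean of the truncated squares
  have hT1 : 8 * (m - 1) * V - ε⁻¹ * (520 * cubes d S) ≤ T := by
    have e1 : av P (fun π => ∑ i ∈ S, ∑ j ∈ S, dl d i j π ^ 2
        - ε⁻¹ * ∑ i ∈ S, ∑ j ∈ S, |dl d i j π| ^ 3) ≤ T := by
      refine av_mono fun π _ => ?_
      simp only [tsum, Finset.mul_sum, ← Finset.sum_sub_distrib]
      exact Finset.sum_le_sum fun i _ => Finset.sum_le_sum fun j _ => le_tsq hε _
    rw [av_sub, av_const_mul, sqV] at e1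
    have := mul_le_mul_of_nonneg_left (av_sum_dl_cube_le hd h hm) (inv_pos.2 hε).le
    linarith
  have hT2 : T ≤ 8 * (m - 1) * V := by
    rw [← sqV]
    refine av_mono fun π _ => ?_
    exact Finset.sum_le_sum fun i _ => Finset.sum_le_sum fun j _ => tsq_le_sq _ _
  have hc2 : ε⁻¹ * (520 * cubes d S) ≤ 0.52 * m := by
    have := mul_le_mul_of_nonneg_left hcub (inv_pos.2 hε).le
    have e : ε⁻¹ * (ε * m / 1000) = m / 1000 := by field_simp
    linarith
  have hV3 : (m - 1) * 0.9 ≤ (m - 1) * V := mul_le_mul_of_nonneg_left hV1 (by linarith)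
  have hV4 : (m - 1) * V ≤ (m - 1) * 1.1 := mul_le_mul_of_nonneg_left hV2 (by linarith)
  have hTlow : 6.6 * m ≤ T := by linarith
  have hTup : T ≤ 8.8 * m := by linarith
  -- the fluctuations of the truncated squares
  have hsq2 : av P (fun π => ∑ i ∈ S, ∑ j ∈ S, tsq ε (dl d i j π) ^ 2)
      ≤ ε ^ 2 * (8.8 * m) := by
    have e1 : av P (fun π => ∑ i ∈ S, ∑ j ∈ S, tsq ε (dl d i j π) ^ 2)
        ≤ av P (fun π => ε ^ 2 * ∑ i ∈ S, ∑ j ∈ S, dl d i j π ^ 2) := by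
      refine av_mono fun π _ => ?_
      simp only [Finset.mul_sum]
      exact Finset.sum_le_sum fun i _ => Finset.sum_le_sum fun j _ => tsq_sq_le hε _
    rw [av_const_mul, sqV] at e1
    have : 8 * (m - 1) * V ≤ 8.8 * m := by linarith
    have := mul_le_mul_of_nonneg_left this (sq_nonneg ε)
    linarith
  have hvar : av P (fun π => (tsum d ε S π - T) ^ 2) ≤ (8.5 * m * ε) ^ 2 := by
    have e0 : ∀ π ∈ P, (tsum d ε S π - T) ^ 2
        = (tsum d ε S π ^ 2 - (2 * T) * tsum d ε S π) + T ^ 2 := fun π _ => by ring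
    rw [av_congr e0, av_add, av_const h.ne, av_sub, av_const_mul,
      show av P (fun π => tsum d ε S π) = T from rfl]
    have e1 := av_tsum_sq_le (d := d) h (by linarith) hε
    rw [← hmdef, ← hT] at e1
    have e2 : (m - 1) * (m - 3) / ((m - 5) * (m - 7)) ≤ 1 + 9 / m := by
      rw [div_le_iff₀ (mul_pos (by linarith) (by linarith))]
      have : (1 + 9 / m) * ((m - 5) * (m - 7)) = ((m + 9) * ((m - 5) * (m - 7))) / m := by
        field_simp
      rw [this, le_div_iff₀ (by linarith)]
      have := mul_le_mul_of_nonneg_right hm (show 0 ≤ m by linarith)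
      linarith
    have e3 := mul_le_mul_of_nonneg_right e2 (sq_nonneg T)
    have e4 : 9 / m * T ^ 2 ≤ 9 * 77.44 * m := by
      have : T ^ 2 ≤ (8.8 * m) ^ 2 := pow_le_pow_left₀ (by linarith) hTup 2
      have := mul_le_mul_of_nonneg_left this (show 0 ≤ 9 / m by positivity)
      have e : 9 / m * (8.8 * m) ^ 2 = 9 * 77.44 * m := by
        field_simp; norm_num
      linarith
    have e5 : 8 * m * av P (fun π => ∑ i ∈ S, ∑ j ∈ S, tsq ε (dl d i j π) ^ 2)
        ≤ 8 * m * (ε ^ 2 * (8.8 * m)) := mul_le_mul_of_nonneg_left hsq2 (by linarith)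
    have e6 : 1000 * m ≤ m * ε ^ 2 * m := mul_le_mul_of_nonneg_right hε2 (by linarith)
    linarith
  have hfl : av P (fun π => |tsum d ε S π - T|) ≤ 8.5 * m * ε := by
    refine le_of_sq_le_sq ?_ (by positivity)
    exact (av_abs_sq_le h.ne _).trans hvar
  -- the exchangeable pair with a truncated linear function
  have hsd : av P (fun π => |W d S π - w|) ≤ 1.05 := by
    refine le_of_sq_le_sq ?_ (by norm_num)
    refine (av_abs_sq_le h.ne _).trans ?_
    have e0 : ∀ π ∈ P, (W d S π - w) ^ 2 = (W d S π ^ 2 - (2 * w) * W d S π) + w ^ 2 :=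
      fun π _ => by ring
    rw [av_congr e0, av_add, av_const h.ne, av_sub, av_const_mul,
      show av P (fun π => W d S π) = w from rfl]
    linarith
  have hup : av P (fun π => win z r (W d S π) * tsum d ε S π) ≤ 8 * (m - 1) * (r + ε) * 1.05 := by
    have e1 : av P (fun π => win z r (W d S π) * tsum d ε S π)
        ≤ av P (fun π => ∑ i ∈ S, ∑ j ∈ S, dl d i j π *
          (clamp z (r + ε) (W d S π + dl d i j π) - clamp z (r + ε) (W d S π))) := by
      refine av_mono fun π _ => ?_
      rw [win]
      split_ifs with hc
      · rw [one_mul]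
        exact Finset.sum_le_sum fun i _ => Finset.sum_le_sum fun j _ =>
          tsq_le_mul_clamp_sub hε hc _
      · rw [zero_mul]
        exact Finset.sum_nonneg fun i _ => Finset.sum_nonneg fun j _ => mul_clamp_sub_nonneg _ _ _ _
    rw [av_exchange hs hd h, ← av_W hs hd h] at e1
    refine e1.trans ?_
    have e2 : av P (fun π => (((S.card : ℝ) - 1) * W d S π - (S.card - 1) * av P (W d S))
        * clamp z (r + ε) (W d S π)) ≤ av P (fun π => ((m - 1) * (r + ε)) * |W d S π - w|) := by
      refine av_mono fun π _ => ?_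
      have c1 := abs_clamp_le (show 0 ≤ r + ε by linarith) z (W d S π)
      have c2 : (W d S π - w) * clamp z (r + ε) (W d S π) ≤ |W d S π - w| * (r + ε) := by
        refine (le_abs_self _).trans ?_
        rw [abs_mul]
        exact mul_le_mul_of_nonneg_left c1 (abs_nonneg _)
      have := mul_le_mul_of_nonneg_left c2 (show 0 ≤ m - 1 by linarith)
      rw [← hmdef, ← hw]
      linarith
    rw [av_const_mul] at e2
    have := mul_le_mul_of_nonneg_left hsd (show 0 ≤ (m - 1) * (r + ε) by
      apply mul_nonneg <;> linarith)
    linarith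
  have hlow : T * av P (fun π => win z r (W d S π)) - av P (fun π => |tsum d ε S π - T|)
      ≤ av P (fun π => win z r (W d S π) * tsum d ε S π) := by
    rw [← av_const_mul, ← av_sub]
    refine av_mono fun π _ => ?_
    have c3 := neg_abs_le (tsum d ε S π - T)
    have c4 := abs_nonneg (tsum d ε S π - T)
    rw [win]
    split_ifs
    · linarith
    · linarith
  have hp : 0 ≤ av P (fun π => win z r (W d S π)) := av_nonneg fun π _ => win_nonneg _ _ _
  have c1 := mul_le_mul_of_nonneg_right hTlow hp
  have c2 : m * (6.6 * av P (fun π => win z r (W d S π))) ≤ m * (8.4 * (r + ε) + 8.5 * ε) := by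
    linarith
  have c3 := le_of_mul_le_mul_left c2 (by linarith : 0 < m)
  linarith

/-- A standardized array `d` of large size `n` whose third absolute moment is `n * δ` with `δ`
small. -/
structure Std [Fintype α] (d : α → α → ℝ) (n δ : ℝ) : Prop where
  symm : ∀ i j, d i j = d j i
  diag : ∀ i, d i i = 0
  row_zero : ∀ i, ∑ j, d i j = 0
  card : n = Fintype.card α
  large : 1000000 ≤ n
  sqs_eq : sqs d univ = (n - 1) * (n - 3) / (2 * (n - 2))
  cubes_eq : cubes d univ = n * δ
  pos : 0 < δ
  small : δ ≤ 1 / 60000000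
  ratio : 1 ≤ 100 * n * δ ^ 2

section Standard

variable [Fintype α] {n δ : ℝ}

omit [DecidableEq α] in
lemma Std.sum_sq_le (hd : Std d n δ) (p : α) : ∑ j, d p j ^ 2 ≤ n / 50000 := by
  have h1 : ∀ j, d p j ^ 2 ≤ (0.002 : ℝ) ^ 2 + 500 * |d p j| ^ 3 := by
    intro j
    have h0 := abs_nonneg (d p j)
    rw [← sq_abs]
    rcases le_total |d p j| 0.002 with h | h
    · have := pow_le_pow_left₀ h0 h 2
      have : 0 ≤ 500 * |d p j| ^ 3 := by positivity
      linarith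
    · have : |d p j| ^ 2 * 0.002 ≤ |d p j| ^ 2 * |d p j| :=
        mul_le_mul_of_nonneg_left h (sq_nonneg _)
      have e : |d p j| ^ 3 = |d p j| ^ 2 * |d p j| := by ring
      rw [e]
      have : (0 : ℝ) ≤ 0.002 ^ 2 := by norm_num
      linarith
  have h2 : ∑ j, |d p j| ^ 3 ≤ n * δ := by
    rw [← hd.cubes_eq]
    exact Finset.single_le_sum (f := fun i => ∑ j, |d i j| ^ 3)
      (fun i _ => Finset.sum_nonneg fun j _ => pow_nonneg (abs_nonneg _) 3) (Finset.mem_univ p)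
  have h3 := Finset.sum_le_sum (s := univ) fun j _ => h1 j
  rw [Finset.sum_add_distrib, Finset.sum_const, nsmul_eq_mul, ← Finset.mul_sum,
    Finset.card_univ, ← hd.card] at h3
  have h4 : n * δ ≤ n * (1 / 60000000) :=
    mul_le_mul_of_nonneg_left hd.small (by linarith [hd.large])
  linarith [hd.large]

lemma Std.row_eq (hd : Std d n δ) (i : α) : row d S i = - ∑ j ∈ Sᶜ, d i j := by
  have := Finset.sum_add_sum_compl S (fun j => d i j)
  rw [hd.row_zero] at this
  rw [row]
  linarith

lemma Std.sum_compl_sq_le (hd : Std d n δ) (hS : Sᶜ.card ≤ 8) :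
    ∑ i, ∑ j ∈ Sᶜ, d i j ^ 2 ≤ 8 * (n / 50000) := by
  rw [Finset.sum_comm]
  have h1 : ∀ j ∈ Sᶜ, ∑ i, d i j ^ 2 ≤ n / 50000 := fun j _ => by
    have := hd.sum_sq_le j
    simpa only [hd.symm j] using this
  refine (Finset.sum_le_sum h1).trans ?_
  rw [Finset.sum_const, nsmul_eq_mul]
  have : (Sᶜ.card : ℝ) ≤ 8 := by exact_mod_cast hS
  exact mul_le_mul_of_nonneg_right this (by linarith [hd.large])

lemma Std.sum_row_sq_le (hd : Std d n δ) (hS : Sᶜ.card ≤ 8) :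
    ∑ i ∈ S, row d S i ^ 2 ≤ 64 * (n / 50000) := by
  have h1 : ∀ i, row d S i ^ 2 ≤ 8 * ∑ j ∈ Sᶜ, d i j ^ 2 := by
    intro i
    rw [hd.row_eq, neg_sq]
    refine sq_sum_le_card_mul_sum_sq.trans ?_
    have : (Sᶜ.card : ℝ) ≤ 8 := by exact_mod_cast hS
    exact mul_le_mul_of_nonneg_right this (Finset.sum_nonneg fun _ _ => sq_nonneg _)
  have h2 : ∑ i ∈ S, row d S i ^ 2 ≤ ∑ i, 8 * ∑ j ∈ Sᶜ, d i j ^ 2 :=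
    (Finset.sum_le_sum fun i _ => h1 i).trans
      (Finset.sum_le_sum_of_subset_of_nonneg (Finset.subset_univ S) fun i _ _ =>
        mul_nonneg (by norm_num) (Finset.sum_nonneg fun _ _ => sq_nonneg _))
  rw [← Finset.mul_sum] at h2
  linarith [hd.sum_compl_sq_le hS]

lemma Std.card_le (hd : Std d n δ) (hS : Sᶜ.card ≤ 8) :
    n - 8 ≤ S.card ∧ (S.card : ℝ) ≤ n := by
  have h1 : (S.card : ℝ) + Sᶜ.card = n := by
    rw [hd.card]; exact_mod_cast Finset.card_add_card_compl S
  have h2 : (Sᶜ.card : ℝ) ≤ 8 := by exact_mod_cast hS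
  have h3 : (0 : ℝ) ≤ Sᶜ.card := Nat.cast_nonneg _
  constructor <;> linarith

lemma Std.sqs_bounds (hd : Std d n δ) (hS : Sᶜ.card ≤ 8) :
    0.499 * n ≤ sqs d S ∧ sqs d S ≤ 0.5 * n := by
  have hn := hd.large
  have h1 : 0.4995 * n ≤ sqs d univ := by
    rw [hd.sqs_eq, le_div_iff₀ (by linarith)]
    nlinarith
  have h2 : sqs d univ ≤ 0.5 * n := by
    rw [hd.sqs_eq, div_le_iff₀ (by linarith)]
    nlinarith
  have h3 : sqs d S ≤ sqs d univ :=
    (Finset.sum_le_sum fun i _ => Finset.sum_le_sum_of_subset_of_nonneg (Finset.subset_univ S)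
      fun j _ _ => sq_nonneg _).trans
      (Finset.sum_le_sum_of_subset_of_nonneg (Finset.subset_univ S) fun i _ _ =>
        Finset.sum_nonneg fun j _ => sq_nonneg _)
  have h4 : sqs d univ = sqs d S + ∑ i ∈ S, ∑ j ∈ Sᶜ, d i j ^ 2
      + ∑ i ∈ Sᶜ, ∑ j, d i j ^ 2 := by
    rw [sqs, ← Finset.sum_add_sum_compl S, sqs, ← Finset.sum_add_distrib]
    congr 1
    exact Finset.sum_congr rfl fun i _ => (Finset.sum_add_sum_compl S _).symm
  have h5 := hd.sum_compl_sq_le hS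
  have h6 : ∑ i ∈ S, ∑ j ∈ Sᶜ, d i j ^ 2 ≤ ∑ i, ∑ j ∈ Sᶜ, d i j ^ 2 :=
    Finset.sum_le_sum_of_subset_of_nonneg (Finset.subset_univ S) fun i _ _ =>
      Finset.sum_nonneg fun j _ => sq_nonneg _
  have h7 : ∑ i ∈ Sᶜ, ∑ j, d i j ^ 2 = ∑ i, ∑ j ∈ Sᶜ, d i j ^ 2 := by
    rw [Finset.sum_comm]
    simp only [hd.symm]
  constructor <;> linarith

lemma Std.moments (hd : Std d n δ) (h : Inv P S) (hS : Sᶜ.card ≤ 8) :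
    0.9 ≤ av P (fun π => W d S π ^ 2) - av P (W d S) ^ 2 ∧
    av P (fun π => W d S π ^ 2) ≤ 1.1 := by
  have hn := hd.large
  obtain ⟨m1, m2⟩ := hd.card_le hS
  obtain ⟨a1, a2⟩ := hd.sqs_bounds hS
  have hrho := hd.sum_row_sq_le hS
  have htot : tot d S ^ 2 ≤ n * (64 * (n / 50000)) := by
    refine sq_sum_le_card_mul_sum_sq.trans ?_
    exact mul_le_mul m2 hrho (Finset.sum_nonneg fun _ _ => sq_nonneg _) (by linarith)
  have hW := av_W hd.symm hd.diag h
  rw [av_W_sq hd.symm hd.diag h (by linarith)]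
  set m : ℝ := (S.card : ℝ)
  set A := sqs d S
  set ρ := ∑ i ∈ S, row d S i ^ 2
  have hρ0 : 0 ≤ ρ := Finset.sum_nonneg fun _ _ => sq_nonneg _
  have q1 : 0 < m - 1 := by linarith
  have q3 : 0 < m - 3 := by linarith
  have hw : av P (W d S) ^ 2 = tot d S ^ 2 * ((m - 1)⁻¹) ^ 2 := by
    rw [← hW]; field_simp
  set t := tot d S ^ 2
  have ht0 : 0 ≤ t := sq_nonneg _
  rw [hw]
  have i1 : (m - 1)⁻¹ ≤ (m - 3)⁻¹ := inv_anti₀ q3 (by linarith)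
  constructor
  · have e1 : t * ((m - 1)⁻¹) ^ 2 ≤ (m - 1)⁻¹ * ((m - 3)⁻¹ * t) := by
      rw [sq, show (m - 1)⁻¹ * ((m - 3)⁻¹ * t) = t * ((m - 1)⁻¹ * (m - 3)⁻¹) by ring]
      exact mul_le_mul_of_nonneg_left
        (mul_le_mul_of_nonneg_left i1 (inv_pos.2 q1).le) ht0
    have e2 : (m - 3)⁻¹ * (4 * ρ) ≤ 1 := by
      rw [inv_mul_le_iff₀ q3]; linarith
    have e3 : 0 ≤ (m - 3)⁻¹ * (2 * A) := mul_nonneg (inv_pos.2 q3).le (by linarith)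
    have e4 : 0.9 ≤ (m - 1)⁻¹ * (2 * A - 1) := by
      rw [le_inv_mul_iff₀ q1]; linarith
    have e5 : (m - 1)⁻¹ * (2 * A - 1) ≤ (m - 1)⁻¹ * (2 * A + ((m - 3)⁻¹ * (2 * A)
        - (m - 3)⁻¹ * (4 * ρ))) :=
      mul_le_mul_of_nonneg_left (by linarith) (inv_pos.2 q1).le
    have e6 : (m - 1)⁻¹ * (2 * A + (m - 3)⁻¹ * (t - 4 * ρ + 2 * A))
        = (m - 1)⁻¹ * (2 * A + ((m - 3)⁻¹ * (2 * A) - (m - 3)⁻¹ * (4 * ρ)))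
          + (m - 1)⁻¹ * ((m - 3)⁻¹ * t) := by ring
    linarith
  · rw [inv_mul_le_iff₀ q1]
    have e1 : (m - 3)⁻¹ * (t - 4 * ρ + 2 * A) ≤ 0.01 * n := by
      rw [inv_mul_le_iff₀ q3]
      nlinarith
    linarith

lemma Std.av_win_le (hd : Std d n δ) (h : Inv P S) (hS : Sᶜ.card ≤ 8) (z : ℝ) {r : ℝ}
    (hr : 0 ≤ r) : av P (fun π => win z r (W d S π)) ≤ 2 * r + 3300 * δ := by
  have hn := hd.large
  have hδ := hd.pos
  obtain ⟨m1, m2⟩ := hd.card_le hS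
  obtain ⟨v1, v2⟩ := hd.moments h hS
  have hm : 0.99 * n ≤ S.card := by linarith
  have := concentration hd.symm hd.diag h (by linarith) v1
    (by linarith [sq_nonneg (av P (W d S))]) (ε := 1100 * δ) (by linarith) ?_ ?_ z hr
  · linarith
  · have h1 : cubes d S ≤ cubes d univ :=
      (Finset.sum_le_sum fun i _ => Finset.sum_le_sum_of_subset_of_nonneg (Finset.subset_univ S)
        fun j _ _ => pow_nonneg (abs_nonneg _) 3).trans
        (Finset.sum_le_sum_of_subset_of_nonneg (Finset.subset_univ S) fun i _ _ =>
          Finset.sum_nonneg fun j _ => pow_nonneg (abs_nonneg _) 3)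
    rw [hd.cubes_eq] at h1
    have := mul_le_mul_of_nonneg_right hm hδ.le
    have : 0 ≤ n * δ := mul_nonneg (by linarith) hδ.le
    linarith
  · have := mul_le_mul_of_nonneg_right hm (sq_nonneg δ)
    have := hd.ratio
    nlinarith

lemma Std.av_abs_W_le (hd : Std d n δ) (h : Inv P S) (hS : Sᶜ.card ≤ 8) :
    av P (fun π => |W d S π|) ≤ 1.2 := by
  refine le_of_sq_le_sq ((av_abs_sq_le h.ne _).trans ((hd.moments h hS).2.trans ?_)) ?_ <;>
  norm_num

/-- The modulus of continuity at `w`, on the scale `r`, of the functions in Stein's equation for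
the half-line ending at `z`. -/
noncomputable def modul (z r w : ℝ) : ℝ := (4 * |w| + 4) * r + 4 * win z r w

lemma Std.av_modul_le (hd : Std d n δ) (h : Inv P S) (hS : Sᶜ.card ≤ 8) (z : ℝ) {r : ℝ}
    (hr : 0 ≤ r) : av P (fun π => modul z r (W d S π)) ≤ 17 * r + 13200 * δ := by
  have e : ∀ π ∈ P, modul z r (W d S π)
      = ((4 * r) * |W d S π| + 4 * r) + 4 * win z r (W d S π) := fun π _ => by
    rw [modul]; ring
  rw [av_congr e, av_add, av_add, av_const_mul, av_const h.ne, av_const_mul]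
  have h1 := hd.av_win_le h hS z hr
  have h2 := mul_le_mul_of_nonneg_left (hd.av_abs_W_le h hS) (show 0 ≤ 4 * r by linarith)
  linarith

end Standard

/-- The unnormalised Gaussian integral over a half-line. -/
noncomputable def gaussInt (w : ℝ) : ℝ := ∫ x in Set.Iic w, Real.exp (-(x ^ 2) / 2)

lemma integrable_gauss : Integrable fun x : ℝ => Real.exp (-(x ^ 2) / 2) := by
  have := integrable_exp_neg_mul_sq (b := 1 / 2) (by norm_num)
  refine this.congr (Filter.Eventually.of_forall fun x => ?_)
  simp only
  congr 1
  ring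

lemma integral_gauss : ∫ x : ℝ, Real.exp (-(x ^ 2) / 2) = √(2 * Real.pi) := by
  have := integral_gaussian (1 / 2)
  rw [show Real.pi / (1 / 2) = 2 * Real.pi by ring] at this
  rw [← this]
  congr 1
  ext x
  congr 1
  ring

lemma gaussInt_nonneg (w : ℝ) : 0 ≤ gaussInt w :=
  integral_nonneg fun _ => (Real.exp_pos _).le

lemma hasDerivAt_gaussInt (w : ℝ) : HasDerivAt gaussInt (Real.exp (-(w ^ 2) / 2)) w := by
  have hc : Continuous fun x : ℝ => Real.exp (-(x ^ 2) / 2) := by fun_prop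
  have e : gaussInt = fun w => gaussInt 0 + ∫ x in (0 : ℝ)..w, Real.exp (-(x ^ 2) / 2) := by
    ext w
    rw [← intervalIntegral.integral_Iic_sub_Iic integrable_gauss.integrableOn
      integrable_gauss.integrableOn, gaussInt, gaussInt]
    ring
  rw [e]
  exact (intervalIntegral.integral_hasDerivAt_right (hc.intervalIntegrable _ _)
    hc.stronglyMeasurable.stronglyMeasurableAtFilter hc.continuousAt).const_add _

lemma gaussInt_add_neg (w : ℝ) : gaussInt w + gaussInt (-w) = √(2 * Real.pi) := by
  have h1 : gaussInt (-w) = ∫ x in Set.Ioi w, Real.exp (-(x ^ 2) / 2) := by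
    have := integral_comp_neg_Iic (-w) fun x : ℝ => Real.exp (-(x ^ 2) / 2)
    simp only [neg_sq, neg_neg] at this
    exact this
  rw [h1, gaussInt, ← integral_gauss, ← Set.compl_Iic]
  exact integral_add_compl measurableSet_Iic integrable_gauss

lemma gaussInt_mul_neg_le (w : ℝ) : -w * gaussInt w ≤ Real.exp (-(w ^ 2) / 2) := by
  have hd : ∀ x ∈ Set.Iic w, HasDerivAt (fun x : ℝ => Real.exp (-(x ^ 2) / 2))
      (-x * Real.exp (-(x ^ 2) / 2)) x := by
    intro x _
    convert ((hasDerivAt_pow 2 x).fun_neg.div_const 2).exp using 1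
    norm_num
    ring
  have hi : IntegrableOn (fun x : ℝ => -x * Real.exp (-(x ^ 2) / 2)) (Set.Iic w) := by
    have := (integrable_mul_exp_neg_mul_sq (b := 1 / 2) (by norm_num)).neg
    refine (this.congr (Filter.Eventually.of_forall fun x => ?_)).integrableOn
    simp only [Pi.neg_apply]
    rw [show -(1 / 2) * x ^ 2 = -(x ^ 2) / 2 by ring]
    ring
  have ht : Filter.Tendsto (fun x : ℝ => Real.exp (-(x ^ 2) / 2)) Filter.atBot (nhds 0) := by
    refine Real.tendsto_exp_atBot.comp ?_
    have : Filter.Tendsto (fun x : ℝ => x ^ 2) Filter.atBot Filter.atTop := by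
      have := (Filter.tendsto_pow_atTop (α := ℝ) (n := 2) (by norm_num)).comp
        Filter.tendsto_neg_atBot_atTop
      refine this.congr fun x => ?_
      simp
    exact (Filter.tendsto_neg_atTop_atBot.comp this).atBot_div_const (by norm_num)
  have hI := integral_Iic_of_hasDerivAt_of_tendsto' hd hi ht
  rw [sub_zero] at hI
  rw [← hI, gaussInt, ← integral_const_mul]
  refine setIntegral_mono_on (integrable_gauss.integrableOn.const_mul _) hi measurableSet_Iic
    fun x hx => ?_
  exact mul_le_mul_of_nonneg_right (neg_le_neg hx) (Real.exp_pos _).le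

lemma cdf_eq (w : ℝ) : stdNormalCDF w = (√(2 * Real.pi))⁻¹ * gaussInt w := rfl

lemma sqrt_two_pi_pos : 0 < √(2 * Real.pi) := Real.sqrt_pos.2 (by positivity)

lemma cdf_nonneg (w : ℝ) : 0 ≤ stdNormalCDF w :=
  mul_nonneg (inv_pos.2 sqrt_two_pi_pos).le (gaussInt_nonneg w)

lemma cdf_add_neg (w : ℝ) : stdNormalCDF w + stdNormalCDF (-w) = 1 := by
  rw [cdf_eq, cdf_eq, ← mul_add, gaussInt_add_neg, inv_mul_cancel₀ sqrt_two_pi_pos.ne']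

lemma cdf_le_one (w : ℝ) : stdNormalCDF w ≤ 1 := by
  linarith [cdf_add_neg w, cdf_nonneg (-w)]

lemma gaussInt_mono : Monotone gaussInt :=
  monotone_of_deriv_nonneg (fun w => (hasDerivAt_gaussInt w).differentiableAt) fun w => by
    rw [(hasDerivAt_gaussInt w).deriv]; exact (Real.exp_pos _).le

lemma cdf_mono : Monotone stdNormalCDF := fun _ _ h =>
  mul_le_mul_of_nonneg_left (gaussInt_mono h) (inv_pos.2 sqrt_two_pi_pos).le

/-- The Mills ratio of the lower tail. -/
noncomputable def mills (w : ℝ) : ℝ := Real.exp (w ^ 2 / 2) * gaussInt w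

lemma mills_nonneg (w : ℝ) : 0 ≤ mills w := mul_nonneg (Real.exp_pos _).le (gaussInt_nonneg w)

lemma exp_mul_exp_neg (w : ℝ) : Real.exp (w ^ 2 / 2) * Real.exp (-(w ^ 2) / 2) = 1 := by
  rw [← Real.exp_add, ← add_div, add_neg_cancel, zero_div, Real.exp_zero]

lemma hasDerivAt_mills (w : ℝ) : HasDerivAt mills (w * mills w + 1) w := by
  refine ((((hasDerivAt_pow 2 w).div_const 2).exp).mul (hasDerivAt_gaussInt w)).congr_deriv ?_
  rw [exp_mul_exp_neg, mills]
  norm_num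
  ring

lemma neg_mul_mills_le (w : ℝ) : -w * mills w ≤ 1 := by
  have := mul_le_mul_of_nonneg_left (gaussInt_mul_neg_le w) (Real.exp_pos (w ^ 2 / 2)).le
  rw [exp_mul_exp_neg] at this
  rw [mills]
  linarith

lemma mills_zero_le : mills 0 ≤ 2 := by
  have h := gaussInt_add_neg 0
  rw [neg_zero] at h
  have h2 : √(2 * Real.pi) ≤ 4 := by
    rw [show (4 : ℝ) = √(4 ^ 2) from (Real.sqrt_sq (by norm_num)).symm]
    exact Real.sqrt_le_sqrt (by linarith [Real.pi_lt_four])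
  simp only [mills]
  norm_num
  linarith

lemma mills_le_two {w : ℝ} (hw : w ≤ 0) : mills w ≤ 2 := by
  have : MonotoneOn mills (Set.Iic 0) := by
    refine monotoneOn_of_deriv_nonneg (convex_Iic 0)
      (fun w _ => (hasDerivAt_mills w).continuousAt.continuousWithinAt)
      (fun w _ => (hasDerivAt_mills w).differentiableAt.differentiableWithinAt) fun w _ => ?_
    rw [(hasDerivAt_mills w).deriv]
    linarith [neg_mul_mills_le w]
  exact (this hw Set.self_mem_Iic hw).trans mills_zero_le

/-- The lower branch of the solution of Stein's equation for the half-line ending at `z`. -/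
noncomputable def branch (z w : ℝ) : ℝ := (1 - stdNormalCDF z) * mills w

lemma branch_nonneg (z w : ℝ) : 0 ≤ branch z w :=
  mul_nonneg (by linarith [cdf_le_one z]) (mills_nonneg w)

lemma branch_le_mills (z w : ℝ) : branch z w ≤ mills w :=
  mul_le_of_le_one_left (mills_nonneg w) (by linarith [cdf_nonneg z])

lemma branch_self (w : ℝ) : branch w w = stdNormalCDF w * mills (-w) := by
  have : 1 - stdNormalCDF w = stdNormalCDF (-w) := by linarith [cdf_add_neg w]
  rw [branch, this]
  simp only [cdf_eq, mills, neg_sq]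
  ring

lemma branch_self_neg (w : ℝ) : branch (-w) (-w) = branch w w := by
  rw [branch_self w, branch]
  congr 1
  linarith [cdf_add_neg w]

lemma branch_le_of_le {z w : ℝ} (h : w ≤ z) : branch z w ≤ mills (-w) := by
  calc branch z w ≤ branch w w :=
        mul_le_mul_of_nonneg_right (by linarith [cdf_mono h]) (mills_nonneg w)
    _ ≤ mills (-w) := by
        rw [branch_self]; exact mul_le_of_le_one_left (mills_nonneg _) (cdf_le_one w)

lemma branch_le_two {z w : ℝ} (h : w ≤ z) : branch z w ≤ 2 := by
  rcases le_total w 0 with hw | hw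
  · exact (branch_le_mills z w).trans (mills_le_two hw)
  · exact (branch_le_of_le h).trans (mills_le_two (by linarith))

lemma abs_mul_branch_le {z w : ℝ} (h : w ≤ z) : |w * branch z w| ≤ 1 := by
  rw [abs_mul, abs_of_nonneg (branch_nonneg z w)]
  rcases le_total w 0 with hw | hw
  · rw [abs_of_nonpos hw]
    exact (mul_le_mul_of_nonneg_left (branch_le_mills z w) (by linarith)).trans
      (neg_mul_mills_le w)
  · rw [abs_of_nonneg hw]
    have := neg_mul_mills_le (-w)
    rw [neg_neg] at this
    exact (mul_le_mul_of_nonneg_left (branch_le_of_le h) hw).trans this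

lemma hasDerivAt_branch (z w : ℝ) :
    HasDerivAt (branch z) (w * branch z w + (1 - stdNormalCDF z)) w := by
  refine ((hasDerivAt_mills w).const_mul (1 - stdNormalCDF z)).congr_deriv ?_
  rw [branch]
  ring

lemma abs_deriv_branch_le {z w : ℝ} (h : w ≤ z) :
    |w * branch z w + (1 - stdNormalCDF z)| ≤ 2 := by
  have h1 := abs_le.1 (abs_mul_branch_le h)
  have h2 := cdf_nonneg z
  have h3 := cdf_le_one z
  rw [abs_le]
  constructor <;> linarith

lemma abs_branch_sub_le {z x y : ℝ} (hx : x ≤ z) (hy : y ≤ z) :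
    |branch z x - branch z y| ≤ 2 * |x - y| :=
  (convex_Iic z).norm_image_sub_le_of_norm_hasDerivWithin_le
    (fun w _ => (hasDerivAt_branch z w).hasDerivWithinAt)
    (fun _ hw => abs_deriv_branch_le hw) hy hx

/-- The bounded solution of Stein's equation for the half-line ending at `z`. -/
noncomputable def steinSol (z w : ℝ) : ℝ :=
  if w ≤ z then branch z w else branch (-z) (-w)

/-- The derivative of `steinSol z` away from `z`. -/
noncomputable def steinDeriv (z w : ℝ) : ℝ :=
  w * steinSol z w + (if w ≤ z then 1 else 0) - stdNormalCDF z

lemma steinSol_of_le {z w : ℝ} (h : w ≤ z) : steinSol z w = branch z w := if_pos h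

lemma steinSol_of_ge {z w : ℝ} (h : z ≤ w) : steinSol z w = branch (-z) (-w) := by
  rcases h.eq_or_lt with rfl | h
  · rw [steinSol_of_le le_rfl, branch_self_neg]
  · exact if_neg h.not_ge

lemma abs_steinSol_le (z w : ℝ) : |steinSol z w| ≤ 2 := by
  rcases le_total w z with h | h
  · rw [steinSol_of_le h, abs_of_nonneg (branch_nonneg _ _)]
    exact branch_le_two h
  · rw [steinSol_of_ge h, abs_of_nonneg (branch_nonneg _ _)]
    exact branch_le_two (neg_le_neg h)

lemma steinDeriv_of_le {z w : ℝ} (h : w ≤ z) :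
    steinDeriv z w = w * branch z w + (1 - stdNormalCDF z) := by
  rw [steinDeriv, steinSol_of_le h, if_pos h]
  ring

lemma steinDeriv_of_gt {z w : ℝ} (h : z < w) :
    steinDeriv z w = -(-w * branch (-z) (-w) + (1 - stdNormalCDF (-z))) := by
  rw [steinDeriv, steinSol_of_ge h.le, if_neg h.not_ge]
  linarith [cdf_add_neg z]

lemma abs_steinDeriv_le (z w : ℝ) : |steinDeriv z w| ≤ 2 := by
  rcases le_or_gt w z with h | h
  · rw [steinDeriv_of_le h]
    exact abs_deriv_branch_le h
  · rw [steinDeriv_of_gt h, abs_neg]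
    exact abs_deriv_branch_le (neg_le_neg h.le)

lemma abs_steinSol_sub_le (z x y : ℝ) :
    |steinSol z x - steinSol z y| ≤ 2 * |x - y| := by
  wlog hxy : x ≤ y generalizing x y
  · rw [abs_sub_comm, abs_sub_comm x]
    exact this y x (le_of_not_ge hxy)
  have lower : ∀ {x y}, x ≤ z → y ≤ z → |steinSol z x - steinSol z y| ≤ 2 * |x - y| := by
    intro x y hx hy
    rw [steinSol_of_le hx, steinSol_of_le hy]
    exact abs_branch_sub_le hx hy
  have upper : ∀ {x y}, z ≤ x → z ≤ y → |steinSol z x - steinSol z y| ≤ 2 * |x - y| := by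
    intro x y hx hy
    rw [steinSol_of_ge hx, steinSol_of_ge hy]
    refine (abs_branch_sub_le (neg_le_neg hx) (neg_le_neg hy)).trans_eq ?_
    rw [neg_sub_neg, abs_sub_comm]
  rcases le_total y z with hy | hy
  · exact lower (hxy.trans hy) hy
  rcases le_total z x with hx | hx
  · exact upper hx hy
  have h1 := lower hx le_rfl
  have h2 := upper le_rfl hy
  rw [abs_of_nonpos (sub_nonpos.2 hx)] at h1
  rw [abs_of_nonpos (sub_nonpos.2 hy)] at h2
  rw [abs_of_nonpos (sub_nonpos.2 hxy)]
  have := abs_sub_le (steinSol z x) (steinSol z z) (steinSol z y)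
  linarith

lemma hasDerivAt_steinSol {z w : ℝ} (h : w ≠ z) :
    HasDerivAt (steinSol z) (steinDeriv z w) w := by
  rcases lt_or_gt_of_ne h with h | h
  · rw [steinDeriv_of_le h.le]
    refine (hasDerivAt_branch z w).congr_of_eventuallyEq ?_
    filter_upwards [Iio_mem_nhds h] with x hx using steinSol_of_le (le_of_lt hx)
  · rw [steinDeriv_of_gt h]
    have := (hasDerivAt_branch (-z) (-w)).comp w (hasDerivAt_neg w)
    rw [mul_neg_one] at this
    refine this.congr_of_eventuallyEq ?_
    filter_upwards [Ioi_mem_nhds h] with x hx using steinSol_of_ge (le_of_lt hx)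

lemma abs_steinDeriv_sub_le {z w r x : ℝ} (hz : r < |w - z|) (hx : |x - w| ≤ r) :
    x ≠ z ∧ |steinDeriv z x - steinDeriv z w| ≤ (2 * |w| + 2) * r := by
  have hr : 0 ≤ r := (abs_nonneg _).trans hx
  obtain ⟨x1, x2⟩ := abs_le.1 hx
  have e : x ≠ z ∧ ((x ≤ z) ↔ (w ≤ z)) := by
    rcases le_total w z with h | h
    · rw [abs_of_nonpos (by linarith)] at hz
      exact ⟨by linarith, by constructor <;> intro <;> linarith⟩
    · rw [abs_of_nonneg (by linarith)] at hz
      exact ⟨by linarith, by constructor <;> intro <;> linarith⟩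
  refine ⟨e.1, ?_⟩
  have e1 : steinDeriv z x - steinDeriv z w
      = (x - w) * steinSol z x + w * (steinSol z x - steinSol z w) := by
    simp only [steinDeriv, e.2]
    ring
  rw [e1]
  refine (abs_add_le _ _).trans ?_
  rw [abs_mul, abs_mul]
  have h1 : |x - w| * |steinSol z x| ≤ r * 2 :=
    mul_le_mul hx (abs_steinSol_le z x) (abs_nonneg _) hr
  have h2 : |w| * |steinSol z x - steinSol z w| ≤ |w| * (2 * r) :=
    mul_le_mul_of_nonneg_left ((abs_steinSol_sub_le z x w).trans (by linarith)) (abs_nonneg _)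
  linarith

lemma abs_steinSol_taylor_le (z w u v : ℝ) :
    |steinSol z (w + u) - steinSol z (w + v) - (u - v) * steinDeriv z w|
      ≤ |u - v| * modul z (|u| + |v|) w := by
  set r := |u| + |v| with hr
  have hr0 : 0 ≤ r := by positivity
  have hw := abs_nonneg w
  rcases lt_or_ge r |w - z| with h | h
  · have hB : ∀ x ∈ Metric.closedBall w r, |x - w| ≤ r := fun x hx => by
      simpa [Real.dist_eq] using hx
    have := (convex_closedBall w r).norm_image_sub_le_of_norm_hasDerivWithin_le
      (f := fun x => steinSol z x - x * steinDeriv z w)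
      (f' := fun x => steinDeriv z x - 1 * steinDeriv z w) (C := (2 * |w| + 2) * r)
      (fun x hx => ((hasDerivAt_steinSol (abs_steinDeriv_sub_le h (hB x hx)).1).sub
        ((hasDerivAt_id x).mul_const _)).hasDerivWithinAt)
      (fun x hx => by
        rw [one_mul]; exact (abs_steinDeriv_sub_le h (hB x hx)).2)
      (x := w + v) (y := w + u)
      (by simp [hr]) (by simp [hr])
    simp only [Real.norm_eq_abs] at this
    rw [show w + u - (w + v) = u - v by ring, show steinSol z (w + u) - (w + u) * steinDeriv z w
      - (steinSol z (w + v) - (w + v) * steinDeriv z w)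
      = steinSol z (w + u) - steinSol z (w + v) - (u - v) * steinDeriv z w by ring] at this
    refine this.trans ?_
    rw [mul_comm]
    refine mul_le_mul_of_nonneg_left ?_ (abs_nonneg _)
    rw [modul]
    have := win_nonneg (z := z) (r := r) (w := w)
    nlinarith [mul_nonneg hw hr0]
  · have h1 := abs_steinSol_sub_le z (w + u) (w + v)
    rw [show w + u - (w + v) = u - v by ring] at h1
    have h2 : |(u - v) * steinDeriv z w| ≤ |u - v| * 2 := by
      rw [abs_mul]
      exact mul_le_mul_of_nonneg_left (abs_steinDeriv_le z w) (abs_nonneg _)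
    have h3 : 4 ≤ modul z r w := by
      rw [modul, win, if_pos h]
      nlinarith [mul_nonneg hw hr0]
    have h4 := mul_le_mul_of_nonneg_left h3 (abs_nonneg (u - v))
    have := abs_sub (steinSol z (w + u) - steinSol z (w + v)) ((u - v) * steinDeriv z w)
    linarith

lemma abs_steinDeriv_modul_le (z w u v : ℝ) :
    |steinDeriv z (w + u) - steinDeriv z (w + v)| ≤ modul z (|u| + |v|) w := by
  set r := |u| + |v| with hr
  have hu := abs_nonneg u
  have hv := abs_nonneg v
  have hr0 : 0 ≤ r := by positivity
  have hw := mul_nonneg (abs_nonneg w) hr0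
  rcases lt_or_ge r |w - z| with h | h
  · have h1 := (abs_steinDeriv_sub_le h (x := w + u) (by simp [hr])).2
    have h2 := (abs_steinDeriv_sub_le h (x := w + v) (by simp [hr])).2
    rw [abs_sub_comm] at h2
    have := abs_sub_le (steinDeriv z (w + u)) (steinDeriv z w) (steinDeriv z (w + v))
    have hwn := win_nonneg (z := z) (r := r) (w := w)
    rw [modul]
    linarith
  · have h1 := abs_steinDeriv_le z (w + u)
    have h2 := abs_steinDeriv_le z (w + v)
    have := abs_sub (steinDeriv z (w + u)) (steinDeriv z (w + v))
    rw [modul, win, if_pos h]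
    linarith

section Removal

variable [Fintype α] {n δ : ℝ}

/-- The absolute row sums of an array. -/
def rabs (d : α → α → ℝ) (i : α) : ℝ := ∑ j, |d i j|

omit [DecidableEq α] in
lemma rabs_nonneg (d : α → α → ℝ) (i : α) : 0 ≤ rabs d i :=
  Finset.sum_nonneg fun _ _ => abs_nonneg _

omit [DecidableEq α] in
lemma sum_abs_le_rabs (d : α → α → ℝ) (i : α) (S : Finset α) : ∑ j ∈ S, |d i j| ≤ rabs d i :=
  Finset.sum_le_sum_of_subset_of_nonneg (Finset.subset_univ S) fun _ _ _ => abs_nonneg _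

lemma card_compl_del_le (S : Finset α) (i k : α) : (del S i k)ᶜ.card ≤ Sᶜ.card + 2 := by
  rw [del, Finset.compl_erase, Finset.compl_erase]
  exact (Finset.card_insert_le _ _).trans (Nat.succ_le_succ (Finset.card_insert_le _ _))

omit [Fintype α] in
/-- The effect of re-pairing `i` with `k` on the sum outside `{i, k}`. -/
lemma W_del_cj (hs : ∀ i j, d i j = d j i) (h : Inv P S) {π : Equiv.Perm α} {i k x : α}
    (hπ : π ∈ fx P i x) (hi : i ∈ S) (hk : k ∈ S) (hik : i ≠ k) :
    W d (del S i k) (cj k x π) = W d S π + dl d k x π - 2 * d i k := by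
  obtain ⟨hP, rfl⟩ := mem_fx.1 hπ
  have hx : π i ∈ S := h.maps π hP i hi
  have h1 := mem_fx.1 (cj_mem_fx h hk hx hik (h.fpf π hP i).symm hπ)
  have h2 := W_del hs h h1.1 hi
  rw [h1.2, W_cj hs h hP hk hx] at h2
  linarith

lemma Std.av_abs_sub_partner_le (hd : Std d n δ) (h : Inv P S) (hS : Sᶜ.card ≤ 4) (z : ℝ)
    {i k : α} (hi : i ∈ S) (hk : k ∈ S) (hik : i ≠ k) :
    av (fx P i k) (fun π => |steinDeriv z (W d S π)
      - steinDeriv z (W d (del S i k) (cj k k π))|) ≤ 13200 * δ + 34 * |d i k| := by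
  have h' := h.fix hi hk hik
  have hb : ∀ π ∈ fx P i k, |steinDeriv z (W d S π)
      - steinDeriv z (W d (del S i k) (cj k k π))|
      ≤ modul z (2 * |d i k|) (W d (del S i k) π) := by
    intro π hπ
    obtain ⟨hP, hx⟩ := mem_fx.1 hπ
    have e := W_del hd.symm h hP hi
    rw [hx] at e
    have := abs_steinDeriv_modul_le z (W d (del S i k) π) (2 * d i k) 0
    rw [add_zero, abs_zero, add_zero, abs_mul, abs_two, add_comm (W d _ π), ← e] at this
    rwa [cj_self]
  refine (av_mono hb).trans ((hd.av_modul_le h' ?_ z (by positivity)).trans_eq ?_)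
  · linarith [card_compl_del_le S i k]
  · ring

lemma Std.av_abs_sub_pair_le (hd : Std d n δ) (h : Inv P S) (hS : Sᶜ.card ≤ 4) (z : ℝ)
    {i k x y : α} (hi : i ∈ S) (hk : k ∈ S) (hik : i ≠ k) (hx : x ∈ S) (hxi : x ≠ i)
    (hxk : x ≠ k) (hy : y ∈ (del S i x).erase k) :
    av (fx (fx P i x) k y) (fun π => |steinDeriv z (W d S π)
      - steinDeriv z (W d (del S i k) (cj k x π))|)
      ≤ 13200 * δ + 34 * (|d i x| + |d k y| + |d x y|) := by
  have h1 := h.fix hi hx hxi.symm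
  have hk1 : k ∈ del S i x := mem_del.2 ⟨hxk.symm, hik.symm, hk⟩
  obtain ⟨hyk, hy1⟩ := Finset.mem_erase.1 hy
  have h2 := h1.fix hk1 hy1 hyk.symm
  have hb : ∀ π ∈ fx (fx P i x) k y, |steinDeriv z (W d S π)
      - steinDeriv z (W d (del S i k) (cj k x π))|
      ≤ modul z (|2 * d i x + 2 * d k y| + |2 * d x y|) (W d (del (del S i x) k y) π) := by
    intro π hπ
    obtain ⟨hπ1, hky⟩ := mem_fx.1 hπ
    obtain ⟨hP, hix⟩ := mem_fx.1 hπ1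
    have e1 := W_del hd.symm h hP hi
    have e2 := W_del hd.symm h1 hπ1 hk1
    rw [hix] at e1
    rw [hky] at e2
    have e3 := W_del_cj hd.symm h hπ1 hi hk hik
    have hxi' : π x = i := by rw [← hix, h.inv π hP]
    have hy2 := (mem_del.1 hy1).1
    have e4 : dl d k x π = 2 * (d k i + d x y - d k y - d x i) := by
      rw [dl, hky, hxi', if_neg]
      push Not
      exact ⟨hxk, hy2.symm⟩
    rw [e4, hd.symm k i, hd.symm x i] at e3
    rw [show W d S π = W d (del (del S i x) k y) π + (2 * d i x + 2 * d k y) by linarith,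
      show W d (del S i k) (cj k x π) = W d (del (del S i x) k y) π + 2 * d x y by linarith]
    exact abs_steinDeriv_modul_le _ _ _ _
  refine (av_mono hb).trans ((hd.av_modul_le h2 ?_ z (by positivity)).trans ?_)
  · linarith [card_compl_del_le S i x, card_compl_del_le (del S i x) k y]
  · have t := abs_add_le (2 * d i x) (2 * d k y)
    simp only [abs_mul, abs_two] at t ⊢
    linarith

lemma Std.av_abs_sub_le (hd : Std d n δ) (h : Inv P S) (hS : Sᶜ.card ≤ 4) (z : ℝ)
    {i k x : α} (hi : i ∈ S) (hk : k ∈ S) (hik : i ≠ k) (hx : x ∈ S.erase i) :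
    av (fx P i x) (fun π => |steinDeriv z (W d S π)
      - steinDeriv z (W d (del S i k) (cj k x π))|)
      ≤ 13200 * δ + 34 * |d i x| + 35 / n * (rabs d k + rabs d x) := by
  have hn := hd.large
  have hk0 := rabs_nonneg d k
  have hx0 := rabs_nonneg d x
  obtain ⟨m1, m2⟩ := hd.card_le (S := S) (by linarith)
  obtain ⟨hxi, hxS⟩ := Finset.mem_erase.1 hx
  by_cases hxk : x = k
  · subst hxk
    have := hd.av_abs_sub_partner_le h hS z hi hk hik
    have : 0 ≤ 35 / n * (rabs d x + rabs d x) := by positivity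
    linarith
  have h1 := h.fix hi hxS (Ne.symm hxi)
  have hk1 : k ∈ del S i x := mem_del.2 ⟨Ne.symm hxk, hik.symm, hk⟩
  have := av_expand h1 hk1 (fun _ π => |steinDeriv z (W d S π)
    - steinDeriv z (W d (del S i k) (cj k x π))|)
  rw [this, card_del hi hxS (Ne.symm hxi)]
  have q : (0 : ℝ) < S.card - 2 - 1 := by linarith
  rw [inv_mul_le_iff₀ q]
  have hcard : (((del S i x).erase k).card : ℝ) = S.card - 2 - 1 := by
    rw [Finset.card_erase_of_mem hk1, Nat.cast_sub (Finset.card_pos.2 ⟨k, hk1⟩), Nat.cast_one,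
      card_del hi hxS (Ne.symm hxi)]
  refine (Finset.sum_le_sum fun y hy =>
    hd.av_abs_sub_pair_le h hS z hi hk hik hxS hxi hxk hy).trans ?_
  have e : ∑ y ∈ (del S i x).erase k, (13200 * δ + 34 * (|d i x| + |d k y| + |d x y|))
      = (S.card - 2 - 1) * (13200 * δ + 34 * |d i x|)
        + 34 * (∑ y ∈ (del S i x).erase k, |d k y| + ∑ y ∈ (del S i x).erase k, |d x y|) := by
    rw [← hcard, ← nsmul_eq_mul, ← Finset.sum_const, ← Finset.sum_add_distrib, Finset.mul_sum,
      ← Finset.sum_add_distrib]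
    exact Finset.sum_congr rfl fun y _ => by ring
  rw [e, mul_add _ (13200 * δ + 34 * |d i x|)]
  refine add_le_add le_rfl ?_
  have t1 := sum_abs_le_rabs d k ((del S i x).erase k)
  have t2 := sum_abs_le_rabs d x ((del S i x).erase k)
  have t3 : 34 ≤ (S.card - 2 - 1) * (35 / n) := by
    rw [mul_div_assoc', le_div_iff₀ (by linarith)]
    linarith
  have := mul_le_mul_of_nonneg_right t3 (add_nonneg hk0 hx0)
  linarith

/-- Conditioning on the partner of `i` changes the law of the sum by little. -/
lemma Std.abs_av_sub_fix_le (hd : Std d n δ) (h : Inv P S) (hS : Sᶜ.card ≤ 4) (z : ℝ)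
    {i k : α} (hi : i ∈ S) (hk : k ∈ S) (hik : i ≠ k) :
    |av P (fun π => steinDeriv z (W d S π))
      - av (fx P i k) (fun π => steinDeriv z (W d (del S i k) π))|
      ≤ 13200 * δ + 36 / n * (rabs d i + rabs d k) + 36 / n ^ 2 * ∑ x, rabs d x := by
  have hn := hd.large
  obtain ⟨m1, m2⟩ := hd.card_le (S := S) (by linarith)
  have q : (0 : ℝ) < S.card - 1 := by linarith
  rw [← av_transfer h hi hk hik, ← av_sub]
  refine (abs_av_le _ _).trans ?_
  rw [av_expand h hi (fun x π => |steinDeriv z (W d S π)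
      - steinDeriv z (W d (del S i k) (cj k x π))|), inv_mul_le_iff₀ q]
  refine (Finset.sum_le_sum fun x hx => hd.av_abs_sub_le h hS z hi hk hik hx).trans ?_
  have hcard : ((S.erase i).card : ℝ) = S.card - 1 := by
    rw [Finset.card_erase_of_mem hi, Nat.cast_sub (Finset.card_pos.2 ⟨i, hi⟩), Nat.cast_one]
  have e : ∑ x ∈ S.erase i, (13200 * δ + 34 * |d i x| + 35 / n * (rabs d k + rabs d x))
      = (S.card - 1) * (13200 * δ + 35 / n * rabs d k) + 34 * ∑ x ∈ S.erase i, |d i x|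
        + 35 / n * ∑ x ∈ S.erase i, rabs d x := by
    rw [← hcard, ← nsmul_eq_mul, ← Finset.sum_const, Finset.mul_sum, Finset.mul_sum,
      ← Finset.sum_add_distrib, ← Finset.sum_add_distrib]
    exact Finset.sum_congr rfl fun y _ => by ring
  rw [e]
  have t1 := sum_abs_le_rabs d i (S.erase i)
  have t2 : ∑ x ∈ S.erase i, rabs d x ≤ ∑ x, rabs d x :=
    Finset.sum_le_sum_of_subset_of_nonneg (Finset.subset_univ _) fun x _ _ => rabs_nonneg d x
  have hi0 := rabs_nonneg d i
  have hk0 := rabs_nonneg d k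
  set R := ∑ x, rabs d x with hR
  have hR0 : 0 ≤ R := Finset.sum_nonneg fun x _ => rabs_nonneg d x
  have t3 : 34 * rabs d i ≤ (S.card - 1) * (36 / n) * rabs d i := by
    refine mul_le_mul_of_nonneg_right ?_ hi0
    rw [mul_div_assoc', le_div_iff₀ (by linarith)]
    linarith
  have t4 : 35 / n * R ≤ (S.card - 1) * (36 / n ^ 2) * R := by
    refine mul_le_mul_of_nonneg_right ?_ hR0
    rw [mul_div_assoc', div_le_div_iff₀ (by linarith) (by positivity)]
    nlinarith
  have t5 : (S.card - 1) * (35 / n * rabs d k) ≤ (S.card - 1) * (36 / n * rabs d k) := by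
    refine mul_le_mul_of_nonneg_left (mul_le_mul_of_nonneg_right ?_ hk0) q.le
    exact div_le_div_of_nonneg_right (by norm_num) (by linarith)
  have t6 := mul_le_mul_of_nonneg_left t2 (show 0 ≤ 35 / n by positivity)
  linarith

end Removal

section Main

variable [Fintype α] {n δ : ℝ}

omit [DecidableEq α] in
lemma sum_four_arrays (q : α → α → ℝ) :
    ∑ i, ∑ k, ∑ j, ∑ l, (q i k + q j l + q i l + q j k)
      = 4 * (Fintype.card α : ℝ) ^ 2 * ∑ i, ∑ j, q i j := by
  have e : ∀ i k : α, ∑ _j : α, ∑ _l : α, q i k = (Fintype.card α : ℝ) ^ 2 * q i k := by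
    intro i k
    simp only [Finset.sum_const, Finset.card_univ, nsmul_eq_mul]
    ring
  have e2 : ∑ _i : α, ∑ _k : α, ∑ j, ∑ l, q j l
      = (Fintype.card α : ℝ) ^ 2 * ∑ i, ∑ j, q i j := by
    simp only [Finset.sum_const, Finset.card_univ, nsmul_eq_mul]
    ring
  have e3 : ∑ i, ∑ _k : α, ∑ _j : α, ∑ l, q i l
      = (Fintype.card α : ℝ) ^ 2 * ∑ i, ∑ j, q i j := by
    simp only [Finset.sum_const, Finset.card_univ, nsmul_eq_mul, ← Finset.mul_sum]
    ring
  have e4 : ∑ _i : α, ∑ k, ∑ j, ∑ _l : α, q j k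
      = (Fintype.card α : ℝ) ^ 2 * ∑ i, ∑ j, q i j := by
    simp only [Finset.sum_const, Finset.card_univ, nsmul_eq_mul, ← Finset.mul_sum]
    rw [Finset.sum_comm]
    ring
  simp only [Finset.sum_add_distrib]
  rw [e2, e3, e4]
  simp only [e, ← Finset.mul_sum]
  ring

omit [DecidableEq α] in
lemma sum_four_vectors (c : α → ℝ) :
    ∑ i, ∑ k, ∑ j, ∑ l, (c i + c k + c j + c l)
      = 4 * (Fintype.card α : ℝ) ^ 3 * ∑ i, c i := by
  simp only [Finset.sum_add_distrib, Finset.sum_const, Finset.card_univ, nsmul_eq_mul,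
    ← Finset.mul_sum]
  ring

lemma qsum_le_sum {H : α → α → α → α → ℝ} (hH : ∀ i k j l, 0 ≤ H i k j l) :
    qsum univ H ≤ ∑ i, ∑ k, ∑ j, ∑ l, H i k j l := by
  have h1 : ∀ i k j (s : Finset α), ∑ l ∈ s, H i k j l ≤ ∑ l, H i k j l := fun i k j s =>
    Finset.sum_le_sum_of_subset_of_nonneg (Finset.subset_univ s) fun _ _ _ => hH _ _ _ _
  have n1 : ∀ i k j, 0 ≤ ∑ l, H i k j l := fun i k j => Finset.sum_nonneg fun _ _ => hH _ _ _ _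
  have n2 : ∀ i k, 0 ≤ ∑ j, ∑ l, H i k j l := fun i k => Finset.sum_nonneg fun _ _ => n1 _ _ _
  refine Finset.sum_le_sum fun i _ => ?_
  refine le_trans (Finset.sum_le_sum fun k _ => ?_)
    (Finset.sum_le_sum_of_subset_of_nonneg (Finset.subset_univ _) fun k _ _ => n2 i k)
  exact le_trans (Finset.sum_le_sum fun j _ => h1 i k j _)
    (Finset.sum_le_sum_of_subset_of_nonneg (Finset.subset_univ _) fun j _ _ => n1 i k j)

/-- An upper bound for the increments `qd`. -/
def sabs (d : α → α → ℝ) (i k j l : α) : ℝ := 2 * (|d i k| + |d j l| + |d i l| + |d j k|)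

omit [Fintype α] [DecidableEq α] in
lemma sabs_nonneg (i k j l : α) : 0 ≤ sabs d i k j l := by
  unfold sabs; positivity

omit [Fintype α] [DecidableEq α] in
lemma abs_pairs_le (i k j l : α) :
    |2 * (d i l + d j k)| + |2 * (d i k + d j l)| ≤ sabs d i k j l := by
  rw [abs_mul, abs_mul, abs_two, sabs]
  linarith [abs_add_le (d i l) (d j k), abs_add_le (d i k) (d j l)]

omit [Fintype α] [DecidableEq α] in
lemma abs_qd_le (i k j l : α) : |qd d i k j l| ≤ sabs d i k j l := by
  have := abs_sub (2 * (d i l + d j k)) (2 * (d i k + d j l))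
  rw [show 2 * (d i l + d j k) - 2 * (d i k + d j l) = qd d i k j l by rw [qd]; ring] at this
  exact this.trans (abs_pairs_le i k j l)

omit [Fintype α] [DecidableEq α] in
lemma sabs_cube_le (i k j l : α) : sabs d i k j l ^ 3
    ≤ 128 * (|d i k| ^ 3 + |d j l| ^ 3 + |d i l| ^ 3 + |d j k| ^ 3) := by
  have := pow_three_add_four |d i k| |d j l| |d i l| |d j k| (abs_nonneg _) (abs_nonneg _)
    (abs_nonneg _) (abs_nonneg _)
  rw [sabs, mul_pow]
  linarith

omit [DecidableEq α] in
lemma sq_mul_rabs_le {s : ℝ} (hs : 0 ≤ s) (i : α) :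
    s ^ 2 * rabs d i ≤ Fintype.card α * s ^ 3 + ∑ y, |d i y| ^ 3 := by
  rw [rabs, Finset.mul_sum, ← Finset.card_univ, ← nsmul_eq_mul, ← Finset.sum_const,
    ← Finset.sum_add_distrib]
  refine Finset.sum_le_sum fun y _ => ?_
  have h0 := abs_nonneg (d i y)
  rcases le_total s |d i y| with h | h
  · have : s ^ 2 * |d i y| ≤ |d i y| ^ 2 * |d i y| := by gcongr
    have : 0 ≤ s ^ 3 := by positivity
    linarith [show |d i y| ^ 3 = |d i y| ^ 2 * |d i y| by ring]
  · have : s ^ 2 * |d i y| ≤ s ^ 2 * s := by gcongr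
    have : 0 ≤ |d i y| ^ 3 := by positivity
    linarith [show s ^ 3 = s ^ 2 * s by ring]

omit [DecidableEq α] in
lemma Std.sum_rabs_le (hd : Std d n δ) : ∑ i, rabs d i ≤ 101 * n ^ 2 * δ := by
  have hδ := hd.pos
  have hn := hd.large
  have h1 : ∀ i j, |d i j| ≤ δ + |d i j| ^ 3 / δ ^ 2 := by
    intro i j
    have h0 := abs_nonneg (d i j)
    rcases le_total |d i j| δ with h | h
    · have : 0 ≤ |d i j| ^ 3 / δ ^ 2 := by positivity
      linarith
    · have : |d i j| ≤ |d i j| ^ 3 / δ ^ 2 := by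
        rw [le_div_iff₀ (by positivity)]
        calc |d i j| * δ ^ 2 ≤ |d i j| * |d i j| ^ 2 := by gcongr
          _ = |d i j| ^ 3 := by ring
      linarith
  have h2 : ∑ i, rabs d i ≤ ∑ i, ∑ j, (δ + |d i j| ^ 3 / δ ^ 2) :=
    Finset.sum_le_sum fun i _ => Finset.sum_le_sum fun j _ => h1 i j
  have h3 : ∑ i, ∑ j, (δ + |d i j| ^ 3 / δ ^ 2) = n ^ 2 * δ + n * δ / δ ^ 2 := by
    rw [← hd.cubes_eq, cubes]
    simp only [Finset.sum_add_distrib, Finset.sum_const, Finset.card_univ, nsmul_eq_mul,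
      ← Finset.sum_div, ← hd.card]
    ring
  have h4 : n * δ / δ ^ 2 ≤ 100 * n ^ 2 * δ := by
    rw [div_le_iff₀ (by positivity)]
    have := mul_le_mul_of_nonneg_left hd.ratio (show 0 ≤ n * δ by positivity)
    nlinarith
  linarith

/-- The comparison of the two sides of Stein's equation on the event that `i` is paired with `k`
and `j` with `l`. -/
lemma Std.abs_term_le (hd : Std d n δ) (h : Inv P univ) (z : ℝ) {i k j l : α} (hik : i ≠ k)
    (hj : j ∈ del univ i k) (hl : l ∈ (del univ i k).erase j) :
    |qd d i k j l * av (fx (fx P i k) j l)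
        (fun π => steinSol z (W d univ π + qd d i k j l) - steinSol z (W d univ π))
      - qd d i k j l ^ 2 * av P (fun π => steinDeriv z (W d univ π))|
      ≤ 47000 * δ * qd d i k j l ^ 2 + (17 * sabs d i k j l ^ 3
        + 36 / n * (sabs d i k j l ^ 2 * rabs d i + sabs d i k j l ^ 2 * rabs d k
          + sabs d i k j l ^ 2 * rabs d j + sabs d i k j l ^ 2 * rabs d l)) := by
  have hn := hd.large
  have hδ := hd.pos
  obtain ⟨hlj, hl1⟩ := Finset.mem_erase.1 hl
  have h1 := h.fix (Finset.mem_univ i) (Finset.mem_univ k) hik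
  have h2 := h1.fix hj hl1 hlj.symm
  have c0 : (univ : Finset α)ᶜ.card = 0 := by simp
  have c1 := card_compl_del_le univ i k
  have c2 := card_compl_del_le (del univ i k) j l
  set T := fx (fx P i k) j l
  set V : Equiv.Perm α → ℝ := W d (del (del univ i k) j l)
  set q := qd d i k j l
  set s := sabs d i k j l
  have hs0 : 0 ≤ s := sabs_nonneg i k j l
  have hqs : |q| ≤ s := abs_qd_le i k j l
  have hq2 : |q| * |q| = q ^ 2 := by rw [← sq, sq_abs]
  have hq2s : q ^ 2 ≤ s ^ 2 := by rw [← sq_abs]; gcongr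
  have a1 : |av T (fun π => steinSol z (W d univ π + q) - steinSol z (W d univ π))
      - q * av T (fun π => steinDeriv z (V π))| ≤ |q| * (17 * s + 13200 * δ) := by
    rw [← av_const_mul, ← av_sub]
    refine (abs_av_le _ _).trans ?_
    have hb : ∀ π ∈ T, |steinSol z (W d univ π + q) - steinSol z (W d univ π)
        - q * steinDeriv z (V π)|
        ≤ |q| * modul z (|2 * (d i l + d j k)| + |2 * (d i k + d j l)|) (V π) := by
      intro π hπ
      obtain ⟨hπ1, hjl⟩ := mem_fx.1 hπ
      obtain ⟨hP, hik'⟩ := mem_fx.1 hπ1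
      have e1 := W_del hd.symm h hP (Finset.mem_univ i)
      have e2 := W_del hd.symm h1 hπ1 hj
      rw [hik'] at e1
      rw [hjl] at e2
      have e3 : W d univ π = V π + 2 * (d i k + d j l) := by
        rw [e1, e2]; ring
      have e4 : W d univ π + q = V π + 2 * (d i l + d j k) := by
        rw [e3]; simp only [q, qd]; ring
      have e5 : q = 2 * (d i l + d j k) - 2 * (d i k + d j l) := by linarith
      have := abs_steinSol_taylor_le z (V π) (2 * (d i l + d j k)) (2 * (d i k + d j l))
      rwa [← e5, ← e3, ← e4] at this
    refine (av_mono hb).trans ?_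
    rw [av_const_mul]
    refine mul_le_mul_of_nonneg_left ?_ (abs_nonneg _)
    refine (hd.av_modul_le h2 (by linarith) z (by positivity)).trans ?_
    linarith [abs_pairs_le (d := d) i k j l]
  have a2 := hd.abs_av_sub_fix_le h (by linarith) z (Finset.mem_univ i) (Finset.mem_univ k) hik
  have a3 := hd.abs_av_sub_fix_le h1 (by linarith) z hj hl1 hlj.symm
  set G0 := av P (fun π => steinDeriv z (W d univ π))
  set G1 := av (fx P i k) (fun π => steinDeriv z (W d (del univ i k) π))
  set G2 := av T (fun π => steinDeriv z (V π))
  set D := av T (fun π => steinSol z (W d univ π + q) - steinSol z (W d univ π))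
  have a4 : |G2 - G0| ≤ 26400 * δ + 36 / n * (rabs d i + rabs d k + rabs d j + rabs d l)
      + 72 / n ^ 2 * ∑ x, rabs d x := by
    have := abs_sub_le G2 G1 G0
    rw [abs_sub_comm G2 G1, abs_sub_comm G1 G0] at this
    have e : 72 / n ^ 2 = 36 / n ^ 2 + 36 / n ^ 2 := by ring
    rw [e]
    linarith
  have a5 : 72 / n ^ 2 * ∑ x, rabs d x ≤ 7272 * δ := by
    rw [div_mul_eq_mul_div, div_le_iff₀ (by positivity)]
    linarith [hd.sum_rabs_le]
  have e : q * D - q ^ 2 * G0 = q * (D - q * G2) + q ^ 2 * (G2 - G0) := by ring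
  have hr := fun x => rabs_nonneg d x
  set r := rabs d i + rabs d k + rabs d j + rabs d l with hrr
  have hr0 : 0 ≤ 36 / n * r := by
    have := hr i; have := hr k; have := hr j; have := hr l
    positivity
  rw [e]
  refine (abs_add_le _ _).trans ?_
  rw [abs_mul, abs_mul, abs_of_nonneg (sq_nonneg q)]
  have b1 := mul_le_mul_of_nonneg_left a1 (abs_nonneg q)
  rw [← mul_assoc, hq2] at b1
  have b2 := mul_le_mul_of_nonneg_left (a4.trans (add_le_add_right a5 _)) (sq_nonneg q)
  have b3 := mul_le_mul_of_nonneg_right hq2s hr0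
  have b4 := mul_le_mul_of_nonneg_right hq2s (show 0 ≤ 17 * s by positivity)
  have b5 : 0 ≤ δ * q ^ 2 := by positivity
  have e6 : 36 / n * (s ^ 2 * rabs d i + s ^ 2 * rabs d k + s ^ 2 * rabs d j + s ^ 2 * rabs d l)
      = s ^ 2 * (36 / n * r) := by rw [hrr]; ring
  rw [e6]
  linarith

lemma Std.sum_error_le (hd : Std d n δ) :
    qsum univ (fun i k j l => 17 * sabs d i k j l ^ 3
        + 36 / n * (sabs d i k j l ^ 2 * rabs d i + sabs d i k j l ^ 2 * rabs d k
          + sabs d i k j l ^ 2 * rabs d j + sabs d i k j l ^ 2 * rabs d l))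
      ≤ 83000 * n ^ 3 * δ := by
  have hn := hd.large
  have hδ := hd.pos
  set c : α → ℝ := fun i => ∑ y, |d i y| ^ 3 with hc
  refine (qsum_le_sum fun i k j l => ?_).trans ?_
  · have := sabs_nonneg (d := d) i k j l
    have := rabs_nonneg d i
    have := rabs_nonneg d k
    have := rabs_nonneg d j
    have := rabs_nonneg d l
    positivity
  have hb : ∀ i k j l, 17 * sabs d i k j l ^ 3
        + 36 / n * (sabs d i k j l ^ 2 * rabs d i + sabs d i k j l ^ 2 * rabs d k
          + sabs d i k j l ^ 2 * rabs d j + sabs d i k j l ^ 2 * rabs d l)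
      ≤ 20608 * (|d i k| ^ 3 + |d j l| ^ 3 + |d i l| ^ 3 + |d j k| ^ 3)
        + 36 / n * (c i + c k + c j + c l) := by
    intro i k j l
    have hs := sabs_nonneg (d := d) i k j l
    have h3 := sabs_cube_le (d := d) i k j l
    have hr := fun x => sq_mul_rabs_le (d := d) hs x
    simp only [← hd.card] at hr
    set s := sabs d i k j l
    have h4 : s ^ 2 * rabs d i + s ^ 2 * rabs d k + s ^ 2 * rabs d j + s ^ 2 * rabs d l
        ≤ 4 * (n * s ^ 3) + (c i + c k + c j + c l) := by
      linarith [hr i, hr k, hr j, hr l]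
    have h5 := mul_le_mul_of_nonneg_left h4 (show 0 ≤ 36 / n by positivity)
    have e : 36 / n * (4 * (n * s ^ 3) + (c i + c k + c j + c l))
        = 144 * s ^ 3 + 36 / n * (c i + c k + c j + c l) := by
      field_simp
      ring
    rw [e] at h5
    linarith
  refine (Finset.sum_le_sum fun i _ => Finset.sum_le_sum fun k _ => Finset.sum_le_sum fun j _ =>
    Finset.sum_le_sum fun l _ => hb i k j l).trans ?_
  have e1 := sum_four_arrays fun i j => |d i j| ^ 3
  have e2 := sum_four_vectors c
  have e3 : ∑ i, ∑ j, |d i j| ^ 3 = n * δ := hd.cubes_eq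
  have e4 : ∑ i, c i = n * δ := hd.cubes_eq
  rw [e3, ← hd.card] at e1
  rw [e4, ← hd.card] at e2
  have e5 : ∑ i, ∑ k, ∑ j, ∑ l, (20608 * (|d i k| ^ 3 + |d j l| ^ 3 + |d i l| ^ 3 + |d j k| ^ 3)
        + 36 / n * (c i + c k + c j + c l))
      = 20608 * (4 * n ^ 2 * (n * δ)) + 36 / n * (4 * n ^ 3 * (n * δ)) := by
    rw [← e1, ← e2]
    simp only [Finset.mul_sum, ← Finset.sum_add_distrib]
  rw [e5, show 36 / n * (4 * n ^ 3 * (n * δ)) = 144 * n ^ 3 * δ by field_simp; ring]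
  have : 0 ≤ n ^ 3 * δ := by positivity
  linarith

lemma Std.av_W_univ (hd : Std d n δ) (h : Inv P univ) :
    tot d univ = 0 ∧ av P (W d univ) = 0 ∧ av P (fun π => W d univ π ^ 2) = 1 := by
  have hn := hd.large
  have hr : ∀ i, row d univ i = 0 := hd.row_zero
  have ht : tot d univ = 0 := Finset.sum_eq_zero fun i _ => hr i
  have hc : ((univ : Finset α).card : ℝ) = n := by rw [Finset.card_univ, hd.card]
  refine ⟨ht, ?_, ?_⟩
  · have := av_W hd.symm hd.diag h
    rw [ht, hc] at this
    exact (mul_eq_zero.1 this).resolve_left (by linarith)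
  · rw [av_W_sq hd.symm hd.diag h (by rw [hc]; linarith)]
    simp only [hr, ht, hc, hd.sqs_eq]
    have : n - 1 ≠ 0 := by linarith
    have : n - 2 ≠ 0 := by linarith
    have : n - 3 ≠ 0 := by linarith
    simp only [ne_eq, OfNat.ofNat_ne_zero, not_false_eq_true, zero_pow, Finset.sum_const_zero]
    field_simp
    ring

/-- Stein's method: the two sides of Stein's equation are close on average. -/
lemma Std.abs_av_stein_le (hd : Std d n δ) (h : Inv P univ) (z : ℝ) :
    |av P (fun π => W d univ π * steinSol z (W d univ π))
      - av P (fun π => steinDeriv z (W d univ π))| ≤ 60000 * δ := by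
  have hn := hd.large
  have hδ := hd.pos
  obtain ⟨ht, hW, hW2⟩ := hd.av_W_univ h
  have hc : ((univ : Finset α).card : ℝ) = n := by rw [Finset.card_univ, hd.card]
  set p : ℝ := (n - 1)⁻¹ * (n - 3)⁻¹ with hp
  have hp0 : 0 ≤ p := mul_nonneg (inv_nonneg.2 (by linarith)) (inv_nonneg.2 (by linarith))
  set A := av P (fun π => W d univ π * steinSol z (W d univ π)) with hA
  set G := av P (fun π => steinDeriv z (W d univ π)) with hG
  have x1 := av_exchange hd.symm hd.diag h (steinSol z)
  have x2 := av_sum_fun_dl h (ψ := fun x => x) (d := d) rfl (fun i k j l π =>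
    steinSol z (W d univ π + qd d i k j l) - steinSol z (W d univ π))
  have x3 : ∀ π ∈ P, ∑ i, ∑ j, dl d i j π * (steinSol z (W d univ π + dl d i j π)
        - steinSol z (W d univ π))
      = ∑ i, ∑ j, dl d i j π * (steinSol z (W d univ π + qd d i (π i) j (π j))
        - steinSol z (W d univ π)) := by
    intro π _
    refine Finset.sum_congr rfl fun i _ => Finset.sum_congr rfl fun j _ => ?_
    by_cases hij : j = i ∨ j = π i
    · rw [dl, if_pos hij, zero_mul, zero_mul]
    · rw [show dl d i j π = qd d i (π i) j (π j) by rw [dl, if_neg hij, qd]]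
  rw [av_congr x3, x2, hc, ht] at x1
  have x4 : av P (fun π => ((n - 1) * W d univ π - 0) * steinSol z (W d univ π))
      = (n - 1) * A := by
    rw [hA, ← av_const_mul]
    exact av_congr fun π _ => by ring
  rw [x4] at x1
  have y1 := av_sum_dl_sq hd.symm hd.diag h
  have y2 := av_sum_fun_dl h (ψ := fun x => x ^ 2) (d := d) (by norm_num)
    (fun _ _ _ _ _ => (1 : ℝ))
  simp only [mul_one] at y2
  rw [y2, hW, hW2, hc] at y1
  have y3 : qsum univ (fun i k j l => qd d i k j l ^ 2 * av (fx (fx P i k) j l) fun _ => 1)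
      = qsum univ (fun i k j l => qd d i k j l ^ 2) := by
    refine Finset.sum_congr rfl fun i hi => Finset.sum_congr rfl fun k hk =>
      Finset.sum_congr rfl fun j hj => Finset.sum_congr rfl fun l hl => ?_
    obtain ⟨hki, hkS⟩ := Finset.mem_erase.1 hk
    obtain ⟨hlj, hlS⟩ := Finset.mem_erase.1 hl
    beta_reduce
    rw [av_const ((h.fix hi hkS hki.symm).fix hj hlS hlj.symm).ne, mul_one]
  rw [y3] at y1
  set Q := qsum univ (fun i k j l => qd d i k j l ^ 2) with hQ
  set X := fun i k j l => qd d i k j l * av (fx (fx P i k) j l)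
    (fun π => steinSol z (W d univ π + qd d i k j l) - steinSol z (W d univ π)) with hX
  set E := fun i k j l => 17 * sabs d i k j l ^ 3
        + 36 / n * (sabs d i k j l ^ 2 * rabs d i + sabs d i k j l ^ 2 * rabs d k
          + sabs d i k j l ^ 2 * rabs d j + sabs d i k j l ^ 2 * rabs d l) with hE
  have t : ∀ i ∈ univ, ∀ k ∈ univ.erase i, ∀ j ∈ del univ i k, ∀ l ∈ (del univ i k).erase j,
      |X i k j l - qd d i k j l ^ 2 * G| ≤ 47000 * δ * qd d i k j l ^ 2 + E i k j l := by
    intro i _ k hk j hj l hl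
    exact hd.abs_term_le h z (Finset.mem_erase.1 hk).1.symm hj hl
  have u1 : qsum univ X ≤ qsum univ (fun i k j l => (G + 47000 * δ) * qd d i k j l ^ 2
      + E i k j l) := by
    refine qsum_mono_fun fun i hi k hk j hj l hl => ?_
    have := (abs_le.1 (t i hi k hk j hj l hl)).2
    linarith
  have u2 : qsum univ (fun i k j l => (G - 47000 * δ) * qd d i k j l ^ 2)
      ≤ qsum univ (fun i k j l => X i k j l + E i k j l) := by
    refine qsum_mono_fun fun i hi k hk j hj l hl => ?_
    have := (abs_le.1 (t i hi k hk j hj l hl)).1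
    linarith
  rw [qsum_add, qsum_const_mul, ← hQ] at u1
  rw [qsum_add, qsum_const_mul, ← hQ] at u2
  have v1 : p * qsum univ X ≤ (G + 47000 * δ) * (p * Q) + p * qsum univ E := by
    linarith [mul_le_mul_of_nonneg_left u1 hp0]
  have v2 : (G - 47000 * δ) * (p * Q) ≤ p * qsum univ X + p * qsum univ E := by
    linarith [mul_le_mul_of_nonneg_left u2 hp0]
  rw [y1, x1] at v1 v2
  have v3 : p * qsum univ E ≤ 8 * (n - 1) * (13000 * δ) := by
    refine (mul_le_mul_of_nonneg_left hd.sum_error_le hp0).trans ?_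
    rw [hp, ← mul_inv, inv_mul_le_iff₀ (mul_pos (by linarith) (by linarith))]
    have w1 : 0.99 * n ≤ n - 1 := by linarith
    have w2 : 0.99 * n ≤ n - 3 := by linarith
    have w3 : (0.99 * n) * (0.99 * n) * (0.99 * n) ≤ (n - 1) * (n - 3) * (n - 1) :=
      mul_le_mul (mul_le_mul w1 w2 (by linarith) (by linarith)) w1 (by linarith)
        (mul_nonneg (by linarith) (by linarith))
    have w4 := mul_le_mul_of_nonneg_right w3 hδ.le
    have : 0 ≤ n ^ 3 * δ := by positivity
    linarith
  have hn1 : 0 < 8 * (n - 1) := by linarith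
  rw [abs_le]
  constructor
  · refine le_of_mul_le_mul_left ?_ hn1
    linarith
  · refine le_of_mul_le_mul_left ?_ hn1
    linarith

lemma Std.abs_cdf_sub_le (hd : Std d n δ) (h : Inv P univ) (z : ℝ) :
    |av P (fun π => if W d univ π ≤ z then 1 else 0) - stdNormalCDF z| ≤ 60000 * δ := by
  have := hd.abs_av_stein_le h z
  have e : av P (fun π => steinDeriv z (W d univ π))
      = av P (fun π => W d univ π * steinSol z (W d univ π))
        + av P (fun π => if W d univ π ≤ z then 1 else 0) - stdNormalCDF z := by
    rw [← av_const h.ne (stdNormalCDF z), ← av_add, ← av_sub]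
    rfl
  rw [e, abs_sub_comm] at this
  convert this using 2
  ring

end Main

lemma inv_fpfInvolutions {n : ℕ} (hn : Even n) : Inv (fpfInvolutions n) univ where
  ne := by
    refine ⟨Fin.revPerm, Finset.mem_filter.2 ⟨Finset.mem_univ _, ?_, fun i h => ?_⟩⟩
    · ext i
      simp
    · have h1 := congrArg Fin.val h
      rw [Fin.revPerm_apply, Fin.val_rev] at h1
      obtain ⟨m, rfl⟩ := hn
      omega
  inv π hπ x := by
    have := (Finset.mem_filter.1 hπ).2.1
    rw [← Equiv.Perm.mul_apply, this, Equiv.Perm.one_apply]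
  fpf π hπ := (Finset.mem_filter.1 hπ).2.2
  maps _ _ _ _ := Finset.mem_univ _
  conj π hπ i _ j _ := by
    obtain ⟨-, h1, h2⟩ := Finset.mem_filter.1 hπ
    refine Finset.mem_filter.2 ⟨Finset.mem_univ _, ?_, fun x h => ?_⟩
    · ext1 x
      rw [Equiv.Perm.mul_apply, cj_apply, cj_apply, Equiv.swap_apply_self,
        ← Equiv.Perm.mul_apply π, h1, Equiv.Perm.one_apply, Equiv.swap_apply_self,
        Equiv.Perm.one_apply]
    · rw [cj_apply, Equiv.swap_apply_eq_iff] at h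
      exact h2 _ h

omit [DecidableEq α] in
lemma sqs_pow_three_le [Fintype α] (d : α → α → ℝ) :
    sqs d univ ^ 3 ≤ (Fintype.card α : ℝ) ^ 2 * cubes d univ ^ 2 := by
  set A := sqs d univ with hA
  set C := cubes d univ with hC
  set R := ∑ p : α × α, |d p.1 p.2| with hR
  have eA : A = ∑ p : α × α, |d p.1 p.2| ^ 2 := by
    rw [hA, sqs, Fintype.sum_prod_type]
    simp only [sq_abs]
  have eC : C = ∑ p : α × α, |d p.1 p.2| ^ 3 := by
    rw [hC, cubes, Fintype.sum_prod_type]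
  have hA0 : 0 ≤ A := by rw [eA]; positivity
  have hC0 : 0 ≤ C := by rw [eC]; positivity
  have hR0 : 0 ≤ R := by positivity
  have h1 : A ^ 2 ≤ R * C := by
    rw [eA, eC]
    exact Finset.sum_sq_le_sum_mul_sum_of_sq_le_mul _ (fun _ _ => abs_nonneg _)
      (fun _ _ => by positivity) fun _ _ => le_of_eq (by ring)
  have h2 : R ^ 2 ≤ (Fintype.card α : ℝ) ^ 2 * A := by
    have := sq_sum_le_card_mul_sum_sq (s := univ) (f := fun p : α × α => |d p.1 p.2|)
    rw [← eA, Finset.card_univ, Fintype.card_prod] at this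
    push_cast at this
    rwa [← sq] at this
  rcases hA0.eq_or_lt with h0 | h0
  · rw [← h0, zero_pow three_ne_zero]
    positivity
  refine le_of_mul_le_mul_right ?_ h0
  calc A ^ 3 * A = (A ^ 2) ^ 2 := by ring
    _ ≤ (R * C) ^ 2 := by gcongr
    _ = R ^ 2 * C ^ 2 := by ring
    _ ≤ (Fintype.card α : ℝ) ^ 2 * A * C ^ 2 := by gcongr
    _ = _ := by ring

lemma std_of_small {n : ℕ} (hn9 : 9 < n) {d : Fin n → Fin n → ℝ}
    (hsymm : ∀ i j, d i j = d j i) (hdiag : ∀ i, d i i = 0) (hrow : ∀ i, ∑ j, d i j = 0)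
    (hvar : 2 * ((n : ℝ) - 2) / (((n : ℝ) - 1) * ((n : ℝ) - 3)) * sqs d univ = 1)
    {δ : ℝ} (hδ : cubes d univ = n * δ) (hsmall : δ ≤ 1 / 60000000) : Std d n δ := by
  have hn : (10 : ℝ) ≤ n := by exact_mod_cast hn9
  have hA : sqs d univ = ((n : ℝ) - 1) * (n - 3) / (2 * (n - 2)) := by
    have : (n : ℝ) - 1 ≠ 0 := by linarith
    have : (n : ℝ) - 2 ≠ 0 := by linarith
    have : (n : ℝ) - 3 ≠ 0 := by linarith
    field_simp at hvar ⊢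
    linarith
  have hA2 : 0.39 * n ≤ sqs d univ := by
    rw [hA, le_div_iff₀ (by linarith)]
    nlinarith
  have hδ0 : 0 ≤ δ := by
    have := cubes_nonneg (d := d) (S := univ)
    rw [hδ] at this
    exact nonneg_of_mul_nonneg_right this (by linarith)
  have hratio : 1 ≤ 100 * n * δ ^ 2 := by
    have h1 := sqs_pow_three_le d
    rw [hδ, Fintype.card_fin] at h1
    have h2 := (pow_le_pow_left₀ (by positivity) hA2 3).trans h1
    have h3 : (n : ℝ) ^ 3 * 0.01 ≤ n ^ 3 * (n * δ ^ 2) := by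
      have : (0 : ℝ) ≤ (n : ℝ) ^ 3 := by positivity
      linarith
    have := le_of_mul_le_mul_left h3 (by positivity)
    linarith
  have hsq : δ ^ 2 ≤ (1 / 60000000) ^ 2 := pow_le_pow_left₀ hδ0 hsmall 2
  have hpos : 0 < δ := by
    refine hδ0.lt_of_ne fun h => ?_
    rw [← h] at hratio
    norm_num at hratio
  refine ⟨hsymm, hdiag, hrow, by simp, ?_, hA, hδ, hpos, hsmall, hratio⟩
  have := mul_le_mul_of_nonneg_left hsq (show (0 : ℝ) ≤ 100 * n by positivity)
  norm_num at this
  linarith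

lemma abs_sub_le_one_of_mem {a b : ℝ} (ha : 0 ≤ a) (ha1 : a ≤ 1) (hb : 0 ≤ b) (hb1 : b ≤ 1) :
    |a - b| ≤ 1 := by
  rw [abs_le]
  constructor <;> linarith

end Matching

/-- L^∞ (Berry–Esseen type) bound for the CLT with fixed-point-free involutions:
`sup_t |F_W(t) − Φ(t)| ≤ 61702446 · β_D / n`. -/
theorem linfty_bound_involutions (n : ℕ) (hn : Even n) (hn9 : 9 < n)
    (d : Fin n → Fin n → ℝ)
    (hsymm : ∀ i j, d i j = d j i) (hdiag : ∀ i, d i i = 0)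
    (hrow : ∀ i, ∑ j, d i j = 0)
    (hvar : 2 * ((n : ℝ) - 2) / (((n : ℝ) - 1) * ((n : ℝ) - 3)) *
      (∑ i, ∑ j, d i j ^ 2) = 1)
    (βD : ℝ) (hβD : βD = ∑ i, ∑ j, if i ≠ j then |d i j| ^ 3 else 0)
    (F : ℝ → ℝ)
    (hF : ∀ t, F t = (((fpfInvolutions n).filter
        (fun π => ∑ i, d i (π i) ≤ t)).card : ℝ) / (fpfInvolutions n).card) :
    ∀ t : ℝ, |F t - stdNormalCDF t| ≤ 61702446 * βD / n := by
  have hn0 : (0 : ℝ) < n := by exact_mod_cast (by omega : 0 < n)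
  have hP := Matching.inv_fpfInvolutions hn
  have hC : Matching.cubes d univ = βD := by
    rw [hβD]
    refine Finset.sum_congr rfl fun i _ => Finset.sum_congr rfl fun j _ => ?_
    split_ifs with hij
    · rfl
    · rw [not_not.1 hij, hdiag]
      norm_num
  have hFav : ∀ t, F t = Matching.av (fpfInvolutions n)
      (fun π => if Matching.W d univ π ≤ t then 1 else 0) := by
    intro t
    rw [hF, Matching.av, Finset.sum_boole]
    rfl
  intro t
  rw [hFav, mul_div_assoc]
  rcases le_or_gt (βD / n) (1 / 61702446) with hs | hs
  · have hd := Matching.std_of_small hn9 hsymm hdiag hrow hvar (δ := βD / n)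
      (by rw [hC]; field_simp) (by linarith)
    have := hd.pos
    exact (hd.abs_cdf_sub_le hP t).trans (by linarith)
  · refine (Matching.abs_sub_le_one_of_mem (Matching.av_nonneg fun π _ => ?_) ?_
      (Matching.cdf_nonneg t) (Matching.cdf_le_one t)).trans (by linarith)
    · split_ifs <;> norm_num
    · refine (Matching.av_mono (G := fun _ => (1 : ℝ)) fun π _ => ?_).trans_eq
        (Matching.av_const hP.ne 1)
      split_ifs <;> norm_num
end
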